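/- arXiv:1609.02743 — 4 statements merged into one kernel-verified Lean document; each statement's English description precedes it below -/
import Mathlib

section
/- Let Ω ⊂ ℝ² be open and bounded. Then there exists a Lipschitz map u : closure(Ω) → ℝ² such that u = 0 at every point of ∂Ω and, for Lebesgue-almost every x ∈ Ω, u is (Fréchet) differentiable at x with derivative Du(x) ∈ E. In particular Du(x) is an orthogonal matrix for a.e. x ∈ Ω, so u solves the Dirichlet problem Du ∈ O(2) a.e. in Ω, u = 0 on ∂Ω. -/
open MeasureTheory Set
open scoped ENNReal NNReal

noncomputable section

/-- The plane `ℝ²`. -/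
abbrev E2 := EuclideanSpace ℝ (Fin 2)

def A1 : Matrix (Fin 2) (Fin 2) ℝ := !![1, 0; 0, 1]
def A2 : Matrix (Fin 2) (Fin 2) ℝ := !![0, 1; 1, 0]
def A3 : Matrix (Fin 2) (Fin 2) ℝ := !![-1, 0; 0, 1]
def A4 : Matrix (Fin 2) (Fin 2) ℝ := !![0, -1; 1, 0]

/-- The set `E = {±A₁, ±A₂, ±A₃, ±A₄}`. -/
def Eset : Set (Matrix (Fin 2) (Fin 2) ℝ) := {A1, -A1, A2, -A2, A3, -A3, A4, -A4}

/-- The continuous linear map on `ℝ²` associated to a `2 × 2` matrix. -/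
def matCLM (A : Matrix (Fin 2) (Fin 2) ℝ) : E2 →L[ℝ] E2 :=
  LinearMap.toContinuousLinearMap (Matrix.toEuclideanLin A)

/-- triangle wave -/
def tw (x : ℝ) : ℝ := |x - 2 * round (x / 2)|

lemma tw_eq (k : ℤ) (x a : ℝ) (h : x = 2 * k + a) (h1 : |a| ≤ 1) : tw x = |a| := by
  unfold tw
  rcases lt_or_ge a 1 with h2 | h2
  · have : round (x / 2) = k := by
      rw [round_eq, Int.floor_eq_iff]
      constructor <;> linarith [(abs_le.1 h1).1]
    rw [this, h]; congr 1; ring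
  · have h3 : a = 1 := le_antisymm (abs_le.1 h1).2 h2
    have : round (x / 2) = k + 1 := by
      rw [round_eq, Int.floor_eq_iff]
      push_cast
      constructor <;> linarith
    rw [this, h, h3]; push_cast; ring_nf; norm_num

lemma tw_eq' (k : ℤ) (x a : ℝ) (h : x = 2 * k + a) (h1 : 1 ≤ |a|) (h2 : |a| ≤ 2) :
    tw x = 2 - |a| := by
  rcases le_total 0 a with h0 | h0
  · rw [abs_of_nonneg h0] at *
    rw [tw_eq (k + 1) x (a - 2) (by push_cast; linarith) (by rw [abs_le]; constructor <;> linarith),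
      abs_of_nonpos (by linarith)]; ring
  · rw [abs_of_nonpos h0] at *
    rw [tw_eq (k - 1) x (a + 2) (by push_cast; linarith) (by rw [abs_le]; constructor <;> linarith),
      abs_of_nonneg (by linarith)]; ring

lemma tw_rep (x : ℝ) : ∃ (k : ℤ) (a : ℝ), x = 2 * k + a ∧ |a| = tw x ∧ |a| ≤ 1 := by
  refine ⟨round (x / 2), x - 2 * round (x / 2), by ring, rfl, ?_⟩
  have := abs_sub_round (x / 2)
  rw [abs_le] at *
  constructor <;> linarith [this.1, this.2]

lemma tw_nonneg (x : ℝ) : 0 ≤ tw x := abs_nonneg _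

lemma tw_le_one (x : ℝ) : tw x ≤ 1 := by
  obtain ⟨k, a, -, h, h1⟩ := tw_rep x
  linarith

lemma tw_le_abs (k : ℤ) (x : ℝ) : tw x ≤ |x - 2 * k| := by
  unfold tw
  have := round_le (x / 2) k
  have e1 : |x - 2 * round (x / 2)| = 2 * |x / 2 - round (x / 2)| := by
    rw [← abs_two, ← abs_mul, abs_two]; congr 1; ring
  have e2 : |x - 2 * k| = 2 * |x / 2 - k| := by
    rw [← abs_two, ← abs_mul, abs_two]; congr 1; ring
  rw [e1, e2]; linarith

lemma tw_lip (x y : ℝ) : |tw x - tw y| ≤ |x - y| := by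
  have key : ∀ x y, tw x - tw y ≤ |x - y| := by
    intro x y
    have h1 := tw_le_abs (round (y / 2)) x
    have h2 : |x - 2 * round (y / 2)| ≤ |x - y| + tw y := by
      unfold tw
      exact abs_sub_le x y _
    linarith
  rw [abs_le]
  have := key y x
  rw [abs_sub_comm] at this
  constructor <;> linarith [key x y]

lemma tw_cont : Continuous tw := by
  refine (LipschitzWith.of_dist_le_mul (K := 1) fun x y => ?_).continuous
  simpa [Real.dist_eq] using tw_lip x y

/-- key folding identity -/
lemma tw_fold (x y : ℝ) (h : tw x + tw y ≤ 1) :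
    (tw (x + y) + tw (x - y)) / 2 = max (tw x) (tw y) ∧
    |tw (x + y) - tw (x - y)| / 2 = min (tw x) (tw y) := by
  obtain ⟨k, a, hk, ha, -⟩ := tw_rep x
  obtain ⟨l, b, hl, hb, -⟩ := tw_rep y
  rw [← ha, ← hb] at h ⊢
  rw [tw_eq (k + l) (x + y) (a + b) (by push_cast; linarith) ((abs_add_le a b).trans h),
    tw_eq (k - l) (x - y) (a - b) (by push_cast; linarith) ((abs_sub a b).trans h)]
  clear ha hb hk hl h
  constructor <;>
  rcases le_total 0 a with ha | ha <;> rcases le_total 0 b with hb | hb <;>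
  rcases le_total 0 (a + b) with hc | hc <;> rcases le_total 0 (a - b) with hd | hd <;>
  simp only [abs_of_nonneg, abs_of_nonpos, ha, hb, hc, hd] <;>
  grind

/-- sorted fold map -/
def F0 (p : E2) : E2 := !₂[max (tw (p 0)) (tw (p 1)), min (tw (p 0)) (tw (p 1))]

def Nm : E2 →L[ℝ] E2 := matCLM !![1, 1; 1, -1]
def Mm : E2 →L[ℝ] E2 := matCLM !![1/2, 1/2; 1/2, -1/2]

lemma matCLM_apply (a b c d : ℝ) (p : E2) :
    matCLM !![a, b; c, d] p = !₂[a * p 0 + b * p 1, c * p 0 + d * p 1] := by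
  ext i
  fin_cases i <;> simp [matCLM, Matrix.toLpLin_apply, Matrix.mulVec, dotProduct, Fin.sum_univ_two]

lemma MN : Mm * Nm = 1 := by
  ext p i
  fin_cases i <;> simp [Mm, Nm, matCLM_apply] <;> ring

lemma MNpow (n : ℕ) : Mm ^ n * Nm ^ n = 1 := pow_mul_pow_eq_one n MN

def q : ℝ := √(1/2)
lemma q_sq : q ^ 2 = 1/2 := Real.sq_sqrt (by norm_num)
lemma q_pos : 0 < q := Real.sqrt_pos.2 (by norm_num)
lemma q_lt : q < 0.71 := by
  have := q_sq; have := q_pos; nlinarith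

lemma nsq (p : E2) : ‖p‖ ^ 2 = (p 0) ^ 2 + (p 1) ^ 2 := by
  simp [EuclideanSpace.norm_sq_eq, Fin.sum_univ_two]

lemma norm_Mm (p : E2) : ‖Mm p‖ = q * ‖p‖ := by
  have : ‖Mm p‖ ^ 2 = (q * ‖p‖) ^ 2 := by
    rw [mul_pow, q_sq, nsq, nsq]
    simp [Mm, matCLM_apply]; ring
  exact (sq_eq_sq₀ (norm_nonneg _) (mul_nonneg q_pos.le (norm_nonneg _))).1 this

lemma norm_Mpow (n : ℕ) (p : E2) : ‖(Mm ^ n) p‖ = q ^ n * ‖p‖ := by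
  induction n with
  | zero => simp
  | succ n ih => rw [pow_succ', mul_apply_eq_comp, norm_Mm, ih]; ring

lemma MNp (n : ℕ) (p : E2) : (Mm ^ n) ((Nm ^ n) p) = p := by
  rw [← mul_apply_eq_comp, MNpow]; rfl

lemma norm_Npow (n : ℕ) (p : E2) : q ^ n * ‖(Nm ^ n) p‖ = ‖p‖ := by
  rw [← norm_Mpow, MNp]

lemma F0_lip (p r : E2) : ‖F0 p - F0 r‖ ≤ ‖p - r‖ := by
  have h : ‖F0 p - F0 r‖ ^ 2 ≤ ‖p - r‖ ^ 2 := by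
    rw [nsq, nsq]
    have h1 := sq_le_sq.2 (tw_lip (p 0) (r 0))
    have h2 := sq_le_sq.2 (tw_lip (p 1) (r 1))
    simp only [F0, PiLp.sub_apply, PiLp.toLp_apply, Matrix.cons_val_zero, Matrix.cons_val_one]
    refine le_trans ?_ (add_le_add h1 h2)
    generalize tw (p 0) = a
    generalize tw (p 1) = b
    generalize tw (r 0) = c
    generalize tw (r 1) = d
    rcases le_total a b with h | h <;> rcases le_total c d with h' | h' <;>
    simp only [max_eq_left, max_eq_right, min_eq_left, min_eq_right, h, h'] <;>
    nlinarith [mul_nonneg (sub_nonneg.2 h) (sub_nonneg.2 h')]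
  exact (sq_le_sq₀ (norm_nonneg _) (norm_nonneg _)).1 h

lemma F0_bd (p : E2) : ‖F0 p‖ ≤ 2 := by
  have h : ‖F0 p‖ ^ 2 ≤ 2 ^ 2 := by
    rw [nsq]
    simp only [F0, PiLp.toLp_apply, Matrix.cons_val_zero, Matrix.cons_val_one]
    have := tw_nonneg (p 0); have := tw_nonneg (p 1)
    have := tw_le_one (p 0); have := tw_le_one (p 1)
    have : max (tw (p 0)) (tw (p 1)) ≤ 1 := max_le ‹_› ‹_›
    have : min (tw (p 0)) (tw (p 1)) ≤ 1 := min_le_of_left_le ‹_›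
    have : 0 ≤ max (tw (p 0)) (tw (p 1)) := le_max_of_le_left ‹_›
    have : 0 ≤ min (tw (p 0)) (tw (p 1)) := le_min ‹_› ‹_›
    nlinarith
  exact (sq_le_sq₀ (norm_nonneg _) (by norm_num)).1 h

def Fn (n : ℕ) (p : E2) : E2 := (Mm ^ n) (F0 ((Nm ^ n) p))

lemma Fn_lip (n : ℕ) (p r : E2) : ‖Fn n p - Fn n r‖ ≤ ‖p - r‖ := by
  unfold Fn
  rw [← map_sub, norm_Mpow, ← norm_Npow n (p - r), map_sub]
  exact mul_le_mul_of_nonneg_left (F0_lip _ _) (pow_nonneg q_pos.le n)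

lemma Fn_bd (n : ℕ) (p : E2) : ‖Fn n p‖ ≤ q ^ n * 2 := by
  unfold Fn
  rw [norm_Mpow]
  exact mul_le_mul_of_nonneg_left (F0_bd _) (pow_nonneg q_pos.le n)

def Sset : Set E2 := {p | 1 < tw (p 0) + tw (p 1)}

lemma twsum_cont : Continuous fun p : E2 => tw (p 0) + tw (p 1) :=
  (tw_cont.comp (by fun_prop)).add (tw_cont.comp (by fun_prop))

lemma Sset_open : IsOpen Sset := isOpen_lt continuous_const twsum_cont

lemma Fn_succ_eq (n : ℕ) (p : E2) (h : (Nm ^ n) p ∉ Sset) : Fn (n + 1) p = Fn n p := by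
  unfold Fn
  rw [pow_succ, pow_succ', mul_apply_eq_comp, mul_apply_eq_comp]
  congr 1
  generalize (Nm ^ n) p = z at *
  have h' : tw (z 0) + tw (z 1) ≤ 1 := not_lt.1 h
  obtain ⟨h1, h2⟩ := tw_fold _ _ h'
  unfold F0
  rw [← h1, ← h2]
  have e0 : (Nm z) 0 = z 0 + z 1 := by simp [Nm, matCLM_apply]
  have e1 : (Nm z) 1 = z 0 - z 1 := by simp [Nm, matCLM_apply]; ring
  rw [e0, e1, Mm, matCLM_apply]
  generalize tw (z 0 + z 1) = a
  generalize tw (z 0 - z 1) = b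
  ext i
  fin_cases i <;> simp <;> rcases le_total a b with h | h <;> simp [h]
  · ring
  · ring
  · rw [abs_of_nonpos (by linarith)]; ring
  · rw [abs_of_nonneg (by linarith)]; ring

def cen (z : E2) : E2 := !₂[2 * (⌊z 0 / 2⌋ : ℝ), 2 * (⌊z 1 / 2⌋ : ℝ)]

lemma cen_bd (z : E2) : ‖cen z - z‖ ≤ 3 := by
  have h : ‖cen z - z‖ ^ 2 ≤ 3 ^ 2 := by
    rw [nsq]
    simp only [cen, PiLp.sub_apply, PiLp.toLp_apply, Matrix.cons_val_zero, Matrix.cons_val_one]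
    have := Int.floor_le (z 0 / 2)
    have := Int.lt_floor_add_one (z 0 / 2)
    have := Int.floor_le (z 1 / 2)
    have := Int.lt_floor_add_one (z 1 / 2)
    nlinarith
  exact (sq_le_sq₀ (norm_nonneg _) (by norm_num)).1 h

lemma floor_loc (x : ℝ) (h : ∀ k : ℤ, x ≠ k) : ∀ᶠ y in nhds x, ⌊y⌋ = ⌊x⌋ := by
  have h1 : (⌊x⌋ : ℝ) < x := lt_of_le_of_ne (Int.floor_le x) (h _).symm
  filter_upwards [Ioo_mem_nhds h1 (Int.lt_floor_add_one x)] with y hy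
  rw [Int.floor_eq_iff]
  exact ⟨hy.1.le, hy.2⟩

lemma Sset_ne (z : E2) (hz : z ∈ Sset) : (∀ k : ℤ, z 0 / 2 ≠ k) ∧ (∀ k : ℤ, z 1 / 2 ≠ k) := by
  have hz' : 1 < tw (z 0) + tw (z 1) := hz
  constructor
  · intro k hk
    have := tw_eq k (z 0) 0 (by linarith) (by simp)
    have := tw_le_one (z 1)
    simp at *; linarith
  · intro k hk
    have := tw_eq k (z 1) 0 (by linarith) (by simp)
    have := tw_le_one (z 0)
    simp at *; linarith

lemma cen_loc (z : E2) (hz : z ∈ Sset) : ∀ᶠ w in nhds z, cen w = cen z := by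
  obtain ⟨h0, h1⟩ := Sset_ne z hz
  have c0 : Continuous fun w : E2 => w 0 / 2 := by fun_prop
  have c1 : Continuous fun w : E2 => w 1 / 2 := by fun_prop
  filter_upwards [c0.continuousAt.eventually (floor_loc _ h0),
    c1.continuousAt.eventually (floor_loc _ h1)] with w hw0 hw1
  simp only [cen, hw0, hw1]

/-- null set of bad points -/
def Bad : Set E2 := {p | (∃ k : ℤ, p 0 = k) ∨ (∃ k : ℤ, p 1 = k) ∨ (∃ k : ℤ, p 0 + p 1 = k) ∨
  (∃ k : ℤ, p 0 - p 1 = k)}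

lemma line_null (a b c : ℝ) (hab : a ≠ 0 ∨ b ≠ 0) :
    volume {p : E2 | a * p 0 + b * p 1 = c} = 0 := by
  let ℓ : E2 →L[ℝ] ℝ := a • EuclideanSpace.proj 0 + b • EuclideanSpace.proj 1
  have hℓ : ∀ p, ℓ p = a * p 0 + b * p 1 := fun p => by simp [ℓ]
  let S : AffineSubspace ℝ E2 := (AffineSubspace.mk' c (⊥ : Submodule ℝ ℝ)).comap
    (ℓ : E2 →ₗ[ℝ] ℝ).toAffineMap
  have hS : (S : Set E2) = {p : E2 | a * p 0 + b * p 1 = c} := by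
    ext p
    simp [S, AffineSubspace.mem_mk', sub_eq_zero, hℓ]
  rw [← hS]
  apply Measure.addHaar_affineSubspace
  intro htop
  have hall : ∀ p : E2, a * p 0 + b * p 1 = c := by
    intro p
    have : p ∈ (S : Set E2) := by rw [htop]; trivial
    rw [hS] at this; exact this
  have z := hall 0
  have x := hall !₂[1, 0]
  have y := hall !₂[0, 1]
  simp at x y z
  rcases hab with h | h
  · apply h; linarith
  · apply h; linarith

lemma Bad_null : volume Bad = 0 := by
  have : Bad ⊆ ⋃ k : ℤ, ({p : E2 | 1 * p 0 + 0 * p 1 = k} ∪ {p : E2 | 0 * p 0 + 1 * p 1 = k} ∪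
      {p : E2 | 1 * p 0 + 1 * p 1 = k} ∪ {p : E2 | 1 * p 0 + (-1) * p 1 = k}) := by
    rintro p (⟨k, hk⟩ | ⟨k, hk⟩ | ⟨k, hk⟩ | ⟨k, hk⟩) <;> rw [mem_iUnion] <;> refine ⟨k, ?_⟩
    · left; left; left; simpa using hk
    · left; left; right; simpa using hk
    · left; right; simpa using hk
    · right; simp only [mem_ofPred_eq]; linarith
  refine measure_mono_null this (measure_iUnion_null fun k => ?_)
  simp only [measure_union_null_iff]
  refine ⟨⟨⟨?_, ?_⟩, ?_⟩, ?_⟩ <;> apply line_null <;> simp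

lemma preN_null (n : ℕ) (s : Set E2) (hs : volume s = 0) : volume ((Nm ^ n) ⁻¹' s) = 0 := by
  have hdet : LinearMap.det ((Nm ^ n : E2 →L[ℝ] E2) : E2 →ₗ[ℝ] E2) ≠ 0 := by
    intro h
    have h2 : LinearMap.det (((Mm ^ n : E2 →L[ℝ] E2) : E2 →ₗ[ℝ] E2) *
      ((Nm ^ n : E2 →L[ℝ] E2) : E2 →ₗ[ℝ] E2)) = 1 := by
      have : (((Mm ^ n : E2 →L[ℝ] E2) : E2 →ₗ[ℝ] E2) *
        ((Nm ^ n : E2 →L[ℝ] E2) : E2 →ₗ[ℝ] E2)) = 1 := by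
        ext1 p; exact MNp n p
      rw [this, map_one]
    rw [map_mul, h, mul_zero] at h2
    exact zero_ne_one h2
  have := Measure.addHaar_preimage_linearMap volume hdet s
  rw [hs, mul_zero] at this
  exact this

def Good (u : E2 → E2) : Prop := ∀ᵐ x ∂(volume : Measure E2), ∃ A ∈ Eset, HasFDerivAt u (matCLM A) x

lemma conj_E (A : Matrix (Fin 2) (Fin 2) ℝ) (hA : A ∈ Eset) :
    ∃ B ∈ Eset, matCLM B = Mm * matCLM A * Nm := by
  have key : ∀ a b c d : ℝ, Mm * matCLM !![a, b; c, d] * Nm =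
      matCLM !![(a + b + c + d)/2, (a - b + c - d)/2; (a + b - c - d)/2, (a - b - c + d)/2] := by
    intro a b c d
    ext p i
    simp only [mul_apply_eq_comp, Mm, Nm, matCLM_apply]
    fin_cases i <;> simp <;> ring
  simp only [Eset, mem_insert_iff, mem_singleton_iff] at hA
  rcases hA with h | h | h | h | h | h | h | h <;> subst h <;>
    simp only [A1, A2, A3, A4, Matrix.neg_of, Matrix.neg_cons, Matrix.neg_empty] <;>
    rw [key] <;> refine ⟨_, ?_, rfl⟩ <;>
    simp [Eset, A1, A2, A3, A4, ← Matrix.ext_iff, Fin.forall_fin_two] <;> norm_num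

lemma tw_loc (x : ℝ) (h : ∀ k : ℤ, x ≠ k) : ∃ e c : ℝ, (e = 1 ∨ e = -1) ∧
    ∀ᶠ y in nhds x, tw y = e * y + c := by
  have h1 : (⌊x⌋ : ℝ) < x := lt_of_le_of_ne (Int.floor_le x) (h _).symm
  have hn := Ioo_mem_nhds h1 (Int.lt_floor_add_one x)
  rcases Int.even_or_odd' ⌊x⌋ with ⟨k, hk | hk⟩
  · refine ⟨1, -2 * k, Or.inl rfl, ?_⟩
    filter_upwards [hn] with y hy
    rw [hk] at hy; push_cast at hy
    rw [tw_eq k y (y - 2 * k) (by ring) (by rw [abs_le]; constructor <;> linarith [hy.1, hy.2]),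
      abs_of_nonneg (by linarith [hy.1])]; ring
  · refine ⟨-1, 2 * k + 2, Or.inr rfl, ?_⟩
    filter_upwards [hn] with y hy
    rw [hk] at hy; push_cast at hy
    rw [tw_eq (k+1) y (y - 2 * k - 2) (by push_cast; ring)
      (by rw [abs_le]; constructor <;> linarith [hy.1, hy.2]),
      abs_of_nonpos (by linarith [hy.2])]; ring

lemma tw_abs_eq (x y : ℝ) (h : tw x = tw y) : (∃ k : ℤ, x + y = k) ∨ ∃ k : ℤ, x - y = k := by
  obtain ⟨k, a, hk, ha, -⟩ := tw_rep x
  obtain ⟨l, b, hl, hb, -⟩ := tw_rep y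
  rw [← ha, ← hb] at h
  rcases abs_eq_abs.1 h with h | h
  · right; exact ⟨2 * k - 2 * l, by push_cast; linarith⟩
  · left; exact ⟨2 * k + 2 * l, by push_cast; linarith⟩

lemma tw_sum_one (x y : ℝ) (h : tw x + tw y = 1) :
    (∃ k : ℤ, x + y = k) ∨ ∃ k : ℤ, x - y = k := by
  obtain ⟨k, a, hk, ha, -⟩ := tw_rep x
  obtain ⟨l, b, hl, hb, -⟩ := tw_rep y
  rw [← ha, ← hb] at h
  rcases le_total 0 a with h1 | h1 <;> rcases le_total 0 b with h2 | h2 <;>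
    simp only [abs_of_nonneg, abs_of_nonpos, h1, h2] at h
  · left; exact ⟨2 * k + 2 * l + 1, by push_cast; linarith⟩
  · right; exact ⟨2 * k - 2 * l + 1, by push_cast; linarith⟩
  · right; exact ⟨2 * k - 2 * l - 1, by push_cast; linarith⟩
  · left; exact ⟨2 * k + 2 * l - 1, by push_cast; linarith⟩

lemma F0_good : Good F0 := by
  have hb : ∀ᵐ x ∂(volume : Measure E2), x ∉ Bad := measure_eq_zero_iff_ae_notMem.1 Bad_null
  filter_upwards [hb] with p hp
  simp only [Bad, mem_ofPred_eq, not_or, not_exists] at hp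
  obtain ⟨h0, h1, h2, h3⟩ := hp
  obtain ⟨e, c, he, hc⟩ := tw_loc _ h0
  obtain ⟨f, d, hf, hd⟩ := tw_loc _ h1
  have c0 : Continuous fun w : E2 => w 0 := by fun_prop
  have c1 : Continuous fun w : E2 => w 1 := by fun_prop
  have hc' := c0.continuousAt.eventually hc
  have hd' := c1.continuousAt.eventually hd
  have ct0 := tw_cont.comp c0
  have ct1 := tw_cont.comp c1
  have aff : ∀ A : Matrix (Fin 2) (Fin 2) ℝ, ∀ b : E2,
      HasFDerivAt (fun w => matCLM A w + b) (matCLM A) p := fun A b =>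
    (matCLM A).hasFDerivAt.add_const b
  have hne : tw (p 0) ≠ tw (p 1) := by
    intro h
    rcases tw_abs_eq _ _ h with ⟨k, hk⟩ | ⟨k, hk⟩
    · exact h2 k hk
    · exact h3 k hk
  rcases lt_or_gt_of_ne hne with hlt | hlt
  · refine ⟨!![0, f; e, 0], ?_, (aff _ !₂[d, c]).congr_of_eventuallyEq ?_⟩
    · rcases he with rfl | rfl <;> rcases hf with rfl | rfl <;>
      simp [Eset, A1, A2, A3, A4, ← Matrix.ext_iff, Fin.forall_fin_two] <;> norm_num
    · filter_upwards [hc', hd', (isOpen_lt ct0 ct1).mem_nhds hlt] with w hw0 hw1 hw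
      have hw' : tw (w 0) < tw (w 1) := hw
      rw [F0, max_eq_right hw'.le, min_eq_left hw'.le, hw0, hw1, matCLM_apply]
      ext i; fin_cases i <;> simp
  · refine ⟨!![e, 0; 0, f], ?_, (aff _ !₂[c, d]).congr_of_eventuallyEq ?_⟩
    · rcases he with rfl | rfl <;> rcases hf with rfl | rfl <;>
      simp [Eset, A1, A2, A3, A4, ← Matrix.ext_iff, Fin.forall_fin_two] <;> norm_num
    · filter_upwards [hc', hd', (isOpen_lt ct1 ct0).mem_nhds hlt] with w hw0 hw1 hw
      have hw' : tw (w 1) < tw (w 0) := hw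
      rw [F0, max_eq_left hw'.le, min_eq_right hw'.le, hw0, hw1, matCLM_apply]
      ext i; fin_cases i <;> simp

lemma Fn_good (n : ℕ) : Good (Fn n) := by
  induction n with
  | zero => exact F0_good
  | succ n ih =>
    have e : Fn (n + 1) = fun x => Mm (Fn n (Nm x)) := by
      ext1 x
      unfold Fn
      rw [pow_succ Nm, pow_succ' Mm]; rfl
    have h0 := preN_null 1 _ ih
    rw [pow_one] at h0
    rw [e]
    have h1 : ∀ᵐ x ∂(volume : Measure E2), ∃ A ∈ Eset, HasFDerivAt (Fn n) (matCLM A) (Nm x) := h0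
    filter_upwards [h1] with x hx
    obtain ⟨A, hA, hd⟩ := hx
    obtain ⟨B, hB, hBe⟩ := conj_E A hA
    refine ⟨B, hB, ?_⟩
    rw [hBe, mul_assoc]
    have h2 : HasFDerivAt (fun y => Nm y) Nm x := Nm.hasFDerivAt
    have h3 : HasFDerivAt (fun y => Fn n (Nm y)) ((matCLM A).comp Nm) x :=
      HasFDerivAt.comp (g := Fn n) (f := fun y => Nm y) x hd h2
    have h4 : HasFDerivAt (fun y => Mm y) Mm (Fn n (Nm x)) := Mm.hasFDerivAt
    exact HasFDerivAt.comp (g := fun y => Mm y) (f := fun y => Fn n (Nm y)) x h4 h3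

/-- gluing of 1-Lipschitz maps -/
lemma glue_lip (W : Set E2) [DecidablePred (· ∈ W)] (f g : E2 → E2)
    (hf : ∀ x y, ‖f x - f y‖ ≤ ‖x - y‖) (hg : ∀ x y, ‖g x - g y‖ ≤ ‖x - y‖)
    (h : ∀ x ∈ frontier W, f x = g x) (x y : E2) :
    ‖W.piecewise f g x - W.piecewise f g y‖ ≤ ‖x - y‖ := by
  have key : ∀ x y, x ∈ W → y ∉ W → ‖f x - g y‖ ≤ ‖x - y‖ := by
    intro x y hx hy
    have hseg : IsPreconnected (segment ℝ x y) := (convex_segment x y).isPreconnected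
    obtain ⟨z, hz, hzf⟩ : (segment ℝ x y ∩ frontier W).Nonempty := by
      by_contra hne
      rw [not_nonempty_iff_eq_empty] at hne
      have := hseg.subset_or_subset (u := interior W) (v := (closure W)ᶜ) isOpen_interior
        isClosed_closure.isOpen_compl
        (disjoint_compl_right.mono_left (interior_subset.trans subset_closure))
        (by
          intro z hz
          by_contra hcon
          simp only [mem_union, mem_compl_iff, not_or, not_not] at hcon
          have : z ∈ segment ℝ x y ∩ frontier W := ⟨hz, hcon.2, hcon.1⟩
          rw [hne] at this; exact this)
      rcases this with h1 | h1
      · exact hy (interior_subset (h1 (right_mem_segment ℝ x y)))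
      · exact h1 (left_mem_segment ℝ x y) (subset_closure hx)
    have hd := dist_add_dist_of_mem_segment hz
    simp only [dist_eq_norm] at hd
    calc ‖f x - g y‖ = ‖(f x - f z) + (g z - g y)‖ := by rw [h z hzf]; congr 1; abel
      _ ≤ ‖f x - f z‖ + ‖g z - g y‖ := norm_add_le _ _
      _ ≤ ‖x - z‖ + ‖z - y‖ := add_le_add (hf _ _) (hg _ _)
      _ = ‖x - y‖ := hd
  by_cases hx : x ∈ W <;> by_cases hy : y ∈ W <;> simp only [piecewise, hx, hy, if_true, if_false]
  · exact hf x y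
  · exact key x y hx hy
  · rw [norm_sub_rev, norm_sub_rev x]; exact key y x hy hx
  · exact hg x y

lemma glue_good (W : Set E2) [DecidablePred (· ∈ W)] (f g : E2 → E2) (hf : Good f) (hg : Good g)
    (h : volume (frontier W) = 0) : Good (W.piecewise f g) := by
  filter_upwards [hf, hg, measure_eq_zero_iff_ae_notMem.1 h] with x hfx hgx hx
  by_cases hi : x ∈ interior W
  · obtain ⟨A, hA, hd⟩ := hfx
    refine ⟨A, hA, hd.congr_of_eventuallyEq ?_⟩
    filter_upwards [mem_interior_iff_mem_nhds.1 hi] with y hy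
    simp [piecewise, hy]
  · have hc : x ∈ (closure W)ᶜ := fun hc => hx ⟨hc, hi⟩
    obtain ⟨A, hA, hd⟩ := hgx
    refine ⟨A, hA, hd.congr_of_eventuallyEq ?_⟩
    filter_upwards [isClosed_closure.isOpen_compl.mem_nhds hc] with y hy
    have : y ∉ W := fun h => hy (subset_closure h)
    simp [piecewise, this]

def cn (n : ℕ) (x : E2) : E2 := (Mm ^ n) (cen ((Nm ^ n) x))

lemma cn_bd (n : ℕ) (x : E2) : dist (cn n x) x ≤ q ^ n * 3 := by
  have : cn n x - x = (Mm ^ n) (cen ((Nm ^ n) x) - (Nm ^ n) x) := by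
    rw [map_sub, MNp]; rfl
  rw [dist_eq_norm, this, norm_Mpow]
  exact mul_le_mul_of_nonneg_left (cen_bd _) (pow_nonneg q_pos.le n)

def Wn (K : Set E2) (n : ℕ) : Set E2 :=
  {x | (Nm ^ n) x ∈ Sset ∧ Metric.infDist (cn n x) K < q ^ n * 25}

lemma Wn_near (K : Set E2) (n : ℕ) (x : E2) (hx : x ∈ Wn K n) :
    Metric.infDist x K < q ^ n * 28 := by
  have h1 := Metric.infDist_le_infDist_add_dist (s := K) (x := x) (y := cn n x)
  have h2 := cn_bd n x
  rw [dist_comm] at h2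
  linarith [hx.2]

lemma Wn_closure (K : Set E2) (n : ℕ) (x : E2) (hx : x ∈ closure (Wn K n)) :
    Metric.infDist x K < q ^ n * 30 := by
  have hc : IsClosed {x | Metric.infDist x K ≤ q ^ n * 28} :=
    isClosed_le (Metric.continuous_infDist_pt K) continuous_const
  have : Metric.infDist x K ≤ q ^ n * 28 :=
    closure_minimal (fun y hy => (Wn_near K n y hy).le) hc hx
  have := pow_pos q_pos n
  linarith

lemma Wn_frontier (K : Set E2) (n : ℕ) (x : E2) (hx : x ∈ frontier (Wn K n)) :
    (Nm ^ n) x ∉ Sset := by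
  intro hS
  have hcont : ContinuousAt (fun x => (Nm ^ n) x) x := (Nm ^ n).continuous.continuousAt
  have e1 := hcont.eventually (Sset_open.mem_nhds hS)
  have e2 := hcont.eventually (cen_loc _ hS)
  by_cases hW : x ∈ Wn K n
  · apply hx.2
    rw [mem_interior_iff_mem_nhds]
    filter_upwards [e1, e2] with y h1 h2
    refine ⟨h1, ?_⟩
    have : cn n y = cn n x := by unfold cn; rw [h2]
    rw [this]; exact hW.2
  · have : (Wn K n)ᶜ ∈ nhds x := by
      filter_upwards [e1, e2] with y h1 h2 hy
      apply hW
      refine ⟨hS, ?_⟩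
      have : cn n y = cn n x := by unfold cn; rw [h2]
      rw [← this]; exact hy.2
    obtain ⟨y, hy, hy'⟩ := mem_closure_iff_nhds.1 hx.1 _ this
    exact hy hy'

lemma Wn_null (K : Set E2) (n : ℕ) : volume (frontier (Wn K n)) = 0 := by
  refine measure_mono_null ?_ (preN_null n _ Bad_null)
  intro x hx
  have h1 := Wn_frontier K n x hx
  have h1' : tw (((Nm ^ n) x) 0) + tw (((Nm ^ n) x) 1) ≤ 1 := not_lt.1 h1
  have h2 : 1 ≤ tw (((Nm ^ n) x) 0) + tw (((Nm ^ n) x) 1) := by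
    have hc : IsClosed {x | 1 ≤ tw (((Nm ^ n) x) 0) + tw (((Nm ^ n) x) 1)} :=
      isClosed_le continuous_const (twsum_cont.comp (Nm ^ n).continuous)
    exact closure_minimal (fun y hy => le_of_lt (show 1 < tw (((Nm ^ n) y) 0) + tw (((Nm ^ n) y) 1) from hy.1)) hc hx.1
  rcases tw_sum_one _ _ (le_antisymm h1' h2) with h | h
  · exact Or.inr (Or.inr (Or.inl h))
  · exact Or.inr (Or.inr (Or.inr h))

open Classical in
def un (K : Set E2) : ℕ → E2 → E2
  | 0 => Fn 0
  | n + 1 => (Wn K n).piecewise (Fn (n + 1)) (un K n)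

lemma un_mem (K : Set E2) (n : ℕ) (x : E2) (h : x ∈ Wn K n) : un K (n + 1) x = Fn (n + 1) x := by
  simp [un, h]

lemma un_not_mem (K : Set E2) (n : ℕ) (x : E2) (h : x ∉ Wn K n) : un K (n + 1) x = un K n x := by
  simp [un, h]

lemma un_near (K : Set E2) (n : ℕ) (x : E2) (h : Metric.infDist x K < q ^ n * 30) :
    un K n x = Fn n x := by
  induction n with
  | zero => rfl
  | succ n ih =>
    have hp := pow_pos q_pos n
    have h' : Metric.infDist x K < q ^ n * (0.71 * 30) := by
      refine h.trans ?_
      rw [pow_succ, mul_assoc]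
      exact mul_lt_mul_of_pos_left (by linarith [q_lt]) hp
    by_cases hS : (Nm ^ n) x ∈ Sset
    · apply un_mem
      refine ⟨hS, ?_⟩
      have h1 := Metric.infDist_le_infDist_add_dist (s := K) (x := cn n x) (y := x)
      have h2 := cn_bd n x
      linarith
    · rw [un_not_mem K n x (fun hW => hS hW.1), Fn_succ_eq n x hS]
      exact ih (by linarith)

lemma un_lip (K : Set E2) (n : ℕ) : ∀ x y, ‖un K n x - un K n y‖ ≤ ‖x - y‖ := by
  induction n with
  | zero => exact Fn_lip 0
  | succ n ih =>
    classical
    intro x y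
    apply glue_lip _ _ _ (Fn_lip (n + 1)) ih
    intro z hz
    rw [un_near K n z (Wn_closure K n z hz.1), Fn_succ_eq n z (Wn_frontier K n z hz)]

lemma un_good (K : Set E2) (n : ℕ) : Good (un K n) := by
  induction n with
  | zero => exact Fn_good 0
  | succ n ih =>
    classical
    exact glue_good _ _ _ (Fn_good (n + 1)) ih (Wn_null K n)

lemma un_stable (K : Set E2) (N n : ℕ) (hn : N ≤ n) (x : E2)
    (h : q ^ N * 30 < Metric.infDist x K) : un K n x = un K N x := by
  induction n, hn using Nat.le_induction with
  | base => rfl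
  | succ n hn ih =>
    rw [un_not_mem, ih]
    intro hW
    have h1 := Wn_near K n x hW
    have h2 : q ^ n ≤ q ^ N := pow_le_pow_of_le_one q_pos.le (by linarith [q_lt]) hn
    have := pow_pos q_pos n
    linarith

lemma q_tendsto : Filter.Tendsto (fun n : ℕ => q ^ n) Filter.atTop (nhds 0) :=
  tendsto_pow_atTop_nhds_zero_of_lt_one q_pos.le (by linarith [q_lt])

lemma exists_N (d : ℝ) (hd : 0 < d) : ∃ N : ℕ, q ^ N * 30 < d := by
  have h := q_tendsto.mul_const 30
  rw [zero_mul] at h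
  exact (h.eventually (gt_mem_nhds hd)).exists

lemma un_zero (K : Set E2) (x : E2) (hx : Metric.infDist x K = 0) :
    Filter.Tendsto (fun n => un K n x) Filter.atTop (nhds 0) := by
  have h := q_tendsto.mul_const 2
  rw [zero_mul] at h
  refine squeeze_zero_norm (fun n => ?_) h
  rw [un_near K n x (by rw [hx]; have := pow_pos q_pos n; linarith)]
  exact Fn_bd n x

lemma un_conv (K : Set E2) (x : E2) :
    ∃ l, Filter.Tendsto (fun n => un K n x) Filter.atTop (nhds l) := by
  rcases (Metric.infDist_nonneg (x := x) (s := K)).eq_or_lt with h | h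
  · exact ⟨0, un_zero K x h.symm⟩
  · obtain ⟨N, hN⟩ := exists_N _ h
    refine ⟨un K N x, tendsto_const_nhds.congr' ?_⟩
    filter_upwards [Filter.eventually_ge_atTop N] with n hn
    exact (un_stable K N n hn x hN).symm

lemma Eset_orth (A : Matrix (Fin 2) (Fin 2) ℝ) (hA : A ∈ Eset) :
    A ∈ Matrix.orthogonalGroup (Fin 2) ℝ := by
  have key : ∀ a b c d : ℝ, a * a + b * b = 1 → c * c + d * d = 1 → a * c + b * d = 0 →
      !![a, b; c, d] ∈ Matrix.orthogonalGroup (Fin 2) ℝ := by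
    intro a b c d h1 h2 h3
    rw [Matrix.mem_orthogonalGroup_iff]
    ext i j
    rw [Matrix.mul_apply, Fin.sum_univ_two]
    fin_cases i <;> fin_cases j <;> simp [Matrix.star_apply] <;> linarith
  simp only [Eset, mem_insert_iff, mem_singleton_iff] at hA
  rcases hA with h | h | h | h | h | h | h | h <;> subst h <;>
    simp only [A1, A2, A3, A4, Matrix.neg_of, Matrix.neg_cons, Matrix.neg_empty] <;>
    apply key <;> norm_num

/-- for any open bounded `Ω ⊆ ℝ²` there is a map `u`, Lipschitz on `closure Ω`,
vanishing on `∂Ω`, and differentiable at a.e. `x ∈ Ω` with derivative a matrix of `E`;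
in particular the derivative is a.e. an orthogonal matrix. -/
theorem stmt0 (Ω : Set E2) (hΩo : IsOpen Ω) (hΩb : Bornology.IsBounded Ω) :
    ∃ (L : ℝ≥0) (u : E2 → E2),
      LipschitzOnWith L u (closure Ω) ∧
      (∀ x ∈ frontier Ω, u x = 0) ∧
      (∀ᵐ x ∂(volume.restrict Ω), ∃ A ∈ Eset,
        A ∈ Matrix.orthogonalGroup (Fin 2) ℝ ∧ HasFDerivAt u (matCLM A) x) := by
  obtain ⟨K, hK⟩ : ∃ K : Set E2, K = Ωᶜ := ⟨_, rfl⟩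
  have hKc : IsClosed K := hK ▸ hΩo.isClosed_compl
  have hKne : K.Nonempty := by
    rw [hK, nonempty_compl]
    rintro rfl
    exact NormedSpace.unbounded_univ ℝ E2 hΩb
  choose u hu using un_conv K
  refine ⟨1, u, ?_, ?_, ?_⟩
  · refine LipschitzWith.lipschitzOnWith (LipschitzWith.of_dist_le_mul fun x y => ?_)
    rw [NNReal.coe_one, one_mul, dist_eq_norm, dist_eq_norm]
    exact le_of_tendsto ((hu x).sub (hu y)).norm (Filter.Eventually.of_forall fun n => un_lip K n x y)
  · intro x hx
    have hxK : x ∈ K := by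
      rw [hK]; intro h
      exact hx.2 (hΩo.interior_eq.symm ▸ h)
    exact tendsto_nhds_unique (hu x) (un_zero K x (Metric.infDist_zero_of_mem hxK))
  · rw [ae_restrict_iff' hΩo.measurableSet]
    have hall : ∀ᵐ x ∂(volume : Measure E2), ∀ n, ∃ A ∈ Eset, HasFDerivAt (un K n) (matCLM A) x :=
      ae_all_iff.2 fun n => un_good K n
    filter_upwards [hall] with x hx hxΩ
    have hpos : 0 < Metric.infDist x K :=
      (hKc.notMem_iff_infDist_pos hKne).1 (by rw [hK]; exact fun h => h hxΩ)
    obtain ⟨N, hN⟩ := exists_N _ hpos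
    obtain ⟨A, hA, hd⟩ := hx N
    refine ⟨A, hA, Eset_orth A hA, hd.congr_of_eventuallyEq ?_⟩
    filter_upwards [(isOpen_lt continuous_const (Metric.continuous_infDist_pt K)).mem_nhds hN]
      with y hy
    refine tendsto_nhds_unique (hu y) (tendsto_const_nhds.congr' ?_)
    filter_upwards [Filter.eventually_ge_atTop N] with n hn
    exact (un_stable K N n hn y hy).symm

end
end

section
/- Let S ⊂ ℝ² be a compact connected set with H¹(S) < ∞. Then the one-dimensional Minkowski content of S exists and equals its Hausdorff measure: lim_{ρ→0⁺} L²(I_ρ(S))/(2ρ) = H¹(S). In particular L²(I_ρ(S)) → 0 as ρ → 0⁺. -/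
open MeasureTheory Set Filter Topology
open scoped ENNReal NNReal

noncomputable section

/-! ### Lipschitz images and connected sets -/

lemma vol_image_le {X : Type*} [MetricSpace X] [MeasurableSpace X] [BorelSpace X]
    {f : X → ℝ} (hf : LipschitzWith 1 f) (A : Set X) : volume (f '' A) ≤ μH[1] A := by
  have := hf.hausdorffMeasure_image_le (d := 1) (by norm_num) A
  rw [hausdorffMeasure_real] at this
  simpa using this

lemma lip_dist {X : Type*} [MetricSpace X] (p : X) : LipschitzWith 1 (fun z : X => dist z p) :=
  LipschitzWith.dist_left p

lemma ball_lower {X : Type*} [MetricSpace X] [MeasurableSpace X] [BorelSpace X]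
    {C : Set X} (hC : IsPreconnected C) {p q : X} (hp : p ∈ C) (hq : q ∈ C) {r : ℝ}
    (hr : r ≤ dist q p) : ENNReal.ofReal r ≤ μH[1] (C ∩ Metric.ball p r) := by
  refine le_trans ?_ (vol_image_le (lip_dist p) _)
  have h1 : Icc 0 (dist q p) ⊆ (fun z => dist z p) '' C := by
    have := hC.image (fun z => dist z p) (by fun_prop)
    have h2 := this.Icc_subset (mem_image_of_mem _ hp) (mem_image_of_mem _ hq)
    simpa using h2
  have h2 : Ico 0 r ⊆ (fun z => dist z p) '' (C ∩ Metric.ball p r) := by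
    intro t ht
    obtain ⟨z, hz, hzt⟩ := h1 ⟨ht.1, ht.2.le.trans hr⟩
    refine ⟨z, ⟨hz, ?_⟩, hzt⟩
    simp only at hzt
    rw [Metric.mem_ball, hzt]; exact ht.2
  calc ENNReal.ofReal r = volume (Ico 0 r) := by simp
    _ ≤ _ := measure_mono h2

lemma conn_lower {X : Type*} [MetricSpace X] [MeasurableSpace X] [BorelSpace X]
    {D : Set X} (hD : IsPreconnected D) {p q : X} (hp : p ∈ D) (hq : q ∈ D) :
    ENNReal.ofReal (dist q p) ≤ μH[1] D :=
  (ball_lower hD hp hq le_rfl).trans (measure_mono inter_subset_left)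

/-! ### An Eilenberg type inequality -/

lemma exists_cover {X : Type*} [MetricSpace X] [MeasurableSpace X] [BorelSpace X]
    (C : Set X) (hC : μH[1] C < ⊤) (n : ℕ) :
    ∃ t : ℕ → Set X, C ⊆ (⋃ i, t i) ∧ (∀ i, Metric.ediam (t i) ≤ ((n : ℝ≥0∞) + 1)⁻¹) ∧
      ∑' i, Metric.ediam (t i) ≤ μH[1] C + ((n : ℝ≥0∞) + 1)⁻¹ := by
  have hpos : (0 : ℝ≥0∞) < ((n : ℝ≥0∞) + 1)⁻¹ := by
    rw [ENNReal.inv_pos]; exact ENNReal.add_ne_top.2 ⟨ENNReal.natCast_ne_top n, ENNReal.one_ne_top⟩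
  have h1 : (⨅ (t : ℕ → Set X) (_ : C ⊆ ⋃ n, t n)
      (_ : ∀ i, Metric.ediam (t i) ≤ ((n : ℝ≥0∞) + 1)⁻¹),
          ∑' n, ⨆ _ : (t n).Nonempty, Metric.ediam (t n) ^ (1 : ℝ)) ≤ μH[1] C := by
    rw [Measure.hausdorffMeasure_apply]
    exact le_iSup₂_of_le (((n : ℝ≥0∞) + 1)⁻¹) hpos le_rfl
  have h2 := lt_of_le_of_lt h1 (ENNReal.lt_add_right hC.ne hpos.ne')
  simp only [iInf_lt_iff] at h2
  obtain ⟨t, ht1, ht2, ht3⟩ := h2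
  refine ⟨t, ht1, ht2, le_trans (ENNReal.tsum_le_tsum fun i => ?_) ht3.le⟩
  rcases (t i).eq_empty_or_nonempty with h | h
  · simp [h]
  · simp [h]

lemma eilenberg {X : Type*} [MetricSpace X] [MeasurableSpace X] [BorelSpace X]
    {f : X → ℝ} (hf : LipschitzWith 1 f) (C : Set X) (hC : μH[1] C < ⊤) :
    ∃ g : ℝ → ℝ≥0∞, Measurable g ∧ ∫⁻ t, g t ≤ μH[1] C ∧
      ∀ (t : ℝ) (T : Finset X), (T : Set X) ⊆ C ∩ f ⁻¹' {t} → (T.card : ℝ≥0∞) ≤ g t := by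
  choose U hU1 hU2 hU3 using exists_cover C hC
  let V : ℕ → ℕ → Set ℝ := fun n i => closure (f '' U n i)
  let gn : ℕ → ℝ → ℝ≥0∞ := fun n t => ∑' i, (V n i).indicator 1 t
  have hVm : ∀ n i, MeasurableSet (V n i) := fun n i => isClosed_closure.measurableSet
  have hgn : ∀ n, Measurable (gn n) := fun n =>
    Measurable.tsum fun i => measurable_one.indicator (hVm n i)
  have hint : ∀ n : ℕ, ∫⁻ t, gn n t ≤ μH[1] C + ((n : ℝ≥0∞) + 1)⁻¹ := by
    intro n
    rw [lintegral_tsum (fun i => (measurable_one.indicator (hVm n i)).aemeasurable)]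
    refine le_trans (ENNReal.tsum_le_tsum fun i => ?_) (hU3 n)
    rw [lintegral_indicator_one (hVm n i)]
    refine (Real.volume_le_diam _).trans ?_
    rw [Metric.ediam_closure]
    simpa using hf.ediam_image_le (U n i)
  have hlim : Tendsto (fun n : ℕ => ((n : ℝ≥0∞) + 1)⁻¹) atTop (𝓝 0) := by
    have := (ENNReal.tendsto_inv_nat_nhds_zero).comp (tendsto_add_atTop_nat 1)
    refine this.congr fun n => ?_
    simp
  refine ⟨fun t => liminf (fun n => gn n t) atTop, Measurable.liminf hgn, ?_, ?_⟩
  · refine (lintegral_liminf_le hgn).trans ?_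
    have h2 : Tendsto (fun n : ℕ => μH[1] C + ((n : ℝ≥0∞) + 1)⁻¹) atTop (𝓝 (μH[1] C)) := by
      simpa using tendsto_const_nhds.add hlim
    rw [← h2.liminf_eq]
    exact liminf_le_liminf (Eventually.of_forall hint)
  · intro t T hT
    refine le_liminf_of_le (by isBoundedDefault) ?_
    have hsep : ∃ ε : ℝ≥0∞, 0 < ε ∧ ∀ x ∈ T, ∀ y ∈ T, x ≠ y → ε ≤ edist x y := by
      by_cases hne : (T.offDiag).Nonempty
      · obtain ⟨z, hz, hmin⟩ := T.offDiag.exists_min_image (fun z => edist z.1 z.2) hne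
        refine ⟨edist z.1 z.2, edist_pos.2 (Finset.mem_offDiag.1 hz).2.2, fun x hx y hy hxy => ?_⟩
        exact hmin (x, y) (Finset.mem_offDiag.2 ⟨hx, hy, hxy⟩)
      · refine ⟨1, one_pos, fun x hx y hy hxy => ?_⟩
        exact absurd ⟨(x, y), Finset.mem_offDiag.2 ⟨hx, hy, hxy⟩⟩ hne
    obtain ⟨ε, hε, hsep⟩ := hsep
    filter_upwards [hlim.eventually (gt_mem_nhds hε)] with n hn
    have hcov : ∀ x ∈ T, ∃ i, x ∈ U n i := fun x hx => by
      simpa using hU1 n (hT hx).1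
    choose! φ hφ using hcov
    have hinj : Set.InjOn φ T := by
      intro x hx y hy hxy
      by_contra hne
      have h1 := hsep x hx y hy hne
      have h2 : edist x y ≤ ((n : ℝ≥0∞) + 1)⁻¹ :=
        (Metric.edist_le_ediam_of_mem (hφ x hx) (hxy ▸ hφ y hy)).trans (hU2 n _)
      exact absurd hn (not_lt.2 (h1.trans h2))
    classical
    calc (T.card : ℝ≥0∞) = ((T.image φ).card : ℝ≥0∞) := by
          rw [Finset.card_image_of_injOn hinj]
      _ = ∑ i ∈ T.image φ, (V n i).indicator 1 t := by
          rw [Finset.card_eq_sum_ones]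
          push_cast
          refine Finset.sum_congr rfl fun i hi => ?_
          obtain ⟨x, hx, rfl⟩ := Finset.mem_image.1 hi
          rw [indicator_of_mem]
          · rfl
          · refine subset_closure ⟨x, hφ x hx, ?_⟩
            exact (hT hx).2
      _ ≤ gn n t := ENNReal.sum_le_tsum _

/-! ### Decomposition into small continua -/

lemma exists_radius {X : Type*} [MetricSpace X] [MeasurableSpace X] [BorelSpace X]
    (S : Set X) (hfin : μH[1] S < ⊤) (x : X) {a b : ℝ} (hab : a < b) :
    ∃ r ∈ Ioo a b, (S ∩ Metric.sphere x r).Finite := by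
  obtain ⟨g, hgm, hgi, hg⟩ := eilenberg (lip_dist x) S hfin
  have hae : ∀ᵐ t : ℝ, g t < ⊤ := ae_lt_top hgm (hgi.trans_lt hfin).ne
  have : ∃ r ∈ Ioo a b, g r < ⊤ := by
    by_contra! hcon
    have h0 : volume (Ioo a b) = 0 := by
      refine measure_mono_null ?_ (ae_iff.1 hae)
      intro r hr
      exact not_lt.2 (hcon r hr)
    simp at h0
    exact absurd hab (not_lt.2 h0)
  obtain ⟨r, hr, hgr⟩ := this
  refine ⟨r, hr, ?_⟩
  by_contra hinf
  have hall : ∀ n : ℕ, (n : ℝ≥0∞) ≤ g r := by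
    intro n
    obtain ⟨T, hT1, hT2⟩ := Set.Infinite.exists_subset_card_eq hinf n
    rw [← hT2]
    exact hg r T hT1
  obtain ⟨n, hn⟩ := ENNReal.exists_nat_gt hgr.ne
  exact absurd hn (not_lt.2 (hall n))

lemma bump {X : Type*} [MetricSpace X] {S Q F : Set X} (hS : IsCompact S) (hSc : IsPreconnected S)
    (hQ : IsClosed Q) (hF : IsClosed F) (hFQ : (S ∩ Q) \ F ⊆ interior Q) {x : X} (hx : x ∈ S ∩ Q)
    (hK : connectedComponentIn (S ∩ Q) x ∩ F = ∅) : connectedComponentIn (S ∩ Q) x = S := by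
  have hcY : IsCompact (S ∩ Q) := hS.inter_right hQ
  have : CompactSpace ↥(S ∩ Q) := isCompact_iff_compactSpace.1 hcY
  have hcc := connectedComponent_eq_iInter_isClopen (⟨x, hx⟩ : ↥(S ∩ Q))
  rw [connectedComponentIn_eq_image hx] at hK
  let V : { s : Set ↥(S ∩ Q) // IsClopen s ∧ (⟨x, hx⟩ : ↥(S ∩ Q)) ∈ s } → Set ↥(S ∩ Q) := fun s => s
  have : Nonempty { s : Set ↥(S ∩ Q) // IsClopen s ∧ (⟨x, hx⟩ : ↥(S ∩ Q)) ∈ s } :=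
    ⟨⟨univ, isClopen_univ, mem_univ _⟩⟩
  have hdir : Directed (· ⊇ ·) V := by
    intro a b
    exact ⟨⟨a.1 ∩ b.1, a.2.1.inter b.2.1, a.2.2, b.2.2⟩, inter_subset_left, inter_subset_right⟩
  have hopen : IsOpen ((Subtype.val : ↥(S ∩ Q) → X) ⁻¹' Fᶜ) :=
    hF.isOpen_compl.preimage continuous_subtype_val
  obtain ⟨⟨Z, hZc, hxZ⟩, hZF⟩ := exists_subset_nhds_of_compactSpace hdir
    (fun i => i.2.1.isClosed) (U := (Subtype.val : ↥(S ∩ Q) → X) ⁻¹' Fᶜ) (by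
      intro y hy
      refine hopen.mem_nhds ?_
      intro hyF
      have hy' : y ∈ connectedComponent (⟨x, hx⟩ : ↥(S ∩ Q)) := by rw [hcc]; exact hy
      have : (y : X) ∈ (∅ : Set X) := by rw [← hK]; exact ⟨mem_image_of_mem _ hy', hyF⟩
      exact this)
  change Z ⊆ _ at hZF
  have hW : IsClosed (Subtype.val '' Z : Set X) :=
    (hZc.isClosed.isCompact.image continuous_subtype_val).isClosed
  have hW' : IsClosed (Subtype.val '' Zᶜ : Set X) :=
    (hZc.compl.isClosed.isCompact.image continuous_subtype_val).isClosed
  have hsub : S ⊆ Subtype.val '' Z := by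
    have hor := (isPreconnected_iff_subset_of_disjoint_closed.1 hSc) (Subtype.val '' Z)
      (Subtype.val '' Zᶜ ∪ (interior Q)ᶜ) hW (hW'.union isOpen_interior.isClosed_compl) ?_ ?_
    · rcases hor with h | h
      · exact h
      · exfalso
        rcases h hx.1 with ⟨y, hy, hyx⟩ | h
        · apply hy
          have : y = ⟨x, hx⟩ := Subtype.ext hyx
          rw [this]; exact hxZ
        · exact h (hFQ ⟨hx, hZF hxZ⟩)
    · intro s hs
      by_cases hsQ : s ∈ Q
      · by_cases hsZ : (⟨s, hs, hsQ⟩ : ↥(S ∩ Q)) ∈ Z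
        · exact Or.inl ⟨_, hsZ, rfl⟩
        · exact Or.inr (Or.inl ⟨_, hsZ, rfl⟩)
      · exact Or.inr (Or.inr fun h => hsQ (interior_subset h))
    · rw [Set.eq_empty_iff_forall_notMem]
      rintro s ⟨hs, ⟨y, hy, rfl⟩, h⟩
      rcases h with ⟨z, hz, hzy⟩ | h
      · exact hz (by rw [Subtype.ext hzy]; exact hy)
      · exact h (hFQ ⟨y.2, hZF hy⟩)
  have hSQ : S ∩ Q = S := by
    refine inter_eq_left.2 fun s hs => ?_
    obtain ⟨y, _, rfl⟩ := hsub hs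
    exact y.2.2
  rw [hSQ]
  exact hSc.connectedComponentIn hx.1

lemma comp_compact {X : Type*} [MetricSpace X] {Y : Set X} (hY : IsCompact Y) {x : X} (hx : x ∈ Y) :
    IsCompact (connectedComponentIn Y x) := by
  have : CompactSpace ↥Y := isCompact_iff_compactSpace.1 hY
  rw [connectedComponentIn_eq_image hx]
  exact isClosed_connectedComponent.isCompact.image continuous_subtype_val

lemma decomp {X : Type*} [MetricSpace X] [MeasurableSpace X] [BorelSpace X]
    {S : Set X} (hS : IsCompact S) (hSc : IsPreconnected S)
    (hfin : μH[1] S < ⊤) {δ : ℝ} (hδ : 0 < δ) :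
    ∃ (𝒞 : Finset (Set X)) (F : Set X), F.Finite ∧ S ⊆ ⋃ C ∈ 𝒞, C ∧
      (∀ C ∈ 𝒞, IsCompact C ∧ IsConnected C ∧ C ⊆ S ∧ Metric.ediam C ≤ ENNReal.ofReal δ) ∧
      ∀ C ∈ 𝒞, ∀ D ∈ 𝒞, C ≠ D → C ∩ D ⊆ F := by
  classical
  choose r hr hrfin using fun x : X => exists_radius S hfin x (a := δ / 4) (b := δ / 2) (by linarith)
  obtain ⟨t, -, ht⟩ := hS.elim_nhds_subcover (fun x => Metric.ball x (r x))
    (fun x _ => Metric.ball_mem_nhds x (by linarith [(hr x).1]))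
  let F : Set X := ⋃ y ∈ t, S ∩ Metric.sphere y (r y)
  have hFfin : F.Finite := t.finite_toSet.biUnion fun y _ => hrfin y
  let Q : Finset X → Set X := fun A => (⋂ y ∈ A, Metric.closedBall y (r y)) ∩
    (⋂ y ∈ t \ A, (Metric.ball y (r y))ᶜ)
  have hQcl : ∀ A, IsClosed (Q A) := fun A =>
    (isClosed_biInter fun y _ => Metric.isClosed_closedBall).inter
      (isClosed_biInter fun y _ => Metric.isOpen_ball.isClosed_compl)
  have hQint : ∀ A ⊆ t, (S ∩ Q A) \ F ⊆ interior (Q A) := by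
    rintro A hA x ⟨⟨hxS, hx1, hx2⟩, hxF⟩
    have hns : ∀ y ∈ t, dist x y ≠ r y := by
      intro y hy h
      exact hxF (mem_biUnion hy ⟨hxS, h⟩)
    have hop : IsOpen ((⋂ y ∈ A, Metric.ball y (r y)) ∩
        (⋂ y ∈ t \ A, (Metric.closedBall y (r y))ᶜ)) :=
      (isOpen_biInter_finset fun y _ => Metric.isOpen_ball).inter
        (isOpen_biInter_finset fun y _ => Metric.isClosed_closedBall.isOpen_compl)
    refine interior_maximal ?_ hop ?_
    · refine inter_subset_inter ?_ ?_
      · exact iInter₂_mono fun y _ => Metric.ball_subset_closedBall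
      · exact iInter₂_mono fun y _ => compl_subset_compl.2 Metric.ball_subset_closedBall
    · simp only [mem_iInter, Metric.mem_closedBall, mem_compl_iff, Metric.mem_ball, not_lt] at hx1 hx2
      constructor
      · simp only [mem_iInter, Metric.mem_ball]
        intro y hy
        exact lt_of_le_of_ne (hx1 y hy) (hns y (hA hy))
      · simp only [mem_iInter, Metric.mem_closedBall, mem_compl_iff, not_le]
        intro y hy
        exact lt_of_le_of_ne (hx2 y hy) (hns y (Finset.mem_sdiff.1 hy).1).symm
  have hQQ : ∀ A ⊆ t, ∀ B ⊆ t, A ≠ B → S ∩ Q A ∩ (S ∩ Q B) ⊆ F := by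
    have key : ∀ A ⊆ t, ∀ B ⊆ t, ∀ y ∈ A, y ∉ B → S ∩ Q A ∩ (S ∩ Q B) ⊆ F := by
      rintro A hA B hB y hyA hyB x ⟨⟨hxS, hx1, -⟩, -, -, hx2⟩
      simp only [mem_iInter, Metric.mem_closedBall, mem_compl_iff, Metric.mem_ball, not_lt] at hx1 hx2
      exact mem_biUnion (hA hyA) ⟨hxS, le_antisymm (hx1 y hyA)
        (hx2 y (Finset.mem_sdiff.2 ⟨hA hyA, hyB⟩))⟩
    intro A hA B hB hAB
    by_cases h : A ⊆ B
    · have : ¬ B ⊆ A := fun h' => hAB (Finset.Subset.antisymm h h')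
      obtain ⟨y, hy, hy'⟩ := Finset.not_subset.1 this
      rw [inter_comm]
      exact key B hB A hA y hy hy'
    · obtain ⟨y, hy, hy'⟩ := Finset.not_subset.1 h
      exact key A hA B hB y hy hy'
  let 𝒮 : Set (Set X) := {K | ∃ A ⊆ t, ∃ x ∈ S ∩ Q A, K = connectedComponentIn (S ∩ Q A) x}
  have h𝒮 : 𝒮.Finite := by
    refine Set.Finite.subset (s := ⋃ A ∈ t.powerset,
      insert S ((fun x => connectedComponentIn (S ∩ Q A) x) '' F)) ?_ ?_
    · exact t.powerset.finite_toSet.biUnion fun A _ => (hFfin.image _).insert S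
    · rintro K ⟨A, hA, x, hx, rfl⟩
      refine mem_biUnion (Finset.mem_coe.2 (Finset.mem_powerset.2 hA)) ?_
      by_cases hK : connectedComponentIn (S ∩ Q A) x ∩ F = ∅
      · exact Or.inl (bump hS hSc (hQcl A) hFfin.isClosed (hQint A hA) hx hK)
      · obtain ⟨y, hy, hyF⟩ := Set.nonempty_iff_ne_empty.2 hK
        exact Or.inr ⟨y, hyF, (connectedComponentIn_eq hy).symm⟩
  refine ⟨h𝒮.toFinset, F, hFfin, ?_, ?_, ?_⟩
  · intro x hx
    let A := t.filter fun y => x ∈ Metric.closedBall y (r y)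
    have hxA : x ∈ S ∩ Q A := by
      refine ⟨hx, ?_, ?_⟩
      · simp only [mem_iInter]
        intro y hy
        exact (Finset.mem_filter.1 hy).2
      · simp only [mem_iInter]
        intro y hy hxy
        rw [Finset.mem_sdiff] at hy
        exact hy.2 (Finset.mem_filter.2 ⟨hy.1, Metric.ball_subset_closedBall hxy⟩)
    refine mem_biUnion (x := connectedComponentIn (S ∩ Q A) x) ?_ (mem_connectedComponentIn hxA)
    simp only [Finset.mem_coe, Set.Finite.mem_toFinset]
    exact ⟨A, Finset.filter_subset _ _, x, hxA, rfl⟩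
  · intro C hC
    rw [Set.Finite.mem_toFinset] at hC
    obtain ⟨A, hA, x, hx, rfl⟩ := hC
    have hsub := connectedComponentIn_subset (S ∩ Q A) x
    refine ⟨comp_compact (hS.inter_right (hQcl A)) hx, isConnected_connectedComponentIn_iff.2 hx,
      hsub.trans inter_subset_left, ?_⟩
    have hne : ∃ y ∈ t, x ∈ Metric.ball y (r y) := by simpa using ht hx.1
    obtain ⟨y, hy, hxy⟩ := hne
    have hyA : y ∈ A := by
      by_contra hyA
      have := hx.2.2
      simp only [mem_iInter] at this
      exact this y (Finset.mem_sdiff.2 ⟨hy, hyA⟩) hxy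
    have hsub2 : connectedComponentIn (S ∩ Q A) x ⊆ Metric.closedBall y (r y) := by
      intro z hz
      have := (hsub hz).2.1
      simp only [mem_iInter] at this
      exact this y hyA
    refine Metric.ediam_le_of_forall_dist_le fun z hz w hw => ?_
    have h1 := Metric.mem_closedBall.1 (hsub2 hz)
    have h2 := Metric.mem_closedBall.1 (hsub2 hw)
    have := dist_triangle_right z w y
    linarith [(hr y).2]
  · intro C hC D hD hCD
    rw [Set.Finite.mem_toFinset] at hC hD
    obtain ⟨A, hA, x, hx, rfl⟩ := hC
    obtain ⟨B, hB, y, hy, rfl⟩ := hD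
    by_cases hAB : A = B
    · subst hAB
      rintro z ⟨hz1, hz2⟩
      exact absurd ((connectedComponentIn_eq hz1).trans (connectedComponentIn_eq hz2).symm) hCD
    · exact (inter_subset_inter (connectedComponentIn_subset _ _)
        (connectedComponentIn_subset _ _)).trans (hQQ A hA B hB hAB)

lemma decomp_eta {X : Type*} [MetricSpace X] [MeasurableSpace X] [BorelSpace X]
    {S : Set X} (hS : IsCompact S) (hSc : IsPreconnected S)
    (hfin : μH[1] S < ⊤) {η : ℝ≥0∞} (hη : η ≠ 0) :
    ∃ (𝒞 : Finset (Set X)) (F : Set X), F.Finite ∧ S ⊆ ⋃ C ∈ 𝒞, C ∧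
      (∀ C ∈ 𝒞, IsCompact C ∧ IsConnected C ∧ C ⊆ S) ∧
      (∀ C ∈ 𝒞, ∀ D ∈ 𝒞, C ≠ D → C ∩ D ⊆ F) ∧
      μH[1] S ≤ ∑ C ∈ 𝒞, Metric.ediam C + η ∧ ∑ C ∈ 𝒞, μH[1] C ≤ μH[1] S := by
  choose 𝒞 F hF hcov hC hCD using fun n : ℕ =>
    decomp hS hSc hfin (δ := 1 / ((n : ℝ) + 1)) (by positivity)
  have hlim : Tendsto (fun n : ℕ => ENNReal.ofReal (1 / ((n : ℝ) + 1))) atTop (𝓝 0) := by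
    have := ENNReal.tendsto_ofReal (tendsto_one_div_add_atTop_nhds_zero_nat (𝕜 := ℝ))
    simpa using this
  have hle := Measure.hausdorffMeasure_le_liminf_sum (ι := fun n => ↥(𝒞 n)) 1 S
    (fun n : ℕ => ENNReal.ofReal (1 / ((n : ℝ) + 1))) hlim (fun n C => (C : Set X))
    (Eventually.of_forall fun n C => (hC n C C.2).2.2.2)
    (Eventually.of_forall fun n => by
      intro x hx
      obtain ⟨C, hC1, hC2⟩ := mem_iUnion₂.1 (hcov n hx)
      exact mem_iUnion.2 ⟨⟨C, hC1⟩, hC2⟩)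
  have hex : ∃ n, μH[1] S ≤ ∑ C ∈ 𝒞 n, Metric.ediam C + η := by
    by_contra! hcon
    have h1 : liminf (fun n => ∑ C : ↥(𝒞 n), Metric.ediam (C : Set X) ^ (1 : ℝ)) atTop
        ≤ μH[1] S - η := by
      refine le_trans (liminf_le_liminf (v := fun _ : ℕ => μH[1] S - η) ?_) (by simp)
      refine Eventually.of_forall fun n => ?_
      have h2 : ∑ C : ↥(𝒞 n), Metric.ediam (C : Set X) ^ (1 : ℝ) = ∑ C ∈ 𝒞 n, Metric.ediam C := by
        simp only [ENNReal.rpow_one]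
        exact Finset.sum_coe_sort (𝒞 n) (fun C => Metric.ediam C)
      rw [h2]
      refine ENNReal.le_sub_of_add_le_right ?_ (hcon n).le
      exact ne_top_of_le_ne_top hfin.ne (le_add_self.trans (hcon n).le)
    have h3 := hle.trans h1
    have h4 : μH[1] S ≠ 0 := fun h => by
      have := hcon 0
      rw [h] at this
      exact not_lt_zero this
    exact absurd (ENNReal.sub_lt_self hfin.ne h4 hη) (not_lt.2 h3)
  obtain ⟨n, hn⟩ := hex
  refine ⟨𝒞 n, F n, hF n, hcov n, fun C h => ⟨(hC n C h).1, (hC n C h).2.1, (hC n C h).2.2.1⟩,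
    hCD n, hn, ?_⟩
  have := Measure.nullSingletonClass_hausdorff X (d := 1) one_pos
  rw [← measure_biUnion_finset₀ (f := fun C => C)]
  · exact measure_mono (iUnion₂_subset fun C h => (hC n C h).2.2.1)
  · intro C hC1 D hD1 hne
    exact measure_mono_null (hCD n C hC1 D hD1 hne) ((hF n).measure_zero _)
  · intro C h
    exact (hC n C h).1.measurableSet.nullMeasurableSet

/-! ### Planar geometry -/

lemma coords_measurePreserving :
    MeasurePreserving (fun z : E2 => (z 0, z 1)) volume volume :=
  (volume_preserving_finTwoArrow ℝ).comp
    (EuclideanSpace.volume_preserving_symm_measurableEquiv_toLp (Fin 2))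

lemma exists_coords (a b : E2) : ∃ f h : E2 → ℝ,
    (∀ z w, dist z w ^ 2 = (f z - f w) ^ 2 + (h z - h w) ^ 2) ∧ f b - f a = dist b a ∧
    MeasurePreserving (fun z : E2 => (f z, h z)) volume volume := by
  have hL : ∃ L : E2 ≃ₗᵢ[ℝ] E2, L b 0 - L a 0 = dist b a := by
    by_cases hab : a = b
    · subst hab
      exact ⟨LinearIsometryEquiv.refl ℝ E2, by simp⟩
    · have hne : ‖b - a‖ ≠ 0 := by
        rw [norm_ne_zero_iff]; exact sub_ne_zero.2 (Ne.symm hab)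
      let u : E2 := (‖b - a‖)⁻¹ • (b - a)
      have hu : ‖u‖ = 1 := by
        simp only [u, norm_smul, norm_inv, norm_norm]
        exact inv_mul_cancel₀ hne
      have horth : Orthonormal ℝ (({0} : Set (Fin 2)).domRestrict (fun _ => u)) := by
        constructor
        · intro i; exact hu
        · intro i j hij
          exact absurd (Subsingleton.elim i j) hij
      obtain ⟨B, hB⟩ := horth.exists_orthonormalBasis_extension_of_card_eq (by simp)
      refine ⟨B.repr, ?_⟩
      have h0 : B 0 = u := hB 0 (by simp)
      rw [B.repr_apply_apply, B.repr_apply_apply, h0, ← inner_sub_right]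
      simp only [u, inner_smul_left, real_inner_self_eq_norm_sq, dist_eq_norm]
      simp
      field_simp
  obtain ⟨L, hL⟩ := hL
  refine ⟨fun z => L z 0, fun z => L z 1, ?_, hL, ?_⟩
  · intro z w
    rw [← L.dist_map z w, EuclideanSpace.dist_eq, Real.sq_sqrt (by positivity)]
    simp [Real.dist_eq, sq_abs]
  · exact coords_measurePreserving.comp L.measurePreserving

lemma coord_le {f h : E2 → ℝ} (hfh : ∀ z w, dist z w ^ 2 = (f z - f w) ^ 2 + (h z - h w) ^ 2)
    (z w : E2) : |f z - f w| ≤ dist z w ∧ |h z - h w| ≤ dist z w := by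
  have := hfh z w
  constructor
  · exact abs_le_of_sq_le_sq (by nlinarith [sq_nonneg (h z - h w)]) dist_nonneg
  · exact abs_le_of_sq_le_sq (by nlinarith [sq_nonneg (f z - f w)]) dist_nonneg

lemma coord_lip {f h : E2 → ℝ} (hfh : ∀ z w, dist z w ^ 2 = (f z - f w) ^ 2 + (h z - h w) ^ 2) :
    LipschitzWith 1 f :=
  LipschitzWith.of_dist_le_mul fun z w => by
    simpa [Real.dist_eq] using (coord_le hfh z w).1

lemma box_upper {f h : E2 → ℝ} (hfh : ∀ z w, dist z w ^ 2 = (f z - f w) ^ 2 + (h z - h w) ^ 2)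
    (hmp : MeasurePreserving (fun z : E2 => (f z, h z)) volume volume) {A : Set E2}
    {α ℓ β w ρ : ℝ} (hℓ : 0 ≤ ℓ) (hρ : 0 ≤ ρ)
    (hA : ∀ z ∈ A, α ≤ f z ∧ f z ≤ α + ℓ ∧ |h z - β| ≤ w) :
    volume (Metric.thickening ρ A) ≤ ENNReal.ofReal ((ℓ + 2 * ρ) * (2 * w + 2 * ρ)) := by
  have hsub : Metric.thickening ρ A ⊆ (fun z : E2 => (f z, h z)) ⁻¹'
      (Icc (α - ρ) (α + ℓ + ρ) ×ˢ Icc (β - w - ρ) (β + w + ρ)) := by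
    intro z hz
    obtain ⟨y, hy, hzy⟩ := Metric.mem_thickening_iff.1 hz
    obtain ⟨h1, h2, h3⟩ := hA y hy
    obtain ⟨h4, h5⟩ := coord_le hfh z y
    rw [abs_le] at h3 h4 h5
    simp only [mem_preimage, mem_prod, mem_Icc]
    refine ⟨⟨?_, ?_⟩, ?_, ?_⟩ <;> linarith
  refine (measure_mono hsub).trans ?_
  rw [hmp.measure_preimage (measurableSet_Icc.prod measurableSet_Icc).nullMeasurableSet,
    Measure.volume_eq_prod, Measure.prod_prod, Real.volume_Icc, Real.volume_Icc,
    ← ENNReal.ofReal_mul (by linarith)]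
  apply le_of_eq
  congr 1
  ring

lemma slice_lower {f h : E2 → ℝ} (hfh : ∀ z w, dist z w ^ 2 = (f z - f w) ^ 2 + (h z - h w) ^ 2)
    (hmp : MeasurePreserving (fun z : E2 => (f z, h z)) volume volume) {A : Set E2}
    (hA : IsCompact A) {ρ : ℝ} (hρ : 0 ≤ ρ) :
    ENNReal.ofReal (2 * ρ) * volume (f '' A) ≤ volume (Metric.thickening ρ A) := by
  let T : Set (ℝ × ℝ) := ⋃ z ∈ A, {p | (p.1 - f z) ^ 2 + (p.2 - h z) ^ 2 < ρ ^ 2}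
  have hT : IsOpen T := isOpen_biUnion fun z _ => isOpen_lt (by fun_prop) (by fun_prop)
  have hpre : (fun z : E2 => (f z, h z)) ⁻¹' T = Metric.thickening ρ A := by
    ext z
    simp only [T, mem_preimage, mem_iUnion, mem_ofPred_eq, Metric.mem_thickening_iff, exists_prop]
    refine exists_congr fun y => and_congr_right fun _ => ?_
    rw [← hfh z y]
    exact pow_lt_pow_iff_left₀ dist_nonneg hρ (by norm_num)
  rw [← hpre, hmp.measure_preimage hT.measurableSet.nullMeasurableSet, Measure.volume_eq_prod,
    Measure.prod_apply hT.measurableSet]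
  have hm : MeasurableSet (f '' A) := (hA.image (coord_lip hfh).continuous).measurableSet
  rw [← setLIntegral_const]
  refine le_trans ?_ (setLIntegral_le_lintegral (f '' A) _)
  refine setLIntegral_mono' hm ?_
  rintro _ ⟨z, hz, rfl⟩
  calc ENNReal.ofReal (2 * ρ) = volume (Ioo (h z - ρ) (h z + ρ)) := by
        rw [Real.volume_Ioo]; congr 1; ring
    _ ≤ _ := by
        refine measure_mono fun y hy => ?_
        refine mem_biUnion hz ?_
        simp only [mem_ofPred_eq, sub_self]
        have h1 := hy.1
        have h2 := hy.2
        nlinarith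

lemma exists_diam {X : Type*} [MetricSpace X] {C : Set X} (hC : IsCompact C) (hne : C.Nonempty) :
    ∃ a ∈ C, ∃ b ∈ C, (∀ z ∈ C, ∀ w ∈ C, dist z w ≤ dist b a) ∧ Metric.diam C = dist b a := by
  obtain ⟨⟨b, a⟩, ⟨hb, ha⟩, hmax⟩ := (hC.prod hC).exists_isMaxOn (hne.prod hne)
    (f := fun p : X × X => dist p.1 p.2) continuous_dist.continuousOn
  have h : ∀ z ∈ C, ∀ w ∈ C, dist z w ≤ dist b a := fun z hz w hw =>
    isMaxOn_iff.1 hmax (z, w) (mk_mem_prod hz hw)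
  refine ⟨a, ha, b, hb, h, le_antisymm (Metric.diam_le_of_forall_dist_le dist_nonneg h) ?_⟩
  exact Metric.dist_le_diam_of_mem hC.isBounded hb ha

lemma lower_piece {C : Set E2} (hC : IsCompact C) (hCc : IsConnected C) (F : Finset E2)
    {r ρ : ℝ} (hr : 0 ≤ r) (hρ : 0 ≤ ρ) :
    2 * ρ * (Metric.diam C - 2 * r * F.card) ≤
      (volume (Metric.thickening ρ (C \ ⋃ x ∈ F, Metric.ball x r))).toReal := by
  obtain ⟨a, ha, b, hb, -, hd⟩ := exists_diam hC hCc.nonempty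
  obtain ⟨f, h, hfh, hab, hmp⟩ := exists_coords a b
  have hlip := coord_lip hfh
  set A := C \ ⋃ x ∈ F, Metric.ball x r with hA
  have hAc : IsCompact A := hC.diff (isOpen_biUnion fun x _ => Metric.isOpen_ball)
  have hslice := slice_lower hfh hmp hAc hρ
  have hfin : volume (Metric.thickening ρ A) ≠ ⊤ := hAc.isBounded.thickening.measure_lt_top.ne
  have hIcc : Icc (f a) (f b) ⊆ f '' C :=
    (hCc.isPreconnected.image f hlip.continuous.continuousOn).Icc_subset
      (mem_image_of_mem _ ha) (mem_image_of_mem _ hb)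
  have hsub : Icc (f a) (f b) ⊆ f '' A ∪ ⋃ x ∈ F, Icc (f x - r) (f x + r) := by
    intro t ht
    obtain ⟨z, hz, rfl⟩ := hIcc ht
    by_cases hzA : z ∈ A
    · exact Or.inl (mem_image_of_mem _ hzA)
    · right
      have : z ∈ ⋃ x ∈ F, Metric.ball x r := by
        by_contra hcon; exact hzA ⟨hz, hcon⟩
      obtain ⟨x, hx, hzx⟩ := mem_iUnion₂.1 this
      refine mem_biUnion hx ?_
      have h1 := (coord_le hfh z x).1
      rw [abs_le] at h1
      rw [Metric.mem_ball] at hzx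
      constructor <;> linarith
  have hfA : volume (f '' A) ≠ ⊤ := (hAc.image hlip.continuous).measure_lt_top.ne
  have hvol : ENNReal.ofReal (Metric.diam C) ≤
      volume (f '' A) + ENNReal.ofReal (2 * r * F.card) := by
    calc ENNReal.ofReal (Metric.diam C) = volume (Icc (f a) (f b)) := by
          rw [Real.volume_Icc, hab, hd]
      _ ≤ _ := measure_mono hsub
      _ ≤ _ := measure_union_le _ _
      _ ≤ _ := by
          gcongr
          refine (measure_biUnion_finset_le _ _).trans ?_
          simp only [Real.volume_Icc]
          rw [← ENNReal.ofReal_sum_of_nonneg]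
          · refine ENNReal.ofReal_le_ofReal (le_of_eq ?_)
            rw [Finset.sum_congr rfl (g := fun _ => 2 * r) (fun x _ => by ring)]
            simp; ring
          · intro x _; linarith
  have h1 : Metric.diam C ≤ (volume (f '' A)).toReal + 2 * r * F.card := by
    have := ENNReal.toReal_mono (by finiteness) hvol
    rwa [ENNReal.toReal_add hfA (by finiteness), ENNReal.toReal_ofReal Metric.diam_nonneg,
      ENNReal.toReal_ofReal (by positivity)] at this
  have h2 := ENNReal.toReal_mono hfin hslice
  rw [ENNReal.toReal_mul, ENNReal.toReal_ofReal (by positivity)] at h2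
  refine le_trans ?_ h2
  gcongr
  linarith

lemma lower_bound {S : Set E2} (hS : IsCompact S) (hSc : IsConnected S)
    (hfin : μH[1] S < ⊤) {ε : ℝ} (hε : 0 < ε) :
    ∀ᶠ ρ in 𝓝[>] (0 : ℝ), (μH[1] S).toReal - ε ≤
      (volume (Metric.thickening ρ S)).toReal / (2 * ρ) := by
  obtain ⟨𝒞, F, hF, hcov, hC, hCD, hdiam, -⟩ := decomp_eta hS hSc.isPreconnected hfin
    (η := ENNReal.ofReal (ε / 2)) (by simpa using hε)
  let F' := hF.toFinset
  have hdiam' : (μH[1] S).toReal ≤ ∑ C ∈ 𝒞, Metric.diam C + ε / 2 := by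
    have hft : ∑ C ∈ 𝒞, Metric.ediam C ≠ ⊤ := by
      rw [ENNReal.sum_ne_top]
      exact fun C h => (hC C h).1.isBounded.ediam_ne_top
    have := ENNReal.toReal_mono (by finiteness) hdiam
    rw [ENNReal.toReal_add hft (by finiteness), ENNReal.toReal_ofReal (by positivity),
      ENNReal.toReal_sum (fun C h => (hC C h).1.isBounded.ediam_ne_top)] at this
    exact this
  -- choose the radius
  let N : ℝ := 2 * F'.card * 𝒞.card + 1
  have hN : 0 < N := by positivity
  let r : ℝ := ε / 2 / N
  have hr : 0 < r := by positivity
  let A : Set E2 → Set E2 := fun C => C \ ⋃ x ∈ F', Metric.ball x r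
  have hAc : ∀ C ∈ 𝒞, IsCompact (A C) := fun C h =>
    (hC C h).1.diff (isOpen_biUnion fun x _ => Metric.isOpen_ball)
  have hdisj : ∀ C ∈ 𝒞, ∀ D ∈ 𝒞, C ≠ D → Disjoint (A C) (A D) := by
    intro C h D h' hne
    rw [Set.disjoint_left]
    rintro x ⟨hx1, hx2⟩ ⟨hx3, -⟩
    have hxF : x ∈ F' := hF.mem_toFinset.2 (hCD C h D h' hne ⟨hx1, hx3⟩)
    exact hx2 (mem_biUnion (Finset.mem_coe.2 hxF) (Metric.mem_ball_self hr))
  have hthick : ∀ᶠ ρ in 𝓝[>] (0 : ℝ), ∀ C ∈ 𝒞, ∀ D ∈ 𝒞, C ≠ D →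
      Disjoint (Metric.thickening ρ (A C)) (Metric.thickening ρ (A D)) := by
    rw [Filter.eventually_all_finset]
    intro C h
    rw [Filter.eventually_all_finset]
    intro D h'
    by_cases hne : C = D
    · exact Eventually.of_forall fun ρ h => absurd hne h
    · obtain ⟨δ, hδ, hd⟩ := (hdisj C h D h' hne).exists_thickenings (hAc C h) (hAc D h').isClosed
      filter_upwards [Ioo_mem_nhdsGT hδ] with ρ hρ _
      exact hd.mono (Metric.thickening_mono hρ.2.le _) (Metric.thickening_mono hρ.2.le _)
  filter_upwards [hthick, self_mem_nhdsWithin] with ρ hρd hρ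
  replace hρ : 0 < ρ := hρ
  rw [le_div_iff₀ (by positivity)]
  have hsum : ∑ C ∈ 𝒞, (volume (Metric.thickening ρ (A C))).toReal ≤
      (volume (Metric.thickening ρ S)).toReal := by
    rw [← ENNReal.toReal_sum (fun C h => (hAc C h).isBounded.thickening.measure_lt_top.ne)]
    refine ENNReal.toReal_mono hS.isBounded.thickening.measure_lt_top.ne ?_
    rw [← measure_biUnion_finset]
    · refine measure_mono (iUnion₂_subset fun C h => ?_)
      exact Metric.thickening_subset_of_subset _ (sdiff_subset.trans (hC C h).2.2)
    · intro C h D h' hne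
      exact hρd C h D h' hne
    · intro C h
      exact Metric.isOpen_thickening.measurableSet
  refine le_trans ?_ hsum
  have hpiece := Finset.sum_le_sum fun C h =>
    lower_piece (hC C h).1 (hC C h).2.1 F' hr.le hρ.le
  refine le_trans ?_ hpiece
  rw [← Finset.mul_sum, Finset.sum_sub_distrib, Finset.sum_const, nsmul_eq_mul, mul_comm]
  refine mul_le_mul_of_nonneg_left ?_ (by positivity)
  have : (𝒞.card : ℝ) * (2 * r * F'.card) ≤ ε / 2 := by
    have h1 : r * N = ε / 2 := div_mul_cancel₀ _ hN.ne'
    have h2 : (𝒞.card : ℝ) * (2 * r * F'.card) = r * N - r := by simp only [N]; ring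
    linarith
  linarith

/-! ### A crude covering estimate -/

lemma crude {C K : Set E2} (hCb : Bornology.IsBounded C) (hC : IsPreconnected C)
    (hK : K ⊆ C) (hKne : K.Nonempty)
    (hfin : μH[1] C < ⊤) {r ρ : ℝ} (hr : 0 < r) (hρ : 0 < ρ) :
    (volume (Metric.thickening ρ C)).toReal ≤ (volume (Metric.thickening (ρ + r) K)).toReal +
      (μH[1] (C \ K)).toReal / r * ((2 * r + ρ) ^ 2 * Real.pi) := by
  classical
  let B : Set E2 := C \ Metric.thickening r K
  let ε : ℝ≥0 := ⟨2 * r, by positivity⟩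
  have hεr : (ε : ℝ≥0∞) = ENNReal.ofReal (2 * r) := by
    rw [ENNReal.ofReal_eq_coe_nnreal (by positivity)]
    rfl
  obtain ⟨k, hk⟩ := hKne
  have hfin' : μH[1] (C \ K) ≠ ⊤ := ((measure_mono sdiff_subset).trans_lt hfin).ne
  have hcard : ∀ T : Finset E2, (T : Set E2) ⊆ B → Metric.IsSeparated (ε : ℝ≥0∞) (T : Set E2) →
      (T.card : ℝ) ≤ (μH[1] (C \ K)).toReal / r := by
    intro T hTB hT
    have hsep : ∀ x ∈ T, ∀ y ∈ T, x ≠ y → 2 * r < dist x y := by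
      intro x hx y hy hxy
      have h1 : (ε : ℝ≥0∞) < edist x y := hT hx hy hxy
      rw [hεr, edist_dist, ENNReal.ofReal_lt_ofReal_iff_of_nonneg (by positivity)] at h1
      exact h1
    have hmeas : ∑ x ∈ T, μH[1] ((C \ K) ∩ Metric.ball x r) ≤ μH[1] (C \ K) := by
      have h2 : ∑ x ∈ T, (μH[1].restrict (C \ K)) (Metric.ball x r) ≤
          (μH[1].restrict (C \ K)) univ := by
        rw [← measure_biUnion_finset]
        · exact measure_mono (subset_univ _)
        · intro x hx y hy hxy
          refine Metric.ball_disjoint_ball ?_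
          linarith [hsep x hx y hy hxy]
        · intro x _; exact Metric.isOpen_ball.measurableSet
      simp only [Measure.restrict_apply Metric.isOpen_ball.measurableSet,
        Measure.restrict_apply_univ] at h2
      simpa only [inter_comm] using h2
    have hle : ∑ x ∈ T, ENNReal.ofReal r ≤ μH[1] (C \ K) := by
      refine le_trans (Finset.sum_le_sum fun x hx => ?_) hmeas
      have hxB := hTB hx
      have hfar : ∀ y ∈ K, r ≤ dist y x := by
        intro y hy
        by_contra hcon
        refine hxB.2 (Metric.mem_thickening_iff.2 ⟨y, hy, ?_⟩)
        rw [dist_comm]; exact not_le.1 hcon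
      refine (ball_lower hC hxB.1 (hK hk) (hfar k hk)).trans (measure_mono ?_)
      rintro z ⟨hzC, hz⟩
      exact ⟨⟨hzC, fun hzK => absurd (hfar z hzK) (not_le.2 (Metric.mem_ball.1 hz))⟩, hz⟩
    rw [Finset.sum_const, nsmul_eq_mul] at hle
    have := ENNReal.toReal_mono hfin' hle
    rw [ENNReal.toReal_mul, ENNReal.toReal_ofReal hr.le, ENNReal.toReal_natCast] at this
    rw [le_div_iff₀ hr]; exact this
  have hpack : Metric.packingNumber ε B ≠ ⊤ := by
    obtain ⟨n, hn⟩ := exists_nat_gt ((μH[1] (C \ K)).toReal / r)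
    refine ne_top_of_le_ne_top (ENat.natCast_ne_top n) (iSup₂_le fun P hPB => iSup_le fun hP => ?_)
    by_contra hcon
    push Not at hcon
    have h1 : ((n + 1 : ℕ) : ℕ∞) ≤ P.encard := by
      push_cast; exact Order.add_one_le_of_lt hcon
    obtain ⟨Q, hQP, hQ⟩ := Set.exists_subset_encard_eq h1
    have hQf : Q.Finite := Set.finite_of_encard_eq_coe hQ
    have h2 := hcard hQf.toFinset (by simpa using hQP.trans hPB) (by simpa using hP.subset hQP)
    have h3 : hQf.toFinset.card = n + 1 := by
      rw [hQf.encard_eq_coe_toFinset_card] at hQ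
      exact_mod_cast hQ
    rw [h3] at h2
    push_cast at h2
    linarith
  have hPf : (Metric.maximalSeparatedSet ε B).Finite := by
    rw [← Set.encard_ne_top_iff, Metric.encard_maximalSeparatedSet hpack]; exact hpack
  have hcover := Metric.isCover_maximalSeparatedSet hpack
  let P := hPf.toFinset
  have hPcard := hcard P (by simpa [P] using Metric.maximalSeparatedSet_subset)
    (by simpa [P] using Metric.isSeparated_maximalSeparatedSet)
  have hsub : Metric.thickening ρ C ⊆ Metric.thickening (ρ + r) K ∪
      ⋃ p ∈ P, Metric.ball p (2 * r + ρ) := by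
    intro x hx
    obtain ⟨z, hz, hxz⟩ := Metric.mem_thickening_iff.1 hx
    by_cases hzK : z ∈ Metric.thickening r K
    · left
      obtain ⟨y, hy, hzy⟩ := Metric.mem_thickening_iff.1 hzK
      refine Metric.mem_thickening_iff.2 ⟨y, hy, ?_⟩
      linarith [dist_triangle x z y]
    · right
      obtain ⟨p, hp, hzp⟩ := hcover (show z ∈ B from ⟨hz, hzK⟩)
      refine mem_biUnion (show p ∈ (P : Set E2) by simpa [P] using hp) ?_
      have h1 : edist z p ≤ ENNReal.ofReal (2 * r) := by rw [← hεr]; exact hzp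
      rw [edist_dist, ENNReal.ofReal_le_ofReal_iff (by positivity)] at h1
      rw [Metric.mem_ball]
      linarith [dist_triangle x z p]
  have hKb : Bornology.IsBounded K := hCb.subset hK
  have hKfin : volume (Metric.thickening (ρ + r) K) ≠ ⊤ := hKb.thickening.measure_lt_top.ne
  have hvol : volume (Metric.thickening ρ C) ≤ volume (Metric.thickening (ρ + r) K) +
      ENNReal.ofReal (P.card * ((2 * r + ρ) ^ 2 * Real.pi)) := by
    refine (measure_mono hsub).trans ((measure_union_le _ _).trans ?_)
    gcongr
    refine (measure_biUnion_finset_le _ _).trans ?_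
    simp only [EuclideanSpace.volume_ball_fin_two]
    rw [Finset.sum_const, nsmul_eq_mul, ENNReal.ofReal_mul (by positivity),
      ENNReal.ofReal_mul (by positivity), ENNReal.ofReal_natCast, ENNReal.ofReal_pow (by positivity)]
  have := ENNReal.toReal_mono (by finiteness) hvol
  rw [ENNReal.toReal_add hKfin (by finiteness), ENNReal.toReal_ofReal (by positivity)] at this
  refine this.trans ?_
  gcongr

/-! ### Strips over points with a single preimage -/

lemma strip_lower {X : Type*} [MetricSpace X] [MeasurableSpace X] [BorelSpace X]
    {C : Set X} (hC : IsClosed C) (hCc : IsPreconnected C) {f : X → ℝ}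
    (hf : Continuous f) {p q : X} (hp : p ∈ C) (hq : q ∈ C) (hpq : f p < f q)
    (hp1 : ∀ z ∈ C, f z = f p → z = p) (hq1 : ∀ z ∈ C, f z = f q → z = q) :
    ENNReal.ofReal (dist q p) ≤ μH[1] (C ∩ f ⁻¹' Icc (f p) (f q)) := by
  classical
  let R : X → X := fun z => if f z ≤ f p then p else if f q ≤ f z then q else z
  have hcont : ContinuousOn R C := by
    have h1 : ContinuousOn R (C ∩ f ⁻¹' Iic (f p)) :=
      (continuousOn_const (c := p)).congr fun z hz => by simp [R, show f z ≤ f p from hz.2]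
    have h2 : ContinuousOn R (C ∩ f ⁻¹' Ici (f q)) :=
      (continuousOn_const (c := q)).congr fun z hz => by
        have : f q ≤ f z := hz.2
        simp [R, this, not_le.2 (hpq.trans_le this)]
    have h3 : ContinuousOn R (C ∩ f ⁻¹' Icc (f p) (f q)) :=
      continuousOn_id.congr fun z hz => by
        simp only [R, id]
        split_ifs with h h'
        · exact (hp1 z hz.1 (le_antisymm h hz.2.1)).symm
        · exact (hq1 z hz.1 (le_antisymm hz.2.2 h')).symm
        · rfl
    have h4 := (h1.union_of_isClosed h2 (hC.inter (isClosed_Iic.preimage hf))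
      (hC.inter (isClosed_Ici.preimage hf))).union_of_isClosed h3
      ((hC.inter (isClosed_Iic.preimage hf)).union (hC.inter (isClosed_Ici.preimage hf)))
      (hC.inter (isClosed_Icc.preimage hf))
    refine h4.mono fun z hz => ?_
    by_cases ha : f z ≤ f p
    · exact Or.inl (Or.inl ⟨hz, ha⟩)
    · by_cases hb : f q ≤ f z
      · exact Or.inl (Or.inr ⟨hz, hb⟩)
      · exact Or.inr ⟨hz, (not_le.1 ha).le, (not_le.1 hb).le⟩
  have himg := hCc.image R hcont
  have hpR : p ∈ R '' C := ⟨p, hp, by simp [R]⟩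
  have hqR : q ∈ R '' C := ⟨q, hq, by simp [R, not_le.2 hpq]⟩
  refine (conn_lower himg hpR hqR).trans (measure_mono ?_)
  rintro _ ⟨z, hz, rfl⟩
  simp only [R]
  split_ifs with h h'
  · exact ⟨hp, le_rfl, hpq.le⟩
  · exact ⟨hq, hpq.le, le_rfl⟩
  · exact ⟨hz, (not_le.1 h).le, (not_le.1 h').le⟩


lemma nu_bounds {X : Type*} [MetricSpace X] [MeasurableSpace X] [BorelSpace X]
    {C : Set X} (hfin : μH[1] C < ⊤) {f : X → ℝ} (hf : LipschitzWith 1 f) {c d : ℝ} (hd : 0 ≤ d)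
    (hfC : f '' C = Icc c (c + d)) {A : Set ℝ} (hA : MeasurableSet A) :
    (volume.restrict (Icc c (c + d))).real A ≤ ((μH[1].restrict C).map f).real A ∧
    ((μH[1].restrict C).map f).real A ≤ (volume.restrict (Icc c (c + d))).real A +
      ((μH[1] C).toReal - d) := by
  have hfm : Measurable f := hf.continuous.measurable
  have : IsFiniteMeasure (μH[1].restrict C) := ⟨by simpa using hfin⟩
  have : IsFiniteMeasure ((μH[1].restrict C).map f) := Measure.isFiniteMeasure_map _ _
  have key : ∀ A : Set ℝ, MeasurableSet A →
      (volume.restrict (Icc c (c + d))).real A ≤ ((μH[1].restrict C).map f).real A := by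
    intro A hA
    refine ENNReal.toReal_mono (measure_ne_top _ _) ?_
    rw [Measure.restrict_apply hA, Measure.map_apply hfm hA, Measure.restrict_apply (hfm hA)]
    refine le_trans (measure_mono ?_) (vol_image_le hf _)
    rintro t ⟨htA, htI⟩
    rw [← hfC] at htI
    obtain ⟨z, hz, rfl⟩ := htI
    exact ⟨z, ⟨htA, hz⟩, rfl⟩
  refine ⟨key A hA, ?_⟩
  have h1 := key Aᶜ hA.compl
  have h2 := measureReal_add_measureReal_compl (μ := volume.restrict (Icc c (c + d))) hA
  have h3 := measureReal_add_measureReal_compl (μ := (μH[1].restrict C).map f) hA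
  have h4 : (volume.restrict (Icc c (c + d))).real univ = d := by
    simp [Measure.real, hd]
  have h5 : ((μH[1].restrict C).map f).real univ = (μH[1] C).toReal := by
    simp [Measure.real, Measure.map_apply hfm MeasurableSet.univ]
  rw [h4] at h2
  rw [h5] at h3
  linarith

lemma multi_set {X : Type*} [MetricSpace X] [MeasurableSpace X] [BorelSpace X]
    {C : Set X} (hfin : μH[1] C < ⊤) {f : X → ℝ} (hf : LipschitzWith 1 f) {c d : ℝ} (hd : 0 ≤ d)
    (hfC : f '' C = Icc c (c + d)) :
    ∃ N : Set ℝ, MeasurableSet N ∧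
      (volume.restrict (Icc c (c + d))).real N ≤ (μH[1] C).toReal - d ∧
      ∀ z ∈ C, ∀ w ∈ C, f z = f w → f z ∉ N → z = w := by
  classical
  obtain ⟨g, hgm, hgi, hg⟩ := eilenberg hf C hfin
  have hNm : MeasurableSet {t | 2 ≤ g t} := measurableSet_le measurable_const hgm
  refine ⟨{t | 2 ≤ g t}, hNm, ?_, ?_⟩
  · have h1 : ∀ t, (Icc c (c + d)).indicator 1 t + ({t | 2 ≤ g t} ∩ Icc c (c + d)).indicator 1 t ≤ g t := by
      intro t
      by_cases ht : t ∈ Icc c (c + d)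
      · by_cases h2 : 2 ≤ g t
        · have : t ∈ {t | 2 ≤ g t} ∩ Icc c (c + d) := ⟨h2, ht⟩
          rw [indicator_of_mem ht, indicator_of_mem this]
          simpa [one_add_one_eq_two] using h2
        · have : t ∉ {t | 2 ≤ g t} ∩ Icc c (c + d) := fun h => h2 h.1
          rw [indicator_of_mem ht, indicator_of_notMem this]
          have ht' := ht
          rw [← hfC] at ht'
          obtain ⟨z, hz, hzt⟩ := ht'
          have := hg t {z} (by simpa using ⟨hz, hzt⟩)
          simpa using this
      · have : t ∉ {t | 2 ≤ g t} ∩ Icc c (c + d) := fun h => ht h.2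
        rw [indicator_of_notMem ht, indicator_of_notMem this]
        simp
    have h2 := (lintegral_mono h1).trans hgi
    rw [lintegral_add_left (measurable_one.indicator measurableSet_Icc),
      lintegral_indicator_one measurableSet_Icc,
      lintegral_indicator_one (hNm.inter measurableSet_Icc), Real.volume_Icc] at h2
    have h3 := ENNReal.toReal_mono hfin.ne h2
    have h4 : volume ({t | 2 ≤ g t} ∩ Icc c (c + d)) ≠ ⊤ :=
      ((measure_mono inter_subset_right).trans_lt measure_Icc_lt_top).ne
    rw [ENNReal.toReal_add (by finiteness) h4, ENNReal.toReal_ofReal (by linarith)] at h3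
    rw [Measure.real, Measure.restrict_apply hNm]
    linarith
  · intro z hz w hw hzw hN
    by_contra hne
    refine hN ?_
    have := hg (f z) {z, w} (by
      intro x hx
      simp only [Finset.coe_insert, Finset.coe_singleton, mem_insert_iff, mem_singleton_iff] at hx
      rcases hx with rfl | rfl
      · exact ⟨hz, rfl⟩
      · exact ⟨hw, hzw.symm⟩)
    rw [Finset.card_pair hne] at this
    exact_mod_cast this

lemma bad_bins {ν lam : Measure ℝ} [IsFiniteMeasure ν] [IsFiniteMeasure lam] {e c ℓ lm : ℝ}
    (hup : ∀ A, MeasurableSet A → ν.real A ≤ lam.real A + e)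
    (hlam : lam ≤ volume) (hℓ : 0 < ℓ) (hlm : 0 < lm) (bad : Finset ℕ)
    (hbad : ∀ k ∈ bad, lm * ℓ ≤ ν.real (Ico (c + k * ℓ) (c + (k + 1) * ℓ)) -
      lam.real (Ico (c + k * ℓ) (c + (k + 1) * ℓ))) :
    ν.real (⋃ k ∈ bad, Ico (c + k * ℓ) (c + (k + 1) * ℓ)) ≤ e + e / lm := by
  set I : ℕ → Set ℝ := fun k => Ico (c + k * ℓ) (c + (k + 1) * ℓ) with hI
  have hdisj : (bad : Set ℕ).PairwiseDisjoint I := by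
    have key : ∀ i j : ℕ, i < j → Disjoint (I i) (I j) := by
      intro i j hij
      rw [Set.disjoint_left]
      rintro t ⟨_, h1⟩ ⟨h2, _⟩
      have : (i : ℝ) + 1 ≤ j := by exact_mod_cast hij
      nlinarith
    intro i _ j _ hij
    rcases lt_or_gt_of_ne hij with h | h
    · exact key i j h
    · exact (key j i h).symm
  have hm : ∀ k ∈ bad, MeasurableSet (I k) := fun k _ => measurableSet_Ico
  have h1 := measureReal_biUnion_finset (μ := ν) hdisj hm
  have h2 := measureReal_biUnion_finset (μ := lam) hdisj hm
  have h3 := hup (⋃ k ∈ bad, I k) (Finset.measurableSet_biUnion _ hm)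
  have h4 : (bad.card : ℝ) * (lm * ℓ) ≤ ∑ k ∈ bad, (ν.real (I k) - lam.real (I k)) := by
    rw [← nsmul_eq_mul]
    exact Finset.card_nsmul_le_sum _ _ _ hbad
  rw [Finset.sum_sub_distrib, ← h1, ← h2] at h4
  have h5 : ∀ k ∈ bad, lam.real (I k) ≤ ℓ := by
    intro k _
    have : lam (I k) ≤ ENNReal.ofReal ℓ := by
      refine (hlam _).trans ?_
      simp only [hI, Real.volume_Ico]
      refine ENNReal.ofReal_le_ofReal (by linarith)
    have := ENNReal.toReal_mono (by finiteness) this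
    rwa [ENNReal.toReal_ofReal hℓ.le] at this
  have h6 : lam.real (⋃ k ∈ bad, I k) ≤ bad.card * ℓ := by
    rw [h2, ← nsmul_eq_mul]
    exact Finset.sum_le_card_nsmul _ _ _ h5
  have h7 : (bad.card : ℝ) * ℓ ≤ e / lm := by
    rw [le_div_iff₀ hlm]
    linarith
  linarith

lemma good_piece {C : Set E2} (hC : IsCompact C) (hCc : IsPreconnected C) (hfin : μH[1] C < ⊤)
    {f h : E2 → ℝ} (hfh : ∀ z w, dist z w ^ 2 = (f z - f w) ^ 2 + (h z - h w) ^ 2)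
    {c d : ℝ} (hd : 0 ≤ d) (hfC : f '' C = Icc c (c + d))
    {x ℓ lm : ℝ} (hlm0 : 0 ≤ lm) (hlm : lm ≤ 1)
    (hgood : ((μH[1].restrict C).map f).real (Ico x (x + ℓ)) -
      (volume.restrict (Icc c (c + d))).real (Ico x (x + ℓ)) ≤ lm * ℓ)
    {z w : E2} (hz : z ∈ C) (hw : w ∈ C) (hzI : f z ∈ Ico x (x + ℓ)) (hwI : f w ∈ Ico x (x + ℓ))
    (hz1 : ∀ y ∈ C, f y = f z → y = z) (hw1 : ∀ y ∈ C, f y = f w → y = w) (hzw : f z < f w) :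
    (h w - h z) ^ 2 ≤ 3 * lm * ℓ ^ 2 := by
  have hf := coord_lip hfh
  have hfm : Measurable f := hf.continuous.measurable
  have : IsFiniteMeasure (μH[1].restrict C) := ⟨by simpa using hfin⟩
  have : IsFiniteMeasure ((μH[1].restrict C).map f) := Measure.isFiniteMeasure_map _ _
  have h1 := strip_lower hC.isClosed hCc hf.continuous hz hw hzw hz1 hw1
  have h2 : dist w z ≤ ((μH[1].restrict C).map f).real (Icc (f z) (f w)) := by
    rw [Measure.real, Measure.map_apply hfm measurableSet_Icc,
      Measure.restrict_apply (hfm measurableSet_Icc), inter_comm]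
    have := ENNReal.toReal_mono ((measure_mono inter_subset_left).trans_lt hfin).ne h1
    rwa [ENNReal.toReal_ofReal dist_nonneg] at this
  have hsub : Icc (f z) (f w) ⊆ Ico x (x + ℓ) := fun t ht =>
    ⟨hzI.1.trans ht.1, ht.2.trans_lt hwI.2⟩
  have h3 := (nu_bounds hfin hf hd hfC (A := Ico x (x + ℓ) \ Icc (f z) (f w))
    (measurableSet_Ico.diff measurableSet_Icc)).1
  rw [measureReal_sdiff hsub measurableSet_Icc, measureReal_sdiff hsub measurableSet_Icc] at h3
  have h4 : (volume.restrict (Icc c (c + d))).real (Icc (f z) (f w)) ≤ f w - f z := by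
    have h5 : (volume.restrict (Icc c (c + d))) (Icc (f z) (f w)) ≤ ENNReal.ofReal (f w - f z) := by
      rw [← Real.volume_Icc]
      exact Measure.restrict_le_self _
    have := ENNReal.toReal_mono (by finiteness) h5
    rwa [ENNReal.toReal_ofReal (by linarith)] at this
  have h6 : dist w z ≤ (f w - f z) + lm * ℓ := by linarith
  have h7 := hfh w z
  have hu : f w - f z ≤ ℓ := by linarith [hzI.1, hwI.2]
  have hu0 : 0 < f w - f z := by linarith
  have hℓ : 0 < ℓ := hu0.trans_le hu
  have h8 : dist w z ^ 2 ≤ ((f w - f z) + lm * ℓ) ^ 2 := pow_le_pow_left₀ dist_nonneg h6 2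
  have h9 : (f w - f z) * (lm * ℓ) ≤ ℓ * (lm * ℓ) := mul_le_mul_of_nonneg_right hu (by positivity)
  have h10 : lm * (lm * ℓ ^ 2) ≤ 1 * (lm * ℓ ^ 2) := mul_le_mul_of_nonneg_right hlm (by positivity)
  nlinarith

lemma good_set {C : Set E2} (hC : IsCompact C) (hCc : IsConnected C) (hfin : μH[1] C < ⊤)
    {m σ : ℝ} (hm : 1 ≤ m) (hσ : 0 < σ) :
    ∃ K ⊆ C, K.Nonempty ∧
      (μH[1] (C \ K)).toReal ≤ 3 * (1 + m ^ 4) * ((μH[1] C).toReal - Metric.diam C) ∧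
      (volume (Metric.thickening σ K)).toReal ≤
        Real.pi * σ ^ 2 + 2 * σ * (Metric.diam C + m * σ) * (1 + 2 / m) * (1 + 1 / m) := by
  classical
  obtain ⟨a, ha, b, hb, hmax, hdiam⟩ := exists_diam hC hCc.nonempty
  obtain ⟨f, h, hfh, hab, hmp⟩ := exists_coords a b
  have hf := coord_lip hfh
  have hfm : Measurable f := hf.continuous.measurable
  rw [hdiam]
  set d := dist b a with hd'
  have hd : 0 ≤ d := dist_nonneg
  set c := f a with hc
  have hfC : f '' C = Icc c (c + d) := by
    refine Subset.antisymm ?_ ?_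
    · rintro _ ⟨z, hz, rfl⟩
      have h1 := (coord_le hfh z a).1.trans (hmax z hz a ha)
      have h2 := (coord_le hfh z b).1.trans (hmax z hz b hb)
      rw [abs_le] at h1 h2
      exact ⟨by linarith [h2.1], by linarith [h1.2]⟩
    · have := (hCc.isPreconnected.image f hf.continuous.continuousOn).Icc_subset
        (mem_image_of_mem f ha) (mem_image_of_mem f hb)
      rwa [show c + d = f b by linarith]
  obtain ⟨N, hNm, hN, hN1⟩ := multi_set hfin hf hd hfC
  have hbd := fun (A : Set ℝ) (hA : MeasurableSet A) => nu_bounds hfin hf hd hfC hA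
  set ν := (μH[1].restrict C).map f with hν
  set lam := volume.restrict (Icc c (c + d)) with hlamdef
  set e := (μH[1] C).toReal - d with he
  have : IsFiniteMeasure (μH[1].restrict C) := ⟨by simpa using hfin⟩
  have : IsFiniteMeasure ν := Measure.isFiniteMeasure_map _ _
  have hm0 : 0 < m := by linarith
  set ℓ := m * σ with hℓ
  have hℓ0 : 0 < ℓ := by positivity
  set lm := 1 / (3 * m ^ 4) with hlm
  have hlm0 : 0 < lm := by positivity
  have hlm1 : lm ≤ 1 := by
    rw [hlm, div_le_one (by positivity)]
    have : 1 ≤ m ^ 4 := one_le_pow₀ hm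
    linarith
  set n := ⌊d / ℓ⌋₊ + 1 with hn
  let I : ℕ → Set ℝ := fun k => Ico (c + k * ℓ) (c + (k + 1) * ℓ)
  let bad := (Finset.range n).filter fun k => lm * ℓ < ν.real (I k) - lam.real (I k)
  let good := (Finset.range n).filter fun k => ¬ (lm * ℓ < ν.real (I k) - lam.real (I k))
  have hB := bad_bins (ν := ν) (lam := lam) (e := e) (c := c) (ℓ := ℓ) (lm := lm)
    (fun A hA => (hbd A hA).2) Measure.restrict_le_self hℓ0 hlm0 bad
    (fun k hk => (Finset.mem_filter.1 hk).2.le)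
  have hcover : ∀ t ∈ Icc c (c + d), ∃ k ∈ Finset.range n, t ∈ I k := by
    intro t ht
    have h0 : 0 ≤ (t - c) / ℓ := div_nonneg (by linarith [ht.1]) hℓ0.le
    refine ⟨⌊(t - c) / ℓ⌋₊, ?_, ?_, ?_⟩
    · rw [Finset.mem_range, hn, Nat.lt_succ_iff]
      refine Nat.floor_le_floor ?_
      gcongr
      linarith [ht.2]
    · have := Nat.floor_le h0
      rw [le_div_iff₀ hℓ0] at this
      linarith
    · have := Nat.lt_floor_add_one ((t - c) / ℓ)
      rw [div_lt_iff₀ hℓ0] at this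
      linarith
  let P : ℕ → Set E2 := fun k => C ∩ f ⁻¹' (I k \ N)
  refine ⟨{a} ∪ ⋃ k ∈ good, P k, ?_, ⟨a, Or.inl rfl⟩, ?_, ?_⟩
  · rintro z (rfl | hz)
    · exact ha
    · simp only [mem_iUnion] at hz
      obtain ⟨k, _, hz⟩ := hz
      exact hz.1
  · have hBm : MeasurableSet (⋃ k ∈ bad, I k) :=
      Finset.measurableSet_biUnion _ fun k _ => measurableSet_Ico
    have h1 : (μH[1] (C \ ({a} ∪ ⋃ k ∈ good, P k))) ≤ ν ((⋃ k ∈ bad, I k) ∪ N) := by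
      rw [Measure.map_apply hfm (hBm.union hNm), Measure.restrict_apply (hfm (hBm.union hNm))]
      refine measure_mono ?_
      rintro z ⟨hzC, hz⟩
      refine ⟨?_, hzC⟩
      by_contra hcon
      have hcon' : f z ∉ (⋃ k ∈ bad, I k) ∪ N := hcon
      rw [mem_union, not_or] at hcon'
      obtain ⟨k, hk, hkz⟩ := hcover (f z) (hfC ▸ mem_image_of_mem f hzC)
      refine hz (Or.inr ?_)
      simp only [mem_iUnion]
      refine ⟨k, Finset.mem_filter.2 ⟨hk, fun hbad => hcon'.1 ?_⟩, hzC, hkz, hcon'.2⟩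
      simp only [mem_iUnion]
      exact ⟨k, Finset.mem_filter.2 ⟨hk, hbad⟩, hkz⟩
    have h2 := ENNReal.toReal_mono (measure_ne_top _ _) h1
    have h3 : (ν ((⋃ k ∈ bad, I k) ∪ N)).toReal ≤ ν.real (⋃ k ∈ bad, I k) + ν.real N :=
      measureReal_union_le _ _
    have h4 := (hbd N hNm).2
    have h5 : e / lm = 3 * m ^ 4 * e := by
      rw [hlm]; field_simp
    rw [h5] at hB
    have hB' : ν.real (⋃ k ∈ bad, I k) ≤ e + 3 * m ^ 4 * e := hB
    linarith
  · have hpiece : ∀ k ∈ good, volume (Metric.thickening σ (P k)) ≤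
        ENNReal.ofReal ((ℓ + 2 * σ) * (2 * (σ / m) + 2 * σ)) := by
      intro k hk
      have hgood := not_lt.1 (Finset.mem_filter.1 hk).2
      rcases (P k).eq_empty_or_nonempty with hemp | ⟨p, hp⟩
      · rw [hemp]; simp
      have hIk : I k = Ico (c + k * ℓ) (c + k * ℓ + ℓ) := by
        simp only [I]; congr 1; ring
      rw [hIk] at hgood
      have hsing : ∀ z ∈ P k, ∀ y ∈ C, f y = f z → y = z := by
        intro z hz y hy hyz
        exact hN1 y hy z hz.1 hyz (hyz ▸ hz.2.2)
      have key : ∀ z ∈ P k, ∀ w ∈ P k, f z < f w → |h w - h z| ≤ σ / m := by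
        intro z hz w hw hzw
        refine abs_le_of_sq_le_sq ?_ (by positivity)
        have := good_piece hC hCc.isPreconnected hfin hfh hd hfC hlm0.le hlm1 hgood hz.1 hw.1
          (hIk ▸ hz.2.1) (hIk ▸ hw.2.1) (hsing z hz) (hsing w hw) hzw
        refine this.trans (le_of_eq ?_)
        rw [hlm, hℓ]
        field_simp
      refine box_upper hfh hmp (α := c + k * ℓ) (β := h p) hℓ0.le hσ.le ?_
      intro z hz
      have hzI : f z ∈ Ico (c + k * ℓ) (c + k * ℓ + ℓ) := hIk ▸ hz.2.1
      refine ⟨hzI.1, hzI.2.le, ?_⟩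
      rcases lt_trichotomy (f z) (f p) with hlt | heq | hgt
      · rw [abs_sub_comm]; exact key z hz p hp hlt
      · rw [hsing p hp z hz.1 heq]; simp; positivity
      · exact key p hp z hz hgt
    have hvol : volume (Metric.thickening σ ({a} ∪ ⋃ k ∈ good, P k)) ≤
        ENNReal.ofReal (Real.pi * σ ^ 2) +
          ENNReal.ofReal (n * ((ℓ + 2 * σ) * (2 * (σ / m) + 2 * σ))) := by
      rw [Metric.thickening_union, Metric.thickening_singleton]
      refine (measure_union_le _ _).trans (add_le_add ?_ ?_)
      · rw [EuclideanSpace.volume_ball_fin_two, mul_comm Real.pi, ENNReal.ofReal_mul (by positivity),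
          ENNReal.ofReal_pow hσ.le]
      · simp only [Metric.thickening_iUnion]
        refine (measure_biUnion_finset_le _ _).trans ((Finset.sum_le_sum hpiece).trans ?_)
        rw [Finset.sum_const, nsmul_eq_mul, ENNReal.ofReal_mul (p := (n : ℝ)) (by positivity),
          ENNReal.ofReal_natCast]
        gcongr
        exact (Finset.card_filter_le _ _).trans (by simp)
    have h1 := ENNReal.toReal_mono (by finiteness) hvol
    rw [ENNReal.toReal_add (by finiteness) (by finiteness), ENNReal.toReal_ofReal (by positivity),
      ENNReal.toReal_ofReal (by positivity)] at h1
    refine h1.trans (add_le_add le_rfl ?_)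
    have h2 : (n : ℝ) * ℓ ≤ d + m * σ := by
      have := Nat.floor_le (div_nonneg hd hℓ0.le)
      rw [le_div_iff₀ hℓ0] at this
      rw [hn]; push_cast
      linarith
    have h3 : (n : ℝ) * ((ℓ + 2 * σ) * (2 * (σ / m) + 2 * σ)) =
        (n * ℓ) * (2 * σ * (1 + 2 / m) * (1 + 1 / m)) := by
      rw [hℓ]; field_simp; ring
    rw [h3]
    calc _ ≤ (d + m * σ) * (2 * σ * (1 + 2 / m) * (1 + 1 / m)) :=
          mul_le_mul_of_nonneg_right h2 (by positivity)
      _ = _ := by ring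

lemma upper_piece {C : Set E2} (hC : IsCompact C) (hCc : IsConnected C) (hfin : μH[1] C < ⊤)
    {m ρ : ℝ} (hm : 1 ≤ m) (hρ : 0 < ρ) :
    (volume (Metric.thickening ρ C)).toReal ≤
      2 * ρ * ((1 + 1 / m) ^ 2 * (1 + 2 / m)) * Metric.diam C +
      ρ * (3 * (1 + m ^ 4) * m * (1 + 2 / m) ^ 2 * Real.pi) *
        ((μH[1] C).toReal - Metric.diam C) +
      ρ ^ 2 * ((1 + 1 / m) ^ 2 * (Real.pi + 2 * m * (1 + 1 / m) * (1 + 2 / m))) := by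
  have hm0 : 0 < m := by linarith
  obtain ⟨K, hKC, hKne, h1, h2⟩ := good_set hC hCc hfin hm (σ := ρ + ρ / m) (by positivity)
  have h3 := crude hC.isBounded hCc.isPreconnected hKC hKne hfin (r := ρ / m) (by positivity) hρ
  have h4 : (μH[1] (C \ K)).toReal / (ρ / m) * ((2 * (ρ / m) + ρ) ^ 2 * Real.pi) ≤
      3 * (1 + m ^ 4) * ((μH[1] C).toReal - Metric.diam C) / (ρ / m) *
        ((2 * (ρ / m) + ρ) ^ 2 * Real.pi) := by
    refine mul_le_mul_of_nonneg_right ?_ (by positivity)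
    exact div_le_div_of_nonneg_right h1 (by positivity)
  refine (h3.trans (add_le_add h2 h4)).trans (le_of_eq ?_)
  field_simp
  ring

lemma upper_bound {S : Set E2} (hS : IsCompact S) (hSc : IsConnected S)
    (hfin : μH[1] S < ⊤) {ε : ℝ} (hε : 0 < ε) :
    ∀ᶠ ρ in 𝓝[>] (0 : ℝ), (volume (Metric.thickening ρ S)).toReal / (2 * ρ) ≤
      (μH[1] S).toReal + ε := by
  set H := (μH[1] S).toReal with hH
  have hH0 : 0 ≤ H := ENNReal.toReal_nonneg
  obtain ⟨m, hm, hmH⟩ : ∃ m : ℝ, 1 ≤ m ∧ (1 + 1 / m) ^ 2 * (1 + 2 / m) * H ≤ H + ε / 3 := by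
    have ht : Tendsto (fun m : ℝ => (1 + 1 / m) ^ 2 * (1 + 2 / m) * H) atTop
        (𝓝 ((1 + 0) ^ 2 * (1 + 0) * H)) := by
      have h1 : Tendsto (fun m : ℝ => 1 / m) atTop (𝓝 0) := tendsto_const_nhds.div_atTop tendsto_id
      have h2 : Tendsto (fun m : ℝ => 2 / m) atTop (𝓝 0) := tendsto_const_nhds.div_atTop tendsto_id
      exact (((h1.const_add 1).pow 2).mul (h2.const_add 1)).mul_const H
    have h3 := ht.eventually_le_const (u := H + ε / 3) (by norm_num; linarith)
    obtain ⟨m, h⟩ := ((eventually_ge_atTop (1 : ℝ)).and h3).exists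
    exact ⟨m, h.1, h.2⟩
  have hm0 : 0 < m := by linarith
  set G := (1 + 1 / m) ^ 2 * (1 + 2 / m) with hG
  set A := 3 * (1 + m ^ 4) * m * (1 + 2 / m) ^ 2 * Real.pi with hA
  set B := (1 + 1 / m) ^ 2 * (Real.pi + 2 * m * (1 + 1 / m) * (1 + 2 / m)) with hB
  have hG0 : 0 ≤ G := by positivity
  have hA0 : 0 < A := by positivity
  have hη : 0 < ε / (3 * A) := by positivity
  obtain ⟨𝒞, F, -, hcov, hC, -, hdiam, hsum⟩ := decomp_eta hS hSc.isPreconnected hfin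
    (η := ENNReal.ofReal (ε / (3 * A))) (by simpa using hη)
  have hCfin : ∀ C ∈ 𝒞, μH[1] C < ⊤ := fun C hCm =>
    (measure_mono (hC C hCm).2.2).trans_lt hfin
  have hdiam' : H ≤ ∑ C ∈ 𝒞, Metric.diam C + ε / (3 * A) := by
    have hf : ∀ C ∈ 𝒞, Metric.ediam C ≠ ⊤ := fun C hCm =>
      Metric.isBounded_iff_ediam_ne_top.1 (hC C hCm).1.isBounded
    have h1 := ENNReal.toReal_mono (ENNReal.add_ne_top.2
      ⟨(ENNReal.sum_lt_top.2 fun C hCm => (hf C hCm).lt_top).ne, ENNReal.ofReal_ne_top⟩) hdiam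
    rw [ENNReal.toReal_add (ENNReal.sum_lt_top.2 fun C hCm => (hf C hCm).lt_top).ne
      ENNReal.ofReal_ne_top, ENNReal.toReal_sum hf, ENNReal.toReal_ofReal hη.le] at h1
    exact h1
  have hsum' : ∑ C ∈ 𝒞, (μH[1] C).toReal ≤ H := by
    rw [← ENNReal.toReal_sum fun C hCm => (hCfin C hCm).ne]
    exact ENNReal.toReal_mono hfin.ne hsum
  have hdH : ∑ C ∈ 𝒞, Metric.diam C ≤ H := by
    refine le_trans (Finset.sum_le_sum fun C hCm => ?_) hsum'
    obtain ⟨a, ha, b, hb, -, hd⟩ := exists_diam (hC C hCm).1 (hC C hCm).2.1.nonempty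
    have := ENNReal.toReal_mono (hCfin C hCm).ne
      (conn_lower (hC C hCm).2.1.isPreconnected ha hb)
    rwa [ENNReal.toReal_ofReal dist_nonneg, ← hd] at this
  have ht : Tendsto (fun ρ : ℝ => ρ * (B * 𝒞.card / 2)) (𝓝[>] 0) (𝓝 (0 * (B * 𝒞.card / 2))) :=
    ((tendsto_id (α := ℝ)).mono_left nhdsWithin_le_nhds).mul_const _
  have h3 := ht.eventually_le_const (u := ε / 3) (by rw [zero_mul]; positivity)
  filter_upwards [h3, self_mem_nhdsWithin] with ρ hρ hρ0
  have hρ0 : 0 < ρ := hρ0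
  have hv : (volume (Metric.thickening ρ S)).toReal ≤
      ∑ C ∈ 𝒞, (volume (Metric.thickening ρ C)).toReal := by
    have hf : ∀ C ∈ 𝒞, volume (Metric.thickening ρ C) ≠ ⊤ := fun C hCm =>
      (hC C hCm).1.isBounded.thickening.measure_lt_top.ne
    rw [← ENNReal.toReal_sum hf]
    refine ENNReal.toReal_mono (ENNReal.sum_lt_top.2 fun C hCm => (hf C hCm).lt_top).ne ?_
    refine le_trans (measure_mono ?_) (measure_biUnion_finset_le 𝒞 fun C => Metric.thickening ρ C)
    refine (Metric.thickening_subset_of_subset ρ hcov).trans ?_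
    simp only [Metric.thickening_iUnion]
    exact Subset.rfl
  have hv2 : ∑ C ∈ 𝒞, (volume (Metric.thickening ρ C)).toReal ≤
      2 * ρ * G * ∑ C ∈ 𝒞, Metric.diam C +
      ρ * A * (∑ C ∈ 𝒞, (μH[1] C).toReal - ∑ C ∈ 𝒞, Metric.diam C) + 𝒞.card * (ρ ^ 2 * B) := by
    refine (Finset.sum_le_sum fun C hCm =>
      upper_piece (hC C hCm).1 (hC C hCm).2.1 (hCfin C hCm) hm hρ0).trans (le_of_eq ?_)
    rw [Finset.sum_add_distrib, Finset.sum_add_distrib, ← Finset.mul_sum, ← Finset.mul_sum,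
      Finset.sum_sub_distrib, Finset.sum_const, nsmul_eq_mul]
  have h5 : 2 * ρ * G * ∑ C ∈ 𝒞, Metric.diam C ≤ 2 * ρ * G * H :=
    mul_le_mul_of_nonneg_left hdH (by positivity)
  have h6 : ρ * A * (∑ C ∈ 𝒞, (μH[1] C).toReal - ∑ C ∈ 𝒞, Metric.diam C) ≤
      ρ * A * (ε / (3 * A)) := mul_le_mul_of_nonneg_left (by linarith) (by positivity)
  have h7 : ρ * A * (ε / (3 * A)) = ρ * (ε / 3) := by field_simp
  have h8 : 2 * ρ * (G * H) ≤ 2 * ρ * (H + ε / 3) := mul_le_mul_of_nonneg_left hmH (by positivity)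
  have h9 : 2 * ρ * (ρ * (B * 𝒞.card / 2)) ≤ 2 * ρ * (ε / 3) :=
    mul_le_mul_of_nonneg_left hρ (by positivity)
  rw [div_le_iff₀ (by positivity)]
  have h10 : 0 < ρ * ε := by positivity
  nlinarith

/-- for a compact connected `S ⊆ ℝ²` with `H¹(S) < ∞`, the one-dimensional
Minkowski content exists and equals `H¹(S)`: `L²(I_ρ(S))/(2ρ) → H¹(S)` as `ρ → 0⁺`
(here `I_ρ(S) = {x : d(x,S) < ρ}` is the open `ρ`-neighborhood, i.e. `Metric.thickening`).
In particular `L²(I_ρ(S)) → 0` as `ρ → 0⁺`. -/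
theorem stmt8 (S : Set E2) (hScpt : IsCompact S) (hSconn : IsConnected S)
    (hSfin : μH[1] S < ⊤) :
    Tendsto (fun ρ : ℝ => volume (Metric.thickening ρ S) / ENNReal.ofReal (2 * ρ))
      (𝓝[>] 0) (𝓝 (μH[1] S)) ∧
    Tendsto (fun ρ : ℝ => volume (Metric.thickening ρ S)) (𝓝[>] 0) (𝓝 0) := by
  have hfin : ∀ ρ : ℝ, volume (Metric.thickening ρ S) ≠ ⊤ := fun ρ =>
    hScpt.isBounded.thickening.measure_lt_top.ne
  have hreal : Tendsto (fun ρ : ℝ => (volume (Metric.thickening ρ S)).toReal / (2 * ρ))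
      (𝓝[>] 0) (𝓝 (μH[1] S).toReal) := by
    rw [Metric.tendsto_nhds]
    intro ε hε
    filter_upwards [lower_bound hScpt hSconn hSfin (half_pos hε),
      upper_bound hScpt hSconn hSfin (half_pos hε)] with ρ h1 h2
    rw [Real.dist_eq, abs_lt]
    constructor <;> linarith
  have h1 : Tendsto (fun ρ : ℝ => volume (Metric.thickening ρ S) / ENNReal.ofReal (2 * ρ))
      (𝓝[>] 0) (𝓝 (μH[1] S)) := by
    have := ENNReal.tendsto_ofReal hreal
    rw [ENNReal.ofReal_toReal hSfin.ne] at this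
    refine this.congr' ?_
    filter_upwards [self_mem_nhdsWithin] with ρ hρ
    have hρ : 0 < ρ := hρ
    rw [ENNReal.ofReal_div_of_pos (by positivity), ENNReal.ofReal_toReal (hfin ρ)]
  refine ⟨h1, ?_⟩
  have h2 : Tendsto (fun ρ : ℝ => (volume (Metric.thickening ρ S)).toReal / (2 * ρ) * (2 * ρ))
      (𝓝[>] 0) (𝓝 ((μH[1] S).toReal * (2 * 0))) :=
    hreal.mul (((tendsto_id (α := ℝ)).mono_left nhdsWithin_le_nhds).const_mul 2)
  have h3 := ENNReal.tendsto_ofReal h2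
  rw [mul_zero, mul_zero, ENNReal.ofReal_zero] at h3
  refine h3.congr' ?_
  filter_upwards [self_mem_nhdsWithin] with ρ hρ
  have hρ : 0 < ρ := hρ
  rw [div_mul_cancel₀ _ (by positivity), ENNReal.ofReal_toReal (hfin ρ)]

end
end

section
/- (Gołąb's theorem) Let Ω ⊂ ℝ² be open and bounded and let U ⊆ ℝ² be open. Let {K_n} be a sequence of nonempty compact connected subsets of closure(Ω), each with H¹(K_n) < ∞, converging in the Hausdorff metric to a nonempty compact set K ⊆ closure(Ω). Then K is connected and H¹(K ∩ U) ≤ liminf_{n→∞} H¹(K_n ∩ U). -/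
open MeasureTheory Set Filter Topology
open scoped ENNReal NNReal

noncomputable section

theorem isClosed_ccIn {X : Type*} [TopologicalSpace X] {F : Set X} (hF : IsClosed F) (x : X) :
    IsClosed (connectedComponentIn F x) := by
  by_cases hx : x ∈ F
  · refine isClosed_of_closure_subset ?_
    refine IsPreconnected.subset_connectedComponentIn isPreconnected_connectedComponentIn.closure
      (subset_closure (mem_connectedComponentIn hx)) ?_
    exact closure_minimal (connectedComponentIn_subset F x) hF
  · rw [connectedComponentIn_eq_empty hx]; exact isClosed_empty

/-- Boundary bumping: the component of `x` in `K ∩ closedBall x r` reaches the sphere. -/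
theorem bump_s10 {X : Type*} [MetricSpace X] {K : Set X} (hK : IsCompact K) (hc : IsPreconnected K)
    {x y : X} (hx : x ∈ K) (hy : y ∈ K) {r : ℝ} (hr : 0 < r) (hxy : r ≤ dist y x) :
    ∃ C ⊆ K ∩ Metric.closedBall x r, IsCompact C ∧ IsConnected C ∧ x ∈ C ∧
      ∃ z ∈ C, r ≤ dist z x := by
  set L := K ∩ Metric.closedBall x r with hLdef
  have hL : IsCompact L := hK.inter_right Metric.isClosed_closedBall
  have hxL : x ∈ L := ⟨hx, Metric.mem_closedBall_self hr.le⟩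
  refine ⟨connectedComponentIn L x, connectedComponentIn_subset L x,
    hL.of_isClosed_subset (isClosed_ccIn hL.isClosed x) (connectedComponentIn_subset L x),
    isConnected_connectedComponentIn_iff.2 hxL, mem_connectedComponentIn hxL, ?_⟩
  by_contra! hcon
  have : CompactSpace L := isCompact_iff_compactSpace.1 hL
  have hcc := connectedComponent_eq_iInter_isClopen (⟨x, hxL⟩ : L)
  rw [connectedComponentIn_eq_image hxL] at hcon
  have : Nonempty {s : Set L // IsClopen s ∧ (⟨x, hxL⟩ : L) ∈ s} :=
    ⟨⟨univ, isClopen_univ, mem_univ _⟩⟩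
  obtain ⟨⟨Z, hZ, hxZ⟩, hZs⟩ := exists_subset_nhds_of_compactSpace
    (V := fun s : {s : Set L // IsClopen s ∧ (⟨x, hxL⟩ : L) ∈ s} => (s : Set L))
    (by
      intro s t
      exact ⟨⟨s.1 ∩ t.1, s.2.1.inter t.2.1, s.2.2, t.2.2⟩, inter_subset_left, inter_subset_right⟩)
    (fun s => s.2.1.isClosed) (U := {p : L | dist (p : X) x < r})
    (by
      intro p hp
      rw [← hcc] at hp
      exact (isOpen_lt (by fun_prop) continuous_const).mem_nhds (hcon p ⟨p, hp, rfl⟩))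
  simp only at hZs
  have hZc : IsClosed (Subtype.val '' Z) :=
    (hZ.isClosed.isCompact.image continuous_subtype_val).isClosed
  obtain ⟨O, hO, hOZ⟩ := isOpen_induced_iff.1 hZ.isOpen
  obtain ⟨p, hpK, ⟨hpO, hpb⟩, hpZ⟩ := hc (O ∩ Metric.ball x r) (Subtype.val '' Z)ᶜ
    (hO.inter Metric.isOpen_ball) hZc.isOpen_compl
    (by
      intro p hp
      by_cases h : p ∈ Subtype.val '' Z
      · left
        obtain ⟨q, hq, rfl⟩ := h
        exact ⟨by rw [← hOZ] at hq; exact hq, hZs hq⟩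
      · exact Or.inr h)
    ⟨x, hx, by rw [← hOZ] at hxZ; exact hxZ, Metric.mem_ball_self hr⟩
    ⟨y, hy, by
      rintro ⟨q, hq, rfl⟩
      exact absurd (hZs hq) (not_lt.2 hxy)⟩
  apply hpZ
  refine ⟨⟨p, hpK, Metric.ball_subset_closedBall hpb⟩, ?_, rfl⟩
  rw [← hOZ]; exact hpO

theorem edist_le_vol {X : Type*} [MetricSpace X] {C : Set X} (hC : IsPreconnected C) {a b : X}
    (ha : a ∈ C) (hb : b ∈ C) : edist a b ≤ volume ((fun x => dist x a) '' C) := by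
  have h1 : Icc (dist a a) (dist b a) ⊆ (fun x => dist x a) '' C :=
    hC.intermediate_value (f := fun x => dist x a) ha hb (by fun_prop)
  calc edist a b = volume (Icc (dist a a) (dist b a)) := by
        rw [Real.volume_Icc, dist_self, sub_zero, dist_comm, edist_dist]
    _ ≤ _ := measure_mono h1

theorem ediam_le_H1 {X : Type*} [MetricSpace X] [MeasurableSpace X] [BorelSpace X] {C : Set X}
    (hC : IsPreconnected C) : Metric.ediam C ≤ μH[1] C := by
  refine Metric.ediam_le fun a ha b hb => ?_
  have h := (LipschitzWith.dist_left a).hausdorffMeasure_image_le (d := 1) zero_le_one C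
  rw [hausdorffMeasure_real] at h
  simpa using (edist_le_vol hC ha hb).trans h

theorem near {X : Type*} [MetricSpace X] [MeasurableSpace X] [BorelSpace X] {K C : Set X}
    (hK : IsCompact K) (hKc : IsPreconnected K) (hC : IsCompact C) (hCc : IsPreconnected C)
    {δ η : ℝ} (hη : 0 < η) (hηδ : η ≤ δ / 2)
    (hCK : ∀ c ∈ C, ∃ p ∈ K, dist c p < η) {a b : X} (ha : a ∈ C) (hb : b ∈ C)
    (hab : 2 * δ ≤ dist a b) :
    edist a b ≤ ENNReal.ofReal (1 + 4 * η / δ) * μH[1] (K ∩ Metric.cthickening δ C) := by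
  have hδ : 0 < δ := by linarith
  set L := K ∩ Metric.cthickening δ C with hLdef
  have hL : IsCompact L := hK.inter_right Metric.isClosed_cthickening
  choose! p hpK hpd using hCK
  have hpth : ∀ c ∈ C, Metric.closedBall (p c) (δ / 2) ⊆ Metric.cthickening δ C := by
    intro c hc z hz
    refine Metric.mem_cthickening_of_dist_le z c δ C hc ?_
    have := dist_triangle z (p c) c
    have h2 := hpd c hc
    rw [dist_comm] at h2
    have := Metric.mem_closedBall.1 hz
    linarith
  have hpL : ∀ c ∈ C, p c ∈ L := fun c hc =>
    ⟨hpK c hc, hpth c hc (Metric.mem_closedBall_self (by linarith))⟩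
  have hbig : ∀ c ∈ C, ENNReal.ofReal (δ / 2) ≤ μH[1] (connectedComponentIn L (p c)) := by
    intro c hc
    have : ∃ y ∈ K, δ / 2 ≤ dist y (p c) := by
      by_contra! hcon
      have h1 := hcon _ (hpK a ha)
      have h2 := hcon _ (hpK b hb)
      have h3 := hpd a ha
      have h4 := hpd b hb
      have h5 := dist_triangle4 a (p a) (p b) b
      have h6 := dist_triangle_right (p a) (p b) (p c)
      rw [dist_comm] at h4
      linarith
    obtain ⟨y, hy, hyd⟩ := this
    obtain ⟨D, hDs, hDc, hDconn, hpD, z, hz, hzd⟩ :=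
      bump_s10 hK hKc (hpK c hc) hy (by linarith) hyd
    have hDL : D ⊆ connectedComponentIn L (p c) :=
      hDconn.isPreconnected.subset_connectedComponentIn hpD
        fun w hw => ⟨(hDs hw).1, hpth c hc (hDs hw).2⟩
    calc ENNReal.ofReal (δ / 2) ≤ edist z (p c) := by
          rw [edist_dist]; exact ENNReal.ofReal_le_ofReal hzd
      _ ≤ Metric.ediam D := Metric.edist_le_ediam_of_mem hz hpD
      _ ≤ μH[1] D := ediam_le_H1 hDconn.isPreconnected
      _ ≤ _ := measure_mono hDL
  obtain ⟨T, hT, hTf, hTc⟩ := hC.elim_finite_subcover_image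
    (b := (fun c => connectedComponentIn L (p c)) '' C) (c := fun D => Metric.thickening η D)
    (fun _ _ => Metric.isOpen_thickening)
    (by
      intro c hc
      refine mem_biUnion (mem_image_of_mem _ hc) ?_
      exact Metric.mem_thickening_iff.2 ⟨p c, mem_connectedComponentIn (hpL c hc), hpd c hc⟩)
  obtain ⟨T, rfl⟩ := hTf.exists_finset_coe
  have hTL : ∀ D ∈ T, D ⊆ L := by
    intro D hD
    obtain ⟨c, hc, rfl⟩ := hT hD
    exact connectedComponentIn_subset _ _
  have hdisj : (T : Set (Set X)).PairwiseDisjoint id := by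
    intro D hD D' hD' hne
    obtain ⟨c, hc, rfl⟩ := hT hD
    obtain ⟨c', hc', rfl⟩ := hT hD'
    refine Set.disjoint_left.2 fun z hz hz' => hne ?_
    exact (connectedComponentIn_eq hz).trans (connectedComponentIn_eq hz').symm
  have hsum : ∑ D ∈ T, μH[1] D ≤ μH[1] L := by
    have hm := measure_biUnion_finset (μ := (μH[1] : Measure X)) (f := id) hdisj ?_
    · simp only [id] at hm
      rw [← hm]
      exact measure_mono (iUnion₂_subset hTL)
    · intro D hD
      obtain ⟨c, hc, rfl⟩ := hT hD
      exact (isClosed_ccIn hL.isClosed _).measurableSet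
  have hterm : ∀ D ∈ T, volume ((fun x => dist x a) '' Metric.thickening η D) ≤
      ENNReal.ofReal (1 + 4 * η / δ) * μH[1] D := by
    intro D hD
    obtain ⟨c, hc, rfl⟩ := hT hD
    set D := connectedComponentIn L (p c)
    have e1 : ENNReal.ofReal (1 + 4 * η / δ) =
        1 + ENNReal.ofReal (4 * η / δ) := by
      rw [ENNReal.ofReal_add zero_le_one (by positivity), ENNReal.ofReal_one]
    calc volume ((fun x => dist x a) '' Metric.thickening η D)
        ≤ Metric.ediam ((fun x => dist x a) '' Metric.thickening η D) := Real.volume_le_diam _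
      _ ≤ Metric.ediam (Metric.thickening η D) := by
          simpa using (LipschitzWith.dist_left a).ediam_image_le (Metric.thickening η D)
      _ ≤ Metric.ediam D + 2 * ENNReal.ofReal η := by
          have := Metric.ediam_thickening_le (s := D) (ε := η.toNNReal)
          rwa [Real.coe_toNNReal η hη.le] at this
      _ ≤ μH[1] D + ENNReal.ofReal (4 * η / δ) * μH[1] D := by
          refine add_le_add ?_ ?_
          · exact ediam_le_H1 isPreconnected_connectedComponentIn
          · calc 2 * ENNReal.ofReal η = ENNReal.ofReal (4 * η / δ) * ENNReal.ofReal (δ / 2) := by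
                  rw [← ENNReal.ofReal_mul (by positivity)]
                  rw [show (4 * η / δ) * (δ / 2) = 2 * η by field_simp; try norm_num]
                  rw [ENNReal.ofReal_mul zero_le_two]; simp
              _ ≤ _ := by gcongr; exact hbig c hc
      _ = _ := by rw [e1, add_mul, one_mul]
  calc edist a b ≤ volume ((fun x => dist x a) '' C) := edist_le_vol hCc ha hb
    _ ≤ volume (⋃ D ∈ T, (fun x => dist x a) '' Metric.thickening η D) := by
        refine measure_mono ?_
        rw [← image_iUnion₂]
        exact image_mono hTc
    _ ≤ ∑ D ∈ T, volume ((fun x => dist x a) '' Metric.thickening η D) :=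
        measure_biUnion_finset_le _ _
    _ ≤ ∑ D ∈ T, ENNReal.ofReal (1 + 4 * η / δ) * μH[1] D := Finset.sum_le_sum hterm
    _ = ENNReal.ofReal (1 + 4 * η / δ) * ∑ D ∈ T, μH[1] D := by rw [Finset.mul_sum]
    _ ≤ _ := by gcongr

/-- Every `K ∩ U` can be covered up to small errors by disjoint small subcontinua. -/
theorem cover_aux {X : Type} [MetricSpace X] {K U : Set X}
    (hK : IsCompact K) (hKc : IsPreconnected K) (hKn : K.Nontrivial) (hU : IsOpen U)
    {S : ℝ≥0∞} (hS : S ≠ ⊤)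
    (H : ∀ T : Finset (Set X),
      (∀ C ∈ T, IsCompact C ∧ IsConnected C ∧ C ⊆ K ∩ U ∧ C.Nontrivial) →
      (T : Set (Set X)).PairwiseDisjoint id → ∑ C ∈ T, Metric.ediam C ≤ S)
    {ε : ℝ} (hε : 0 < ε) :
    ∃ (ι : Type) (_ : Countable ι) (t : ι → Set X), K ∩ U ⊆ ⋃ i, t i ∧
      (∀ i, Metric.ediam (t i) ≤ 6 * ENNReal.ofReal ε) ∧
      ∑' i, Metric.ediam (t i) ≤ S + 6 * ENNReal.ofReal ε := by
  obtain ⟨u, hut, hdisj, hcov⟩ := Vitali.exists_disjoint_subfamily_covering_enlargement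
    (B := (id : Set X → Set X))
    (t := {C : Set X | (IsCompact C ∧ IsConnected C ∧ C ⊆ K ∩ U ∧ C.Nontrivial) ∧
      Metric.diam C ≤ ε})
    (δ := fun C => Metric.diam C) 2 one_lt_two (fun _ _ => Metric.diam_nonneg) ε
    (fun C hC => hC.2) (fun C hC => hC.1.2.1.nonempty)
  have hsum : ∑' C : u, Metric.ediam (C : Set X) ≤ S := by
    rw [ENNReal.tsum_eq_iSup_sum]
    refine iSup_le fun s => ?_
    have := H (s.map (Function.Embedding.subtype _)) ?_ ?_
    · simpa using this
    · intro C hC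
      obtain ⟨D, -, rfl⟩ := Finset.mem_map.1 hC
      exact (hut D.2).1
    · refine hdisj.subset ?_
      intro C hC
      obtain ⟨D, -, rfl⟩ := Finset.mem_map.1 (Finset.mem_coe.1 hC)
      exact D.2
  have hsumtop : ∑' C : u, Metric.ediam (C : Set X) ≠ ⊤ := ne_top_of_le_ne_top hS hsum
  have hucount : Countable u := by
    have := Summable.countable_support_ennreal hsumtop
    rw [← countable_univ_iff]
    refine this.mono fun C _ => ?_
    exact (Metric.ediam_pos_iff.2 (hut C.2).1.2.2.2).ne'
  obtain ⟨T, hT⟩ := ((tendsto_order.1 (ENNReal.tendsto_tsum_compl_atTop_zero hsumtop)).2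
    (ENNReal.ofReal ε) (ENNReal.ofReal_pos.2 hε)).exists
  have hne : ∀ C : u, (C : Set X).Nonempty := fun C => (hut C.2).1.2.1.nonempty
  choose q hq using hne
  have hbdd : ∀ C : u, Bornology.IsBounded (C : Set X) := fun C => (hut C.2).1.1.isBounded
  have hed : ∀ C : u, Metric.ediam (C : Set X) = ENNReal.ofReal (Metric.diam (C : Set X)) :=
    fun C => (ENNReal.ofReal_toReal (Metric.isBounded_iff_ediam_ne_top.1 (hbdd C))).symm
  have hball : ∀ C : u, Metric.ediam (Metric.closedBall (q C) (3 * Metric.diam (C : Set X))) ≤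
      6 * Metric.ediam (C : Set X) := by
    intro C
    have h0 : 0 ≤ Metric.diam (C : Set X) := Metric.diam_nonneg
    rw [← Metric.closedEBall_ofReal (by positivity)]
    refine Metric.ediam_closedEBall_le.trans (le_of_eq ?_)
    rw [ENNReal.ofReal_mul (by norm_num), hed, ← mul_assoc]
    congr 1
    norm_num
  have hsmall : ∀ C : u, Metric.ediam (C : Set X) ≤ ENNReal.ofReal ε := by
    intro C
    rw [hed]
    exact ENNReal.ofReal_le_ofReal (hut C.2).2
  refine ⟨u ⊕ {b : u // b ∉ T}, inferInstance,
    Sum.elim (fun C => (C : Set X))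
      (fun C => Metric.closedBall (q C.1) (3 * Metric.diam (C.1 : Set X))), ?_, ?_, ?_⟩
  · intro x hx
    by_cases hxT : ∃ C ∈ T, x ∈ (C : Set X)
    · obtain ⟨C, -, hxC⟩ := hxT
      exact mem_iUnion.2 ⟨Sum.inl C, hxC⟩
    push Not at hxT
    have hF : IsClosed (⋃ C ∈ T, (C : Set X)) :=
      T.finite_toSet.isClosed_biUnion fun C _ => (hut C.2).1.1.isClosed
    have hW : IsOpen (U ∩ (⋃ C ∈ T, (C : Set X))ᶜ) := hU.inter hF.isOpen_compl
    obtain ⟨ρ, hρ, hρs⟩ := Metric.isOpen_iff.1 hW x ⟨hx.2, by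
      simp only [mem_compl_iff, mem_iUnion, not_exists]
      exact fun C hC => hxT C hC⟩
    obtain ⟨y, hy, hyx⟩ := hKn.exists_ne x
    have hd : 0 < dist y x := dist_pos.2 hyx
    set r := min (ρ / 2) (min (ε / 2) (dist y x)) with hr
    have hr0 : 0 < r := by positivity
    have hr1 : r ≤ ρ / 2 := min_le_left _ _
    have hr2 : r ≤ ε / 2 := (min_le_right _ _).trans (min_le_left _ _)
    have hr3 : r ≤ dist y x := (min_le_right _ _).trans (min_le_right _ _)
    obtain ⟨D, hDs, hDc, hDconn, hxD, z, hz, hzd⟩ := bump_s10 hK hKc hx.1 hy hr0 hr3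
    have hDW : ∀ w ∈ D, w ∈ U ∩ (⋃ C ∈ T, (C : Set X))ᶜ := fun w hw =>
      hρs (Metric.closedBall_subset_ball (by linarith) (hDs hw).2)
    have hDdiam : Metric.diam D ≤ ε :=
      (Metric.diam_le_of_subset_closedBall hr0.le fun w hw => (hDs hw).2).trans (by linarith)
    obtain ⟨b, hb, ⟨w, hwD, hwb⟩, hDb⟩ := hcov D ⟨⟨hDc, hDconn,
      fun w hw => ⟨(hDs hw).1, (hDW w hw).1⟩, ⟨z, hz, x, hxD, by
        rintro rfl
        rw [dist_self] at hzd
        linarith⟩⟩, hDdiam⟩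
    have hbT : (⟨b, hb⟩ : u) ∉ T := fun h => (hDW w hwD).2 (mem_biUnion h hwb)
    refine mem_iUnion.2 ⟨Sum.inr ⟨⟨b, hb⟩, hbT⟩, ?_⟩
    simp only [Sum.elim_inr, Metric.mem_closedBall]
    have h1 := dist_triangle x w (q ⟨b, hb⟩)
    have h2 := Metric.dist_le_diam_of_mem hDc.isBounded hxD hwD
    have h3 := Metric.dist_le_diam_of_mem (hbdd ⟨b, hb⟩) hwb (hq ⟨b, hb⟩)
    simp only at h3 hDb
    linarith
  · rintro (C | C)
    · refine (hsmall C).trans ?_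
      exact le_mul_of_one_le_left' (by norm_num)
    · refine (hball C).trans ?_
      gcongr
      exact hsmall C
  · rw [Summable.tsum_sum ENNReal.summable ENNReal.summable]
    refine add_le_add hsum ?_
    calc _ ≤ ∑' C : {b : u // b ∉ T}, 6 * Metric.ediam (C.1 : Set X) :=
          ENNReal.tsum_le_tsum fun C => hball C
      _ = 6 * ∑' C : {b : u // b ∉ T}, Metric.ediam (C.1 : Set X) := ENNReal.tsum_mul_left
      _ ≤ _ := by gcongr

theorem H1_le {X : Type} [MetricSpace X] [MeasurableSpace X] [BorelSpace X] {K U : Set X}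
    (hK : IsCompact K) (hKc : IsPreconnected K) (hKn : K.Nontrivial) (hU : IsOpen U)
    {S : ℝ≥0∞} (hS : S ≠ ⊤)
    (H : ∀ T : Finset (Set X),
      (∀ C ∈ T, IsCompact C ∧ IsConnected C ∧ C ⊆ K ∩ U ∧ C.Nontrivial) →
      (T : Set (Set X)).PairwiseDisjoint id → ∑ C ∈ T, Metric.ediam C ≤ S) :
    μH[1] (K ∩ U) ≤ S := by
  have hpos : ∀ n : ℕ, (0 : ℝ) < 1 / ((n : ℝ) + 1) := fun n => by positivity
  choose ι hι t hcov hdiam hsum using fun n : ℕ => cover_aux hK hKc hKn hU hS H (hpos n)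
  have hlim : Tendsto (fun n : ℕ => 6 * ENNReal.ofReal (1 / ((n : ℝ) + 1))) atTop (𝓝 0) := by
    have h1 := ENNReal.tendsto_ofReal (tendsto_one_div_add_atTop_nhds_zero_nat (𝕜 := ℝ))
    have h2 := ENNReal.Tendsto.const_mul (a := 6) h1 (Or.inr (by norm_num))
    simpa using h2
  have h := Measure.hausdorffMeasure_le_liminf_tsum 1 (K ∩ U) _ hlim t
    (Eventually.of_forall hdiam) (Eventually.of_forall hcov)
  refine h.trans ?_
  simp only [ENNReal.rpow_one]
  have h3 := (tendsto_const_nhds (x := S)).add hlim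
  rw [add_zero] at h3
  rw [← h3.liminf_eq]
  exact liminf_le_liminf (Eventually.of_forall hsum)

theorem conn_lim {X : Type} [MetricSpace X] {K : ℕ → Set X} {K' : Set X}
    (hKconn : ∀ n, IsConnected (K n)) (hK' : IsCompact K')
    (h1 : ∀ ε > 0, ∀ᶠ n in atTop, ∀ x ∈ K n, ∃ y ∈ K', dist x y < ε)
    (h2 : ∀ ε > 0, ∀ᶠ n in atTop, ∀ y ∈ K', ∃ x ∈ K n, dist y x < ε) :
    IsPreconnected K' := by
  rw [isPreconnected_closed_iff]
  intro A B hA hB hAB ⟨a, haK, haA⟩ ⟨b, hbK, hbB⟩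
  by_contra hne
  have hd : Disjoint (K' ∩ A) (K' ∩ B) := Set.disjoint_left.2 fun x hx hx' =>
    hne ⟨x, hx.1, hx.2, hx'.2⟩
  obtain ⟨δ, hδ, hdisj⟩ := hd.exists_thickenings (hK'.inter_right hA)
    (hK'.isClosed.inter hB)
  obtain ⟨n, hn1, hn2⟩ := ((h1 δ hδ).and (h2 δ hδ)).exists
  obtain ⟨p, hp, hpa⟩ := hn2 a haK
  obtain ⟨p', hp', hpb⟩ := hn2 b hbK
  obtain ⟨z, -, hz, hz'⟩ := (hKconn n).isPreconnected
    (Metric.thickening δ (K' ∩ A)) (Metric.thickening δ (K' ∩ B)) Metric.isOpen_thickening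
    Metric.isOpen_thickening
    (by
      intro x hx
      obtain ⟨y, hy, hxy⟩ := hn1 x hx
      rcases hAB hy with h | h
      · exact Or.inl (Metric.mem_thickening_iff.2 ⟨y, ⟨hy, h⟩, hxy⟩)
      · exact Or.inr (Metric.mem_thickening_iff.2 ⟨y, ⟨hy, h⟩, hxy⟩))
    ⟨p, hp, Metric.mem_thickening_iff.2 ⟨a, ⟨haK, haA⟩, by rwa [dist_comm]⟩⟩
    ⟨p', hp', Metric.mem_thickening_iff.2 ⟨b, ⟨hbK, hbB⟩, by rwa [dist_comm]⟩⟩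
  exact Set.disjoint_left.1 hdisj hz hz'

theorem exists_ediam_eq {X : Type} [MetricSpace X] {C : Set X} (hC : IsCompact C)
    (hne : C.Nonempty) : ∃ a ∈ C, ∃ b ∈ C, Metric.ediam C = edist a b := by
  obtain ⟨⟨a, b⟩, ⟨ha, hb⟩, hab⟩ := (hC.prod hC).exists_isMaxOn (hne.prod hne)
    (f := fun p : X × X => edist p.1 p.2) (by fun_prop)
  refine ⟨a, ha, b, hb, le_antisymm (Metric.ediam_le fun x hx y hy => ?_)
    (Metric.edist_le_ediam_of_mem ha hb)⟩
  exact hab (mk_mem_prod hx hy)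

theorem lsc_aux {X : Type} [MetricSpace X] [MeasurableSpace X] [BorelSpace X]
    {U : Set X} (hU : IsOpen U)
    {K : ℕ → Set X} (hKcpt : ∀ n, IsCompact (K n)) (hKconn : ∀ n, IsConnected (K n)) {K' : Set X}
    (h2 : ∀ ε > 0, ∀ᶠ n in atTop, ∀ y ∈ K', ∃ x ∈ K n, dist y x < ε)
    (hl : liminf (fun n => μH[1] (K n ∩ U)) atTop ≠ ⊤)
    (T : Finset (Set X))
    (hT : ∀ C ∈ T, IsCompact C ∧ IsConnected C ∧ C ⊆ K' ∩ U ∧ C.Nontrivial)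
    (hdisj : (T : Set (Set X)).PairwiseDisjoint id) :
    ∑ C ∈ T, Metric.ediam C ≤ liminf (fun n => μH[1] (K n ∩ U)) atTop := by
  have : Nonempty X := (hKconn 0).nonempty.to_type
  choose! a ha b hb hab using fun (C : Set X) (hC : C ∈ T) => exists_ediam_eq (hT C hC).1 (hT C hC).2.1.nonempty
  have hsmall : ∀ δ₀ : ℝ, 0 < δ₀ → ∀ᶠ δ in 𝓝[>] (0 : ℝ), 0 < δ ∧ δ < δ₀ :=
    fun δ₀ h => Ioo_mem_nhdsGT h
  have e1 : ∀ᶠ δ in 𝓝[>] (0 : ℝ), ∀ C ∈ T, Metric.cthickening δ C ⊆ U := by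
    rw [eventually_all_finset]
    intro C hC
    obtain ⟨δ₀, hδ₀, h⟩ := (hT C hC).1.exists_cthickening_subset_open hU
      ((hT C hC).2.2.1.trans inter_subset_right)
    filter_upwards [hsmall δ₀ hδ₀] with δ hδ
    exact (Metric.cthickening_mono hδ.2.le C).trans h
  have e2 : ∀ᶠ δ in 𝓝[>] (0 : ℝ), ∀ C ∈ T, 2 * δ ≤ dist (a C) (b C) := by
    rw [eventually_all_finset]
    intro C hC
    have hpos : 0 < dist (a C) (b C) := by
      rw [dist_pos, ← edist_pos, ← hab C hC]
      exact Metric.ediam_pos_iff.2 (hT C hC).2.2.2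
    filter_upwards [hsmall (dist (a C) (b C) / 2) (by positivity)] with δ hδ
    linarith
  have e3 : ∀ᶠ δ in 𝓝[>] (0 : ℝ), ∀ C ∈ T, ∀ D ∈ T, C ≠ D →
      Disjoint (Metric.cthickening δ C) (Metric.cthickening δ D) := by
    rw [eventually_all_finset]
    intro C hC
    rw [eventually_all_finset]
    intro D hD
    by_cases hCD : C = D
    · exact Eventually.of_forall fun _ h => absurd hCD h
    obtain ⟨δ₀, hδ₀, h⟩ := (hdisj hC hD hCD).exists_cthickenings (hT C hC).1
      (hT D hD).1.isClosed
    filter_upwards [hsmall δ₀ hδ₀] with δ hδ _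
    exact h.mono (Metric.cthickening_mono hδ.2.le C) (Metric.cthickening_mono hδ.2.le D)
  obtain ⟨δ, ⟨hδ, -⟩, hδ1, hδ2, hδ3⟩ :=
    ((hsmall 1 one_pos).and (e1.and (e2.and e3))).exists
  set l := liminf (fun n => μH[1] (K n ∩ U)) atTop with hldef
  have key : ∀ᶠ η in 𝓝[>] (0 : ℝ),
      ∑ C ∈ T, Metric.ediam C ≤ ENNReal.ofReal (1 + 4 * η / δ) * l := by
    filter_upwards [hsmall (δ / 2) (by positivity)] with η hη
    have hη0 : 0 < η := hη.1
    have hc0 : ENNReal.ofReal (1 + 4 * η / δ) ≠ 0 :=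
      (ENNReal.ofReal_pos.2 (by positivity)).ne'
    rw [mul_comm, ← ENNReal.div_le_iff hc0 ENNReal.ofReal_ne_top]
    refine le_liminf_of_le (by isBoundedDefault) ?_
    filter_upwards [h2 η hη0] with n hn
    rw [ENNReal.div_le_iff hc0 ENNReal.ofReal_ne_top, mul_comm]
    have hdd : (T : Set (Set X)).PairwiseDisjoint (fun C => K n ∩ Metric.cthickening δ C) :=
      fun C hC D hD hne =>
        (hδ3 C hC D hD hne).mono inter_subset_right inter_subset_right
    calc ∑ C ∈ T, Metric.ediam C
        ≤ ∑ C ∈ T, ENNReal.ofReal (1 + 4 * η / δ) * μH[1] (K n ∩ Metric.cthickening δ C) := by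
          refine Finset.sum_le_sum fun C hC => ?_
          rw [hab C hC]
          exact near (hKcpt n) (hKconn n).isPreconnected (hT C hC).1
            (hT C hC).2.1.isPreconnected hη0 hη.2.le
            (fun c hc => hn c ((hT C hC).2.2.1 hc).1) (ha C hC) (hb C hC) (hδ2 C hC)
      _ = ENNReal.ofReal (1 + 4 * η / δ) *
            μH[1] (⋃ C ∈ T, K n ∩ Metric.cthickening δ C) := by
          rw [← Finset.mul_sum, measure_biUnion_finset hdd]
          exact fun C _ => ((hKcpt n).isClosed.inter Metric.isClosed_cthickening).measurableSet
      _ ≤ _ := by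
          gcongr
          exact iUnion₂_subset fun C hC => inter_subset_inter_right _ (hδ1 C hC)
  have hlim : Tendsto (fun η : ℝ => ENNReal.ofReal (1 + 4 * η / δ) * l) (𝓝[>] 0) (𝓝 (1 * l)) := by
    refine ENNReal.Tendsto.mul_const ?_ (Or.inr hl)
    have : Tendsto (fun η : ℝ => 1 + 4 * η / δ) (𝓝 0) (𝓝 (1 + 4 * 0 / δ)) :=
      Continuous.tendsto (by fun_prop) 0
    have h := (ENNReal.tendsto_ofReal this).mono_left (nhdsWithin_le_nhds (s := Ioi 0))
    simpa using h
  rw [one_mul] at hlim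
  exact ge_of_tendsto hlim key

/-- Gołąb's theorem: if nonempty compact connected sets `K_n ⊆ closure Ω` with
`H¹(K_n) < ∞` converge in the Hausdorff metric to a nonempty compact `K ⊆ closure Ω`, then `K`
is connected and, for every open `U`, `H¹(K ∩ U) ≤ liminf_n H¹(K_n ∩ U)`. -/
theorem stmt10 (Ω : Set E2) (hΩo : IsOpen Ω) (hΩb : Bornology.IsBounded Ω)
    (U : Set E2) (hU : IsOpen U)
    (K : ℕ → Set E2) (hKcpt : ∀ n, IsCompact (K n)) (hKconn : ∀ n, IsConnected (K n))
    (hKsub : ∀ n, K n ⊆ closure Ω) (hKfin : ∀ n, μH[1] (K n) < ⊤)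
    (K' : Set E2) (hK'cpt : IsCompact K') (hK'ne : K'.Nonempty) (hK'sub : K' ⊆ closure Ω)
    (hconv : Tendsto (fun n => Metric.hausdorffDist (K n) K') atTop (𝓝 0)) :
    IsConnected K' ∧
    μH[1] (K' ∩ U) ≤ Filter.liminf (fun n => μH[1] (K n ∩ U)) atTop := by
  have hfin : ∀ n, Metric.hausdorffEDist (K n) K' ≠ ⊤ := fun n =>
    Metric.hausdorffEDist_ne_top_of_nonempty_of_bounded (hKconn n).nonempty hK'ne
      (hKcpt n).isBounded hK'cpt.isBounded
  have hlt : ∀ ε > 0, ∀ᶠ n in atTop, Metric.hausdorffDist (K n) K' < ε :=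
    fun ε hε => hconv.eventually_lt_const hε
  have h1 : ∀ ε > 0, ∀ᶠ n in atTop, ∀ x ∈ K n, ∃ y ∈ K', dist x y < ε := by
    intro ε hε
    filter_upwards [hlt ε hε] with n hn x hx
    exact Metric.exists_dist_lt_of_hausdorffDist_lt hx hn (hfin n)
  have h2 : ∀ ε > 0, ∀ᶠ n in atTop, ∀ y ∈ K', ∃ x ∈ K n, dist y x < ε := by
    intro ε hε
    filter_upwards [hlt ε hε] with n hn y hy
    obtain ⟨x, hx, hxy⟩ := Metric.exists_dist_lt_of_hausdorffDist_lt' hy hn (hfin n)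
    exact ⟨x, hx, by rwa [dist_comm]⟩
  have hpre := conn_lim hKconn hK'cpt h1 h2
  refine ⟨⟨hK'ne, hpre⟩, ?_⟩
  by_cases hnt : K'.Nontrivial
  · by_cases hl : liminf (fun n => μH[1] (K n ∩ U)) atTop = ⊤
    · rw [hl]; exact le_top
    · exact H1_le hK'cpt hpre hnt hU hl (lsc_aux hU hKcpt hKconn h2 hl)
  · have hs : (K' ∩ U).Subsingleton :=
      (Set.not_nontrivial_iff.1 hnt).anti inter_subset_left
    have := Measure.nullSingletonClass_hausdorff E2 (d := 1) one_pos
    rw [hs.measure_zero]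
    exact zero_le

end
end

section
/- Let Ω ⊂ ℝ² be open and bounded, U ⊆ ℝ² open, and let φ : closure(Ω) → ℝ be continuous with 0 ≤ c₁ ≤ φ(x) ≤ c₂ for all x ∈ closure(Ω), for some constants 0 ≤ c₁ ≤ c₂. If {K_n} is a sequence of nonempty compact connected subsets of closure(Ω), each with H¹(K_n) < ∞, converging in the Hausdorff metric to a nonempty compact connected set K ⊆ closure(Ω) with H¹(K) < ∞, then ∫_{K∩U} φ dH¹ ≤ liminf_{n→∞} ∫_{K_n∩U} φ dH¹ (the integrals being with respect to the one-dimensional Hausdorff measure restricted to K ∩ U and K_n ∩ U respectively). -/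
open MeasureTheory Set Filter Topology
open scoped ENNReal NNReal

noncomputable section

/-- union of the sets with label `j`. -/
def clus {X ι κ : Type*} (A : ι → Set X) (f : ι → κ) (j : κ) : Set X :=
  {x | ∃ i, f i = j ∧ x ∈ A i}

/-- sum of the weights with label `j`. -/
def wtc {ι κ : Type*} [Fintype ι] [DecidableEq κ] (w : ι → ℝ≥0∞) (f : ι → κ) (j : κ) : ℝ≥0∞ :=
  ∑ i with f i = j, w i

theorem clus_step1 {X ι : Type*} [MetricSpace X] [Fintype ι] [DecidableEq ι]
    (A : ι → Set X) (w : ι → ℝ≥0∞) (hw : ∀ i, Metric.ediam (A i) ≤ w i) (δ : ℝ≥0∞)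
    (hδ : ∀ i, w i < 2 * δ) (hδ0 : 0 < δ) :
    ∃ f : ι → ι, (∀ j, Metric.ediam (clus A f j) ≤ wtc w f j) ∧ (∀ j, wtc w f j < 2 * δ) ∧
      ∀ j k, j ≠ k → wtc w f j < δ → wtc w f k < δ → ¬ (clus A f j ∩ clus A f k).Nonempty := by
  classical
  let P : Set (ι → ι) := {f | (∀ j, Metric.ediam (clus A f j) ≤ wtc w f j) ∧
    (∀ j, wtc w f j < 2 * δ)}
  have hne : P.Nonempty := by
    refine ⟨id, ?_, ?_⟩
    · intro j
      have h1 : clus A id j = A j := by ext x; simp [clus]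
      have h2 : wtc w id j = w j := by simp [wtc, Finset.filter_eq']
      rw [h1, h2]; exact hw j
    · intro j
      have h2 : wtc w id j = w j := by simp [wtc, Finset.filter_eq']
      rw [h2]; exact hδ j
  obtain ⟨f, ⟨hf1, hf2⟩, hmin⟩ := Set.exists_min_image P
    (fun f => (Finset.univ.image f).card) (Set.toFinite _) hne
  refine ⟨f, hf1, hf2, ?_⟩
  rintro j k hjk hj hk hmeet
  let f' : ι → ι := fun i => if f i = k then j else f i
  have hkim : k ∈ Finset.univ.image f := by
    obtain ⟨x, -, i, hi, -⟩ := hmeet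
    simp only [Finset.mem_image, Finset.mem_univ, true_and]
    exact ⟨i, hi⟩
  have hjim : j ∈ Finset.univ.image f := by
    obtain ⟨x, ⟨i, hi, -⟩, -⟩ := hmeet
    simp only [Finset.mem_image, Finset.mem_univ, true_and]
    exact ⟨i, hi⟩
  have hcard : (Finset.univ.image f').card < (Finset.univ.image f).card := by
    apply Finset.card_lt_card
    refine (Finset.ssubset_iff_of_subset ?_).2 ⟨k, hkim, ?_⟩
    · intro l hl
      simp only [Finset.mem_image, Finset.mem_univ, true_and] at hl
      obtain ⟨i, rfl⟩ := hl
      by_cases h : f i = k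
      · simpa [f', h] using hjim
      · simp [f', h]
    · simp only [Finset.mem_image, Finset.mem_univ, true_and, not_exists, f']
      intro i
      split_ifs with h
      · exact hjk
      · exact h
  have hcj : clus A f' j = clus A f j ∪ clus A f k := by
    ext x
    simp only [clus, f', mem_ofPred_eq, mem_union]
    constructor
    · rintro ⟨i, hi, hx⟩
      split_ifs at hi with h
      · exact Or.inr ⟨i, h, hx⟩
      · exact Or.inl ⟨i, hi, hx⟩
    · rintro (⟨i, hi, hx⟩ | ⟨i, hi, hx⟩)
      · exact ⟨i, by simp [hi], hx⟩
      · exact ⟨i, by simp [hi], hx⟩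
  have hwj : wtc w f' j = wtc w f j + wtc w f k := by
    unfold wtc
    rw [← Finset.sum_union]
    · apply Finset.sum_congr _ (fun _ _ => rfl)
      ext i
      simp only [f', Finset.mem_filter, Finset.mem_univ, true_and, Finset.mem_union]
      split_ifs with h <;> simp [h]
    · rw [Finset.disjoint_left]
      intro i hi hi'
      simp only [Finset.mem_filter, Finset.mem_univ, true_and] at hi hi'
      exact hjk (hi.symm.trans hi')
  have hck : clus A f' k = ∅ := by
    ext x
    simp only [clus, f', mem_ofPred_eq, mem_empty_iff_false, iff_false]
    rintro ⟨i, hi, hx⟩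
    split_ifs at hi with h
    · exact hjk hi
    · exact h hi
  have hwk : wtc w f' k = 0 := by
    unfold wtc
    rw [Finset.filter_false_of_mem, Finset.sum_empty]
    intro i _ hi
    simp only [f'] at hi
    split_ifs at hi with h
    · exact hjk hi
    · exact h hi
  have hiff : ∀ l, l ≠ j → l ≠ k → ∀ i, f' i = l ↔ f i = l := by
    intro l hlj hlk i
    simp only [f']
    split_ifs with h
    · constructor
      · intro h'; exact absurd h'.symm hlj
      · intro h'; exact absurd (h'.symm.trans h) hlk
    · rfl
  have hcl : ∀ l, l ≠ j → l ≠ k → clus A f' l = clus A f l := by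
    intro l hlj hlk
    unfold clus
    simp only [hiff l hlj hlk]
  have hwl : ∀ l, l ≠ j → l ≠ k → wtc w f' l = wtc w f l := by
    intro l hlj hlk
    unfold wtc
    simp only [hiff l hlj hlk]
  have hP : f' ∈ P := by
    refine ⟨?_, ?_⟩
    · intro l
      by_cases hlj : l = j
      · rw [hlj, hcj, hwj]
        exact (Metric.ediam_union_le hmeet).trans (add_le_add (hf1 _) (hf1 _))
      by_cases hlk : l = k
      · rw [hlk, hck]; simp
      rw [hcl l hlj hlk, hwl l hlj hlk]; exact hf1 l
    · intro l
      by_cases hlj : l = j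
      · rw [hlj, hwj, two_mul]
        exact ENNReal.add_lt_add hj hk
      by_cases hlk : l = k
      · rw [hlk, hwk]; exact ENNReal.mul_pos (by simp) hδ0.ne'
      rw [hwl l hlj hlk]; exact hf2 l
  exact absurd (hmin f' hP) (not_le.2 hcard)

theorem clus_step2 {X ι : Type*} [MetricSpace X] [Fintype ι] [DecidableEq ι]
    (A : ι → Set X) (w : ι → ℝ≥0∞) (hw : ∀ i, Metric.ediam (A i) ≤ w i) (δ : ℝ≥0∞)
    (hδ : ∀ i, w i < 2 * δ) (hδ0 : 0 < δ) :
    ∃ f : ι → ι, ∀ j, (clus A f j).Nonempty → Metric.ediam (clus A f j) ≤ wtc w f j ∧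
      ((δ ≤ wtc w f j ∧ Metric.ediam (clus A f j) ≤ 4 * δ) ∨
       (Metric.ediam (clus A f j) < δ ∧
        ∀ k, k ≠ j → ¬ (clus A f j ∩ clus A f k).Nonempty)) := by
  classical
  obtain ⟨f, hf1, hf2, hf3⟩ := clus_step1 A w hw δ hδ hδ0
  let Q : ι → ι → Prop := fun s b => δ ≤ wtc w f b ∧ (clus A f s ∩ clus A f b).Nonempty
  let g : ι → ι := fun s => if h : wtc w f s < δ ∧ ∃ b, Q s b then h.2.choose else s
  have hg1 : ∀ s, g s = s ∨ (wtc w f s < δ ∧ Q s (g s)) := by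
    intro s
    by_cases h : wtc w f s < δ ∧ ∃ b, Q s b
    · right
      refine ⟨h.1, ?_⟩
      have : g s = h.2.choose := by simp only [g]; rw [dif_pos h]
      rw [this]; exact h.2.choose_spec
    · left; simp only [g]; rw [dif_neg h]
  have hg2 : ∀ s, wtc w f s < δ → (∃ b, Q s b) → Q s (g s) := by
    intro s h1 h2
    have h : wtc w f s < δ ∧ ∃ b, Q s b := ⟨h1, h2⟩
    have : g s = h.2.choose := by simp only [g]; rw [dif_pos h]
    rw [this]; exact h.2.choose_spec
  have hc : ∀ j x, x ∈ clus A (g ∘ f) j ↔ ∃ l, g l = j ∧ x ∈ clus A f l := by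
    intro j x
    constructor
    · rintro ⟨i, hi, hx⟩
      exact ⟨f i, hi, i, rfl, hx⟩
    · rintro ⟨l, hl, i, rfl, hx⟩
      exact ⟨i, hl, hx⟩
  have hwt : ∀ j, wtc w (g ∘ f) j = ∑ l with g l = j, wtc w f l := by
    intro j
    unfold wtc
    rw [← Finset.sum_fiberwise_of_maps_to (s := Finset.univ.filter fun i => (g ∘ f) i = j)
      (t := Finset.univ.filter fun l => g l = j) (g := f)]
    · apply Finset.sum_congr rfl
      intro l hl
      apply Finset.sum_congr _ (fun _ _ => rfl)
      ext i
      simp only [Finset.mem_filter, Finset.mem_univ, true_and, Function.comp] at hl ⊢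
      constructor
      · exact fun h => h.2
      · rintro rfl; exact ⟨hl, rfl⟩
    · intro i hi
      simpa using hi
  refine ⟨g ∘ f, ?_⟩
  intro j hjne
  by_cases hj : δ ≤ wtc w f j
  · have hgj : g j = j := by
      rcases hg1 j with h | h
      · exact h
      · exact absurd h.1 (not_lt.2 hj)
    have hle : ∀ s : Finset ι, (∀ l ∈ s, g l = j) → ∑ l ∈ s, wtc w f l ≤ wtc w (g ∘ f) j := by
      intro s hs
      rw [hwt]
      apply Finset.sum_le_sum_of_subset
      intro l hl
      simpa using hs l hl
    have key : ∀ l, g l = j → l ≠ j → wtc w f l < δ ∧ (clus A f l ∩ clus A f j).Nonempty := by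
      intro l hl hlj
      rcases hg1 l with h | h
      · exact absurd (h.symm.trans hl) hlj
      · refine ⟨h.1, ?_⟩
        have := h.2.2
        rwa [hl] at this
    have hed : ∀ l x y, x ∈ clus A f l → y ∈ clus A f l → edist x y ≤ wtc w f l :=
      fun l x y hx hy => (Metric.edist_le_ediam_of_mem hx hy).trans (hf1 l)
    have main : ∀ x ∈ clus A (g ∘ f) j, ∀ y ∈ clus A (g ∘ f) j,
        edist x y ≤ wtc w (g ∘ f) j ∧ edist x y ≤ 4 * δ := by
      intro x hx0 y hy0
      obtain ⟨l, hl, hx⟩ := (hc j x).1 hx0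
      obtain ⟨m, hm, hy⟩ := (hc j y).1 hy0
      have e2 : 2 * δ ≤ 4 * δ := by gcongr; norm_num
      have e3 : δ + 2 * δ ≤ 4 * δ := by
        calc δ + 2 * δ = 3 * δ := by ring
          _ ≤ 4 * δ := by gcongr; norm_num
      by_cases hlm : l = m
      · subst hlm
        refine ⟨(hed l x y hx hy).trans ?_, (hed l x y hx hy).trans ((hf2 l).le.trans e2)⟩
        simpa using hle {l} (by simpa using hl)
      by_cases hlj : l = j
      · subst hlj
        obtain ⟨hm1, z, hz, hz'⟩ := key m hm (Ne.symm hlm)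
        have h1 : edist x y ≤ wtc w f l + wtc w f m :=
          (edist_triangle x z y).trans (add_le_add (hed l x z hx hz') (hed m z y hz hy))
        refine ⟨h1.trans ?_, h1.trans ?_⟩
        · have := hle {l, m} (by simp [hl, hm])
          rwa [Finset.sum_pair hlm] at this
        · rw [add_comm]; exact (add_le_add hm1.le (hf2 _).le).trans e3
      by_cases hmj : m = j
      · subst hmj
        obtain ⟨hm1, z, hz, hz'⟩ := key l hl hlm
        have h1 : edist x y ≤ wtc w f l + wtc w f m :=
          (edist_triangle x z y).trans (add_le_add (hed l x z hx hz) (hed m z y hz' hy))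
        refine ⟨h1.trans ?_, h1.trans ?_⟩
        · have := hle {l, m} (by simp [hl, hm])
          rwa [Finset.sum_pair hlm] at this
        · exact (add_le_add hm1.le (hf2 _).le).trans e3
      obtain ⟨hl1, z, hz, hz'⟩ := key l hl hlj
      obtain ⟨hm1, z2, hz2, hz2'⟩ := key m hm hmj
      have h1 : edist x y ≤ wtc w f l + (wtc w f j + wtc w f m) := by
        refine (edist_triangle x z y).trans (add_le_add (hed l x z hx hz) ?_)
        exact (edist_triangle z z2 y).trans (add_le_add (hed j z z2 hz' hz2') (hed m z2 y hz2 hy))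
      refine ⟨h1.trans ?_, h1.trans ?_⟩
      · have := hle {l, j, m} (by simp [hl, hm, hgj])
        rwa [Finset.sum_insert (by simp [hlj, hlm]), Finset.sum_pair (Ne.symm hmj)] at this
      · calc wtc w f l + (wtc w f j + wtc w f m) ≤ δ + (2 * δ + δ) :=
              add_le_add hl1.le (add_le_add (hf2 _).le hm1.le)
          _ = 4 * δ := by ring
    refine ⟨Metric.ediam_le fun x hx y hy => (main x hx y hy).1, Or.inl ⟨?_, 
      Metric.ediam_le fun x hx y hy => (main x hx y hy).2⟩⟩
    refine hj.trans ?_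
    simpa using hle {j} (by simpa using hgj)
  · rw [not_le] at hj
    have hgl : ∀ l, g l = j → l = j := by
      intro l hl
      rcases hg1 l with h | h
      · exact h.symm.trans hl
      · have := h.2.1
        rw [hl] at this
        exact absurd hj (not_lt.2 this)
    have hno : ¬ ∃ b, Q j b := by
      intro hb
      obtain ⟨x, hx⟩ := hjne
      obtain ⟨l, hl, hx⟩ := (hc j x).1 hx
      have hlj := hgl l hl
      subst hlj
      have h2 := (hg2 l hj hb).1
      rw [hl] at h2
      exact absurd hj (not_lt.2 h2)
    have hgj : g j = j := by
      rcases hg1 j with h | h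
      · exact h
      · exact absurd ⟨_, h.2⟩ hno
    have hcj : clus A (g ∘ f) j = clus A f j := by
      ext x
      rw [hc]
      constructor
      · rintro ⟨l, hl, hx⟩
        rwa [hgl l hl] at hx
      · exact fun hx => ⟨j, hgj, hx⟩
    have hwj : wtc w f j ≤ wtc w (g ∘ f) j := by
      rw [hwt]
      exact Finset.single_le_sum (f := fun l => wtc w f l) (fun _ _ => zero_le) (by simpa using hgj)
    refine ⟨hcj ▸ (hf1 j).trans hwj, Or.inr ⟨?_, ?_⟩⟩
    · rw [hcj]; exact (hf1 j).trans_lt hj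
    · rintro k hk ⟨x, hx, hx'⟩
      rw [hcj] at hx
      obtain ⟨l, hl, hx'⟩ := (hc k x).1 hx'
      have hlj : l ≠ j := by
        rintro rfl
        exact hk (hl.symm.trans hgj)
      by_cases hlδ : wtc w f l < δ
      · exact hf3 j l (Ne.symm hlj) hj hlδ ⟨x, hx, hx'⟩
      · exact hno ⟨l, not_lt.1 hlδ, x, hx, hx'⟩

theorem finite_open_cover {X : Type*} [MetricSpace X] [MeasurableSpace X] [BorelSpace X]
    (S : Set X) (hS : IsCompact S) (M : ℝ≥0∞) (hM : M ≠ ⊤) (hSM : μH[1] S ≤ M)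
    (r ε : ℝ≥0∞) (hr : 0 < r) (hε : 0 < ε) :
    ∃ (t : Finset ℕ) (A : ℕ → Set X), (∀ i, IsOpen (A i)) ∧ S ⊆ ⋃ i ∈ t, A i ∧
      (∀ i, Metric.ediam (A i) ≤ r) ∧ ∑ i ∈ t, Metric.ediam (A i) ≤ M + ε := by
  have hε2 : ε / 2 ≠ 0 := (ENNReal.half_pos hε.ne').ne'
  have hr4 : 0 < r / 2 := ENNReal.half_pos hr.ne'
  have h1 : (⨅ (t : ℕ → Set X) (_ : S ⊆ ⋃ n, t n) (_ : ∀ n, Metric.ediam (t n) ≤ r / 2),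
          ∑' n, ⨆ _ : (t n).Nonempty, Metric.ediam (t n) ^ (1 : ℝ)) < M + ε / 2 := by
    have h2 : (⨅ (t : ℕ → Set X) (_ : S ⊆ ⋃ n, t n) (_ : ∀ n, Metric.ediam (t n) ≤ r / 2),
          ∑' n, ⨆ _ : (t n).Nonempty, Metric.ediam (t n) ^ (1 : ℝ)) ≤ M := by
      refine le_trans ?_ hSM
      rw [Measure.hausdorffMeasure_apply]
      exact le_iSup₂ (f := fun (r : ℝ≥0∞) (_ : 0 < r) =>
        ⨅ (t : ℕ → Set X) (_ : S ⊆ ⋃ n, t n) (_ : ∀ n, Metric.ediam (t n) ≤ r),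
          ∑' n, ⨆ _ : (t n).Nonempty, Metric.ediam (t n) ^ (1 : ℝ)) (r / 2) hr4
    exact h2.trans_lt (ENNReal.lt_add_right hM hε2)
  simp only [iInf_lt_iff] at h1
  obtain ⟨t, hSt, htr, hsum⟩ := h1
  have hsum' : ∑' n, Metric.ediam (t n) < M + ε / 2 := by
    refine lt_of_le_of_lt (ENNReal.tsum_le_tsum fun n => ?_) hsum
    rcases (t n).eq_empty_or_nonempty with h | h
    · simp [h]
    · simp [h]
  obtain ⟨e, he0, hes⟩ := ENNReal.exists_pos_sum_of_countable (ENNReal.half_pos hε2).ne' ℕ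
  obtain ⟨r', hr'0, hr'⟩ : ∃ r' : ℝ≥0, 0 < r' ∧ (r' : ℝ≥0∞) < r / 2 / 2 := by
    obtain ⟨q, hq, hq'⟩ := ENNReal.lt_iff_exists_nnreal_btwn.1 (ENNReal.half_pos hr4.ne')
    exact ⟨q, by exact_mod_cast hq, hq'⟩
  let A : ℕ → Set X := fun n => Metric.thickening ((min (e n) r' : ℝ≥0) : ℝ) (t n)
  have hA : ∀ n, Metric.ediam (A n) ≤ Metric.ediam (t n) + 2 * ((min (e n) r' : ℝ≥0) : ℝ≥0∞) :=
    fun n => Metric.ediam_thickening_le _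
  have hSA : S ⊆ ⋃ n, A n := by
    refine hSt.trans (iUnion_mono fun n => Metric.self_subset_thickening ?_ _)
    have : 0 < min (e n) r' := lt_min (he0 n) hr'0
    exact_mod_cast this
  obtain ⟨s, hs⟩ := hS.elim_finite_subcover A (fun n => Metric.isOpen_thickening) hSA
  refine ⟨s, A, fun n => Metric.isOpen_thickening, hs, fun n => ?_, ?_⟩
  · refine (hA n).trans ?_
    calc Metric.ediam (t n) + 2 * ((min (e n) r' : ℝ≥0) : ℝ≥0∞)
        ≤ r / 2 + 2 * (r / 2 / 2) := by
          gcongr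
          · exact htr n
          · refine le_trans ?_ hr'.le
            exact_mod_cast min_le_right _ _
      _ = r := by
          rw [ENNReal.mul_div_cancel (by simp) (by simp), ENNReal.add_halves]
  · calc ∑ i ∈ s, Metric.ediam (A i) ≤ ∑' n, Metric.ediam (A n) := ENNReal.sum_le_tsum _
      _ ≤ ∑' n, (Metric.ediam (t n) + 2 * (e n : ℝ≥0∞)) := by
          refine ENNReal.tsum_le_tsum fun n => (hA n).trans ?_
          gcongr
          exact min_le_left _ _
      _ = ∑' n, Metric.ediam (t n) + 2 * ∑' n, (e n : ℝ≥0∞) := by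
          rw [ENNReal.tsum_add, ENNReal.tsum_mul_left]
      _ ≤ (M + ε / 2) + 2 * (ε / 2 / 2) := by gcongr
      _ = M + ε := by
          rw [ENNReal.mul_div_cancel (by simp) (by simp), add_assoc, ENNReal.add_halves]

theorem core_cover {X : Type*} [MetricSpace X] [MeasurableSpace X] [BorelSpace X]
    (S V : Set X) (hS : IsCompact S) (hSc : IsPreconnected S) (M : ℝ≥0∞) (hM : M ≠ ⊤)
    (hSM : μH[1] (S ∩ V) ≤ M) (ρ δ : ℝ≥0∞) (hρ : ρ ≠ ⊤) (hδ : 0 < δ) (hδρ : δ < ρ) :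
    ∃ (ι : Type) (_ : Fintype ι) (B : ι → Set X),
      S ∩ {x | 2 * ρ ≤ Metric.infEDist x Vᶜ} ⊆ ⋃ i, B i ∧
      (∀ i, Metric.ediam (B i) ≤ 4 * δ) ∧ ∑ i, Metric.ediam (B i) ≤ M + δ ∧
      (Fintype.card ι : ℝ≥0∞) * δ ≤ M + δ + δ := by
  classical
  have hδt : δ ≠ ⊤ := (hδρ.trans_le le_top).ne
  have hFc : IsClosed {x : X | ρ ≤ Metric.infEDist x Vᶜ} :=
    isClosed_le continuous_const Metric.continuous_infEDist
  have hFV : {x : X | ρ ≤ Metric.infEDist x Vᶜ} ⊆ V := by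
    intro x hx
    by_contra hxV
    have h0 : Metric.infEDist x Vᶜ = 0 := Metric.infEDist_zero_of_mem hxV
    have hx' : ρ ≤ Metric.infEDist x Vᶜ := hx
    rw [h0] at hx'
    exact absurd (hδ.trans hδρ) (not_lt.2 hx')
  obtain ⟨t, A, hAo, hSA, hAd, hAs⟩ := finite_open_cover (S ∩ {x | ρ ≤ Metric.infEDist x Vᶜ})
    (hS.inter_right hFc) M hM ((measure_mono (inter_subset_inter_right _ hFV)).trans hSM)
    δ δ hδ hδ
  let A' : t → Set X := fun i => A i
  let w : t → ℝ≥0∞ := fun i => Metric.ediam (A i)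
  have hδ2 : δ < 2 * δ := by
    rw [two_mul]; exact ENNReal.lt_add_right hδt hδ.ne'
  obtain ⟨f, hf⟩ := clus_step2 A' w (fun i => le_rfl) δ (fun i => (hAd i).trans_lt hδ2) hδ
  have hcov : S ∩ {x | ρ ≤ Metric.infEDist x Vᶜ} ⊆ ⋃ j, clus A' f j := by
    intro x hx
    have := hSA hx
    simp only [mem_iUnion] at this ⊢
    obtain ⟨i, hi, hx⟩ := this
    exact ⟨f ⟨i, hi⟩, ⟨i, hi⟩, rfl, hx⟩
  have hopen : ∀ j, IsOpen (clus A' f j) := by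
    intro j
    have : clus A' f j = ⋃ i, ⋃ (_ : f i = j), A' i := by
      ext x; simp [clus]
    rw [this]
    exact isOpen_iUnion fun i => isOpen_iUnion fun _ => hAo i
  have hsum : ∑ j, wtc w f j ≤ M + δ := by
    unfold wtc
    rw [Finset.sum_fiberwise]
    refine le_trans (le_of_eq ?_) hAs
    exact Finset.sum_coe_sort t (fun i => Metric.ediam (A i))
  by_cases hcase : ∃ j x, x ∈ clus A' f j ∧ x ∈ S ∧ 2 * ρ ≤ Metric.infEDist x Vᶜ ∧
      (Metric.ediam (clus A' f j) < δ ∧ ∀ k, k ≠ j → ¬ (clus A' f j ∩ clus A' f k).Nonempty)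
  · obtain ⟨j, x, hxj, hxS, hx2, hdi, hdis⟩ := hcase
    have hsub : S ⊆ clus A' f j := by
      apply hSc.subset_of_closure_inter_subset (hopen j) ⟨x, hxS, hxj⟩
      rintro y ⟨hyc, hyS⟩
      have hxy : edist x y ≤ ρ := by
        refine le_trans ?_ (hdi.trans hδρ).le
        rw [← Metric.ediam_closure]
        exact Metric.edist_le_ediam_of_mem (subset_closure hxj) hyc
      have hyρ : ρ ≤ Metric.infEDist y Vᶜ := by
        have h1 : ρ + ρ ≤ Metric.infEDist y Vᶜ + ρ := by
          rw [← two_mul]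
          exact hx2.trans (Metric.infEDist_le_infEDist_add_edist.trans (by gcongr))
        exact (ENNReal.add_le_add_iff_right hρ).1 h1
      obtain ⟨k, hk⟩ := mem_iUnion.1 (hcov ⟨hyS, hyρ⟩)
      by_cases hkj : k = j
      · rwa [hkj] at hk
      · exfalso
        obtain ⟨z, hz, hz'⟩ := mem_closure_iff.1 hyc _ (hopen k) hk
        exact hdis k hkj ⟨z, hz', hz⟩
    refine ⟨Unit, inferInstance, fun _ => clus A' f j, ?_, ?_, ?_, ?_⟩
    · intro y hy
      exact mem_iUnion.2 ⟨(), hsub hy.1⟩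
    · intro _
      refine hdi.le.trans ?_
      calc δ = 1 * δ := (one_mul _).symm
        _ ≤ 4 * δ := by gcongr; norm_num
    · simp only [Finset.univ_unique, Finset.sum_const, Finset.card_singleton, one_smul]
      exact hdi.le.trans le_add_self
    · simp only [Fintype.card_unit, Nat.cast_one, one_mul]
      exact le_add_self
  · let J : Finset t := Finset.univ.filter fun j =>
      (clus A' f j ∩ (S ∩ {x | 2 * ρ ≤ Metric.infEDist x Vᶜ})).Nonempty
    have hJ : ∀ j ∈ J, Metric.ediam (clus A' f j) ≤ wtc w f j ∧ δ ≤ wtc w f j ∧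
        Metric.ediam (clus A' f j) ≤ 4 * δ := by
      intro j hj
      obtain ⟨x, hx, hxS, hx2⟩ := (Finset.mem_filter.1 hj).2
      obtain ⟨h1, h2 | h2⟩ := hf j ⟨x, hx⟩
      · exact ⟨h1, h2⟩
      · exact absurd ⟨j, x, hx, hxS, hx2, h2⟩ hcase
    have hJs : ∑ j ∈ J, wtc w f j ≤ M + δ :=
      (Finset.sum_le_sum_of_subset (Finset.subset_univ _)).trans hsum
    let e : Fin J.card ≃ J := J.equivFin.symm
    have hconv : ∀ F : t → ℝ≥0∞, ∑ i : Fin J.card, F (e i) = ∑ j ∈ J, F j := by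
      intro F
      rw [e.sum_comp (fun j : J => F j)]
      exact Finset.sum_coe_sort J F
    refine ⟨Fin J.card, inferInstance, fun i => clus A' f (e i), ?_, ?_, ?_, ?_⟩
    · rintro x ⟨hxS, hx2⟩
      have hx2' : 2 * ρ ≤ Metric.infEDist x Vᶜ := hx2
      have hx1 : ρ ≤ Metric.infEDist x Vᶜ := by
        refine le_trans ?_ hx2'
        rw [two_mul]; exact le_self_add
      obtain ⟨j, hj⟩ := mem_iUnion.1 (hcov ⟨hxS, hx1⟩)
      have hjJ : j ∈ J := Finset.mem_filter.2 ⟨Finset.mem_univ _, x, hj, hxS, hx2⟩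
      refine mem_iUnion.2 ⟨e.symm ⟨j, hjJ⟩, ?_⟩
      simpa using hj
    · intro i
      exact (hJ _ (e i).2).2.2
    · rw [hconv fun j => Metric.ediam (clus A' f j)]
      exact (Finset.sum_le_sum fun j hj => (hJ j hj).1).trans hJs
    · rw [Fintype.card_fin]
      refine le_trans ?_ (hJs.trans le_self_add)
      rw [← nsmul_eq_mul]
      exact Finset.card_nsmul_le_sum _ _ _ fun j hj => (hJ j hj).2.1

theorem golab_inner {X : Type*} [MetricSpace X] [MeasurableSpace X] [BorelSpace X]
    (V : Set X) (K : ℕ → Set X) (hKcpt : ∀ n, IsCompact (K n)) (hKconn : ∀ n, IsConnected (K n))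
    (K' : Set X) (hK'cpt : IsCompact K') (hK'ne : K'.Nonempty)
    (hconv : Tendsto (fun n => Metric.hausdorffDist (K n) K') atTop (𝓝 0))
    (M : ℝ≥0∞) (hM : M ≠ ⊤) (hfr : ∃ᶠ n in atTop, μH[1] (K n ∩ V) ≤ M)
    (ρ : ℝ≥0∞) (hρ0 : 0 < ρ) (hρ : ρ ≠ ⊤) :
    μH[1] (K' ∩ {x | 3 * ρ ≤ Metric.infEDist x Vᶜ}) ≤ M := by
  have step : ∀ δ : ℝ≥0∞, 0 < δ → δ < ρ → ∃ (ι : Type) (_ : Fintype ι) (B : ι → Set X),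
      K' ∩ {x | 3 * ρ ≤ Metric.infEDist x Vᶜ} ⊆ ⋃ i, B i ∧
      (∀ i, Metric.ediam (B i) ≤ 6 * δ) ∧ ∑ i, Metric.ediam (B i) ≤ M + 2 * δ := by
    intro δ hδ hδρ
    have hδt : δ ≠ ⊤ := (hδρ.trans_le le_top).ne
    let c : ℝ≥0∞ := (M + δ + δ) / δ
    have hct : c ≠ ⊤ := ENNReal.div_ne_top (by simp [hM, hδt]) hδ.ne'
    have hpos : 0 < min δ (δ / (2 * c)) := by
      refine lt_min hδ (ENNReal.div_pos hδ.ne' ?_)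
      exact ENNReal.mul_ne_top (by simp) hct
    obtain ⟨τ, hτ0, hτ⟩ := ENNReal.lt_iff_exists_nnreal_btwn.1 hpos
    have hτ0' : 0 < τ := by exact_mod_cast hτ0
    have hτδ : (τ : ℝ≥0∞) ≤ δ := hτ.le.trans (min_le_left _ _)
    have hτc : (τ : ℝ≥0∞) ≤ δ / (2 * c) := hτ.le.trans (min_le_right _ _)
    have hev : ∀ᶠ n in atTop, Metric.hausdorffDist (K n) K' < τ :=
      hconv.eventually (gt_mem_nhds (by exact_mod_cast hτ0'))
    obtain ⟨n, hn1, hn2⟩ := (hfr.and_eventually hev).exists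
    obtain ⟨ι, hι, B, hB1, hB2, hB3, hB4⟩ := core_cover (K n) V (hKcpt n)
      (hKconn n).isPreconnected M hM hn1 ρ δ hρ hδ hδρ
    have hfin : Metric.hausdorffEDist (K n) K' ≠ ⊤ :=
      Metric.hausdorffEDist_ne_top_of_nonempty_of_bounded (hKconn n).nonempty hK'ne
        (hKcpt n).isBounded hK'cpt.isBounded
    have hth : ∀ i, Metric.ediam (Metric.thickening (τ : ℝ) (B i)) ≤ Metric.ediam (B i) + 2 * τ :=
      fun i => Metric.ediam_thickening_le _
    refine ⟨ι, hι, fun i => Metric.thickening (τ : ℝ) (B i), ?_, ?_, ?_⟩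
    · rintro x ⟨hxK, hx3⟩
      obtain ⟨y, hyK, hyx⟩ := Metric.exists_dist_lt_of_hausdorffDist_lt' hxK hn2 hfin
      have hxy : edist x y ≤ ρ := by
        refine le_trans ?_ (hτδ.trans hδρ.le)
        rw [edist_comm, edist_nndist]
        have : nndist y x < τ := by exact_mod_cast hyx
        exact_mod_cast this.le
      have hy2 : 2 * ρ ≤ Metric.infEDist y Vᶜ := by
        have h1 : 2 * ρ + ρ ≤ Metric.infEDist y Vᶜ + ρ := by
          have hx3' : 3 * ρ ≤ Metric.infEDist x Vᶜ := hx3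
          calc 2 * ρ + ρ = 3 * ρ := by ring
            _ ≤ _ := hx3'
            _ ≤ Metric.infEDist y Vᶜ + edist x y := Metric.infEDist_le_infEDist_add_edist
            _ ≤ _ := by gcongr
        exact (ENNReal.add_le_add_iff_right hρ).1 h1
      obtain ⟨i, hi⟩ := mem_iUnion.1 (hB1 ⟨hyK, hy2⟩)
      refine mem_iUnion.2 ⟨i, Metric.mem_thickening_iff.2 ⟨y, hi, ?_⟩⟩
      rw [dist_comm]; exact hyx
    · intro i
      refine (hth i).trans ?_
      calc Metric.ediam (B i) + 2 * τ ≤ 4 * δ + 2 * δ := by gcongr; exact hB2 i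
        _ = 6 * δ := by ring
    · refine (Finset.sum_le_sum fun i _ => hth i).trans ?_
      rw [Finset.sum_add_distrib]
      have hcard : (Fintype.card ι : ℝ≥0∞) ≤ c :=
        (ENNReal.le_div_iff_mul_le (Or.inl hδ.ne') (Or.inl hδt)).2 hB4
      have h2 : ∑ _i : ι, 2 * (τ : ℝ≥0∞) ≤ δ := by
        rw [Finset.sum_const, Finset.card_univ, nsmul_eq_mul]
        calc (Fintype.card ι : ℝ≥0∞) * (2 * τ) ≤ c * (2 * (δ / (2 * c))) := by gcongr
          _ = (2 * c) * (δ / (2 * c)) := by ring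
          _ ≤ δ := ENNReal.mul_div_le
      calc _ ≤ (M + δ) + δ := add_le_add hB3 h2
        _ = M + 2 * δ := by ring
  have hk : ∀ k : ℕ, 0 < ρ / ((k : ℝ≥0∞) + 2) ∧ ρ / ((k : ℝ≥0∞) + 2) < ρ := by
    intro k
    have h2 : (k : ℝ≥0∞) + 2 ≠ ⊤ := by simp
    refine ⟨ENNReal.div_pos hρ0.ne' h2, ?_⟩
    refine lt_of_le_of_lt (b := ρ / 2) ?_ (ENNReal.half_lt_self hρ0.ne' hρ)
    gcongr
    exact le_add_self
  have hlim : Tendsto (fun k : ℕ => ρ / ((k : ℝ≥0∞) + 2)) atTop (𝓝 0) := by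
    have h1 : Tendsto (fun k : ℕ => (k : ℝ≥0∞) + 2) atTop (𝓝 ⊤) := by
      have := (ENNReal.tendsto_nat_nhds_top).comp (tendsto_add_atTop_nat 2)
      refine this.congr fun k => ?_
      simp
    have := ENNReal.Tendsto.const_div h1 (Or.inr hρ) (a := ρ)
    simpa using this
  choose ι hι B hB1 hB2 hB3 using fun k : ℕ => step _ (hk k).1 (hk k).2
  have h6 : Tendsto (fun k : ℕ => 6 * (ρ / ((k : ℝ≥0∞) + 2))) atTop (𝓝 0) := by
    have := ENNReal.Tendsto.const_mul (a := 6) hlim (Or.inr (by simp))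
    simpa using this
  have h2 : Tendsto (fun k : ℕ => M + 2 * (ρ / ((k : ℝ≥0∞) + 2))) atTop (𝓝 M) := by
    have := (ENNReal.Tendsto.const_mul (a := 2) hlim (Or.inr (by simp))).const_add M
    simpa using this
  refine (Measure.hausdorffMeasure_le_liminf_sum 1 _ _ h6 B
    (Eventually.of_forall hB2) (Eventually.of_forall hB1)).trans ?_
  rw [← h2.liminf_eq]
  refine liminf_le_liminf (Eventually.of_forall fun k => ?_)
  simpa using hB3 k

theorem golab_open {X : Type*} [MetricSpace X] [MeasurableSpace X] [BorelSpace X]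
    (V : Set X) (hV : IsOpen V)
    (K : ℕ → Set X) (hKcpt : ∀ n, IsCompact (K n)) (hKconn : ∀ n, IsConnected (K n))
    (K' : Set X) (hK'cpt : IsCompact K') (hK'ne : K'.Nonempty)
    (hconv : Tendsto (fun n => Metric.hausdorffDist (K n) K') atTop (𝓝 0)) :
    μH[1] (K' ∩ V) ≤ liminf (fun n => μH[1] (K n ∩ V)) atTop := by
  by_contra hcon
  rw [not_le] at hcon
  obtain ⟨M, hM1, hM2⟩ := exists_between hcon
  have hfr : ∃ᶠ n in atTop, μH[1] (K n ∩ V) ≤ M :=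
    (frequently_lt_of_liminf_lt (by isBoundedDefault) hM1).mono fun n hn => hn.le
  have hMt : M ≠ ⊤ := (hM2.trans_le le_top).ne
  let ρ : ℕ → ℝ≥0∞ := fun k => ((k : ℝ≥0∞) + 1)⁻¹
  have hin := fun k => golab_inner V K hKcpt hKconn K' hK'cpt hK'ne hconv M hMt hfr (ρ k)
    (by simp [ρ]) (by simp [ρ])
  have hU : K' ∩ V ⊆ ⋃ k, (K' ∩ {x | 3 * ρ k ≤ Metric.infEDist x Vᶜ}) := by
    rintro x ⟨hxK, hxV⟩
    have h1 : 0 < Metric.infEDist x Vᶜ := by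
      rw [pos_iff_ne_zero]
      intro h0
      have := (Metric.mem_iff_infEDist_zero_of_closed hV.isClosed_compl).2 h0
      exact this hxV
    have h3 : Metric.infEDist x Vᶜ / 3 ≠ 0 := (ENNReal.div_pos h1.ne' (by simp)).ne'
    obtain ⟨k, hk⟩ := ENNReal.exists_inv_nat_lt h3
    refine mem_iUnion.2 ⟨k, hxK, ?_⟩
    show 3 * ρ k ≤ _
    have hρk : ρ k ≤ Metric.infEDist x Vᶜ / 3 := by
      refine le_trans ?_ hk.le
      exact ENNReal.inv_le_inv.2 le_self_add
    calc 3 * ρ k ≤ 3 * (Metric.infEDist x Vᶜ / 3) := by gcongr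
      _ ≤ _ := ENNReal.mul_div_le
  have hmono : Monotone fun k => (K' ∩ {x | 3 * ρ k ≤ Metric.infEDist x Vᶜ}) := by
    intro k l hkl x hx
    refine ⟨hx.1, ?_⟩
    have h2 : 3 * ρ k ≤ Metric.infEDist x Vᶜ := hx.2
    show 3 * ρ l ≤ _
    refine le_trans ?_ h2
    have : ρ l ≤ ρ k := by
      apply ENNReal.inv_le_inv.2
      gcongr
    gcongr
  have : μH[1] (K' ∩ V) ≤ M := by
    refine (measure_mono hU).trans ?_
    rw [hmono.measure_iUnion]
    exact iSup_le hin
  exact absurd hM2 (not_lt.2 this)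

/-- lower semicontinuity, along Hausdorff-converging sequences of nonempty compact
connected sets of finite `H¹`-measure in `closure Ω`, of the functional
`K ↦ ∫_{K ∩ U} φ dH¹` for a continuous weight `φ` with `0 ≤ c₁ ≤ φ ≤ c₂` on `closure Ω`. -/
theorem stmt11 (Ω : Set E2) (hΩo : IsOpen Ω) (hΩb : Bornology.IsBounded Ω)
    (U : Set E2) (hU : IsOpen U)
    (φ : E2 → ℝ) (hφcont : ContinuousOn φ (closure Ω))
    (c₁ c₂ : ℝ) (hc₁ : 0 ≤ c₁) (hc₁₂ : c₁ ≤ c₂)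
    (hφbd : ∀ x ∈ closure Ω, c₁ ≤ φ x ∧ φ x ≤ c₂)
    (K : ℕ → Set E2) (hKcpt : ∀ n, IsCompact (K n)) (hKconn : ∀ n, IsConnected (K n))
    (hKsub : ∀ n, K n ⊆ closure Ω) (hKfin : ∀ n, μH[1] (K n) < ⊤)
    (K' : Set E2) (hK'cpt : IsCompact K') (hK'conn : IsConnected K')
    (hK'sub : K' ⊆ closure Ω) (hK'fin : μH[1] K' < ⊤)
    (hconv : Tendsto (fun n => Metric.hausdorffDist (K n) K') atTop (𝓝 0)) :
    ∫⁻ x in K' ∩ U, ENNReal.ofReal (φ x) ∂(μH[1]) ≤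
      Filter.liminf (fun n => ∫⁻ x in K n ∩ U, ENNReal.ofReal (φ x) ∂(μH[1])) atTop := by
  have hlc : ∀ S : Set E2, IsCompact S → S ⊆ closure Ω →
      ∫⁻ x in S ∩ U, ENNReal.ofReal (φ x) ∂(μH[1]) =
        ∫⁻ t in Ioi (0 : ℝ), (μH[1] : Measure E2).restrict (S ∩ U) {x | t < φ x} := by
    intro S hS hSΩ
    have hmeas : MeasurableSet (S ∩ U) := hS.measurableSet.inter hU.measurableSet
    apply lintegral_eq_lintegral_meas_lt
    · filter_upwards [ae_restrict_mem hmeas] with x hx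
      exact hc₁.trans (hφbd x (hSΩ hx.1)).1
    · exact (hφcont.mono (inter_subset_left.trans hSΩ)).aemeasurable hmeas
  have hval : ∀ t : ℝ, ∃ V : Set E2, IsOpen V ∧ ∀ S : Set E2, IsCompact S → S ⊆ closure Ω →
      (μH[1] : Measure E2).restrict (S ∩ U) {x | t < φ x} = μH[1] (S ∩ V) := by
    intro t
    obtain ⟨W, hWo, hW⟩ := continuousOn_iff'.1 hφcont (Ioi t) isOpen_Ioi
    refine ⟨W ∩ U, hWo.inter hU, fun S hS hSΩ => ?_⟩
    rw [Measure.restrict_apply' (hS.measurableSet.inter hU.measurableSet)]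
    congr 1
    ext x
    have hx := Set.ext_iff.1 hW x
    simp only [mem_inter_iff, mem_preimage, mem_Ioi] at hx
    simp only [mem_inter_iff]
    constructor
    · rintro ⟨h1, h2, h3⟩
      exact ⟨h2, (hx.1 ⟨h1, hSΩ h2⟩).1, h3⟩
    · rintro ⟨h1, h2, h3⟩
      exact ⟨(hx.2 ⟨h2, hSΩ h1⟩).1, h1, h3⟩
  rw [hlc K' hK'cpt hK'sub]
  have heq : (fun n => ∫⁻ x in K n ∩ U, ENNReal.ofReal (φ x) ∂(μH[1])) = fun n =>
      ∫⁻ t in Ioi (0 : ℝ), (μH[1] : Measure E2).restrict (K n ∩ U) {x | t < φ x} :=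
    funext fun n => hlc (K n) (hKcpt n) (hKsub n)
  rw [heq]
  refine le_trans ?_ (lintegral_liminf_le fun n => ?_)
  · refine lintegral_mono fun t => ?_
    obtain ⟨V, hV, hVS⟩ := hval t
    have h1 : (fun n => (μH[1] : Measure E2).restrict (K n ∩ U) {x | t < φ x}) =
        fun n => μH[1] (K n ∩ V) := funext fun n => hVS _ (hKcpt n) (hKsub n)
    show _ ≤ liminf (fun n => (μH[1] : Measure E2).restrict (K n ∩ U) {x | t < φ x}) atTop
    rw [h1, hVS _ hK'cpt hK'sub]
    exact golab_open V hV K hKcpt hKconn K' hK'cpt hK'conn.nonempty hconv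
  · apply Antitone.measurable
    intro s t hst
    exact measure_mono fun x (hx : t < φ x) => lt_of_le_of_lt hst hx

end
end
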